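/- For every positive integer w and every ε > 0 there exists K such that: every finite poset P with w(P) ≤ w and π(P) ≥ K satisfies δ(P) > 1/2 − ε. -/

import Mathlib

open Finset

section Defs
variable (α : Type*) [Fintype α] [PartialOrder α]

/-- Linear extensions of a finite poset `α` with `n` elements: order-preserving
bijections to `Fin n` (representing the target `{1,…,n}`). -/
def LinExt : Type _ :=
  {f : α ≃ Fin (Fintype.card α) // ∀ x y : α, x < y → f x < f y}

instance : Finite (LinExt α) := by unfold LinExt; infer_instance

noncomputable instance : Fintype (LinExt α) := Fintype.ofFinite _

end Defs

section Defs2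
variable {α : Type*} [Fintype α] [PartialOrder α]

/-- the uniform probability `ℙ(E)` of an event `E` on linear extensions -/
noncomputable def Pr (E : LinExt α → Prop) : ℝ :=
  (Nat.card {f : LinExt α // E f} : ℝ) / (Nat.card (LinExt α) : ℝ)

/-- the value `f(x) ∈ {1,…,n}` of a linear extension at `x` -/
def val (f : LinExt α) (x : α) : ℕ := (f.1 x : ℕ) + 1

/-- `ℙ(x ≺ y)`, the probability that `x` precedes `y` in a uniform linear extension -/
noncomputable def prLT (x y : α) : ℝ := Pr (fun f => val f x < val f y)

/-- the expectation `𝔼 f(x)` for `f` uniform on `E(P)` -/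
noncomputable def expec (x : α) : ℝ :=
  (∑ f : LinExt α, (val f x : ℝ)) / (Nat.card (LinExt α) : ℝ)

/-- the variance `Var(f(x))` for `f` uniform on `E(P)` -/
noncomputable def variance (x : α) : ℝ :=
  (∑ f : LinExt α, ((val f x : ℝ) - expec x) ^ 2) / (Nat.card (LinExt α) : ℝ)

/-- the standard deviation `σ(x)` of `f(x)` -/
noncomputable def sigma (x : α) : ℝ := Real.sqrt (variance x)

/-- `π(x)`: the number of elements of the poset incomparable to `x` -/
noncomputable def piVal (x : α) : ℕ := Nat.card {y : α // ¬ x ≤ y ∧ ¬ y ≤ x}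

/-- `q(x) = max_{k ∈ {1,…,n}} ℙ(f(x) = k)` -/
noncomputable def qVal (x : α) : ℝ :=
  ⨆ k : Fin (Fintype.card α), Pr (fun f => val f x = (k : ℕ) + 1)

end Defs2

namespace Balance

open scoped Classical

noncomputable section

variable {Q : Type*} [Fintype Q] [PartialOrder Q]

/-- The position of `x` in the linear extension `f`, counted from `0`. -/
def rk (f : LinExt Q) (x : Q) : ℕ := (f.1 x : ℕ)

/-- The average of `X` over all linear extensions. -/
def ex (X : LinExt Q → ℝ) : ℝ := (∑ f, X f) / Fintype.card (LinExt Q)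

/-- The probability of `A` under a uniform linear extension. -/
def pb (A : LinExt Q → Prop) : ℝ := ex fun f => if A f then 1 else 0

instance : Nonempty (LinExt Q) := by
  let : Fintype (LinearExtension Q) := ‹Fintype Q›
  let e := Fintype.orderIsoFinOfCardEq (LinearExtension Q)
    (k := Fintype.card Q) (by exact Fintype.card_congr (Equiv.refl _))
  refine ⟨⟨(Equiv.refl Q : Q ≃ LinearExtension Q).trans e.symm.toEquiv, fun x y h => ?_⟩⟩
  have h1 : toLinearExtension x < toLinearExtension y :=
    lt_of_le_of_ne (toLinearExtension.monotone h.le) (fun hh => h.ne (by exact hh))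
  exact e.symm.lt_iff_lt.2 h1

lemma card_pos' : (0 : ℝ) < Fintype.card (LinExt Q) := by
  exact_mod_cast Fintype.card_pos

lemma rk_lt_card (f : LinExt Q) (x : Q) : rk f x < Fintype.card Q := (f.1 x).2

lemma rk_inj {f : LinExt Q} {x y : Q} : rk f x = rk f y ↔ x = y := by
  unfold rk
  rw [← Fin.ext_iff, f.1.injective.eq_iff]

lemma rk_lt {f : LinExt Q} {x y : Q} (h : x < y) : rk f x < rk f y := f.2 x y h

lemma rk_le {f : LinExt Q} {x y : Q} (h : x ≤ y) : rk f x ≤ rk f y := by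
  rcases h.eq_or_lt with rfl | h
  · exact le_rfl
  · exact (rk_lt h).le

lemma exists_rk_eq (f : LinExt Q) {j : ℕ} (hj : j < Fintype.card Q) : ∃ x, rk f x = j :=
  ⟨f.1.symm ⟨j, hj⟩, by simp [rk]⟩

lemma ex_add (X Y : LinExt Q → ℝ) : ex (fun f => X f + Y f) = ex X + ex Y := by
  simp [ex, Finset.sum_add_distrib, add_div]

lemma ex_sub (X Y : LinExt Q → ℝ) : ex (fun f => X f - Y f) = ex X - ex Y := by
  simp [ex, Finset.sum_sub_distrib, sub_div]

lemma ex_mul (c : ℝ) (X : LinExt Q → ℝ) : ex (fun f => c * X f) = c * ex X := by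
  simp [ex, ← Finset.mul_sum, mul_div_assoc]

lemma ex_const (c : ℝ) : ex (fun _ : LinExt Q => c) = c := by
  have := card_pos' (Q := Q)
  simp [ex]

lemma ex_sum {ι : Type*} (s : Finset ι) (X : ι → LinExt Q → ℝ) :
    ex (fun f => ∑ i ∈ s, X i f) = ∑ i ∈ s, ex (X i) := by
  simp only [ex]
  rw [Finset.sum_comm, Finset.sum_div]

lemma ex_mono {X Y : LinExt Q → ℝ} (h : ∀ f, X f ≤ Y f) : ex X ≤ ex Y := by
  unfold ex
  have := card_pos' (Q := Q)
  gcongr with f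
  exact h f

lemma ex_nonneg {X : LinExt Q → ℝ} (h : ∀ f, 0 ≤ X f) : 0 ≤ ex X := by
  have := ex_mono (X := fun _ => 0) h
  rwa [ex_const] at this

lemma ex_comp {σ : LinExt Q → LinExt Q} (hσ : Function.Involutive σ) (X : LinExt Q → ℝ) :
    ex (fun f => X (σ f)) = ex X := by
  unfold ex
  congr 1
  exact Equiv.sum_comp hσ.toPerm X

lemma pb_nonneg (A : LinExt Q → Prop) : 0 ≤ pb A :=
  ex_nonneg fun f => by split_ifs <;> norm_num

lemma pb_mono {A B : LinExt Q → Prop} (h : ∀ f, A f → B f) : pb A ≤ pb B :=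
  ex_mono fun f => by
    by_cases hA : A f
    · simp [hA, h f hA]
    · simp only [hA, if_false]; split_ifs <;> norm_num

lemma pb_congr {A B : LinExt Q → Prop} (h : ∀ f, A f ↔ B f) : pb A = pb B :=
  le_antisymm (pb_mono fun f => (h f).1) (pb_mono fun f => (h f).2)

lemma pb_le_one (A : LinExt Q → Prop) : pb A ≤ 1 := by
  have : pb A ≤ ex (fun _ : LinExt Q => 1) := ex_mono fun f => by split_ifs <;> norm_num
  rwa [ex_const] at this

lemma pb_true {A : LinExt Q → Prop} (h : ∀ f, A f) : pb A = 1 := by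
  simp [pb, h, ex_const]

lemma pb_false {A : LinExt Q → Prop} (h : ∀ f, ¬ A f) : pb A = 0 := by
  simp [pb, h, ex_const]

lemma pb_not (A : LinExt Q → Prop) : pb (fun f => ¬ A f) = 1 - pb A := by
  have h : pb A + pb (fun f => ¬ A f) = 1 := by
    unfold pb
    refine (ex_add _ _).symm.trans (Eq.trans ?_ (ex_const (Q := Q) 1))
    refine congrArg ex (funext fun f => ?_)
    by_cases hA : A f <;> simp [hA]
  linarith

lemma pb_or_le {A B C : LinExt Q → Prop} (h : ∀ f, A f → B f ∨ C f) : pb A ≤ pb B + pb C := by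
  unfold pb
  rw [← ex_add]
  refine ex_mono fun f => ?_
  by_cases hA : A f
  · rcases h f hA with hB | hC
    · simp only [hA, hB, if_true]; split_ifs <;> norm_num
    · simp only [hA, hC, if_true]; split_ifs <;> norm_num
  · simp only [hA, if_false]; split_ifs <;> norm_num

lemma pb_exists_le {ι : Type*} (s : Finset ι) {A : LinExt Q → Prop} (B : ι → LinExt Q → Prop)
    (h : ∀ f, A f → ∃ i ∈ s, B i f) : pb A ≤ ∑ i ∈ s, pb (B i) := by
  unfold pb
  rw [← ex_sum]
  refine ex_mono fun f => ?_
  have h0 : ∀ i ∈ s, (0 : ℝ) ≤ if B i f then 1 else 0 := fun i _ => by split_ifs <;> norm_num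
  by_cases hA : A f
  · obtain ⟨i, hi, hB⟩ := h f hA
    simp only [hA, if_true]
    refine le_trans ?_ (Finset.single_le_sum h0 hi)
    simp [hB]
  · simp only [hA, if_false]
    exact Finset.sum_nonneg h0

lemma sum_pb_le {ι : Type*} (s : Finset ι) {A : LinExt Q → Prop} (B : ι → LinExt Q → Prop)
    (h : ∀ f, ∀ i ∈ s, B i f → A f) (hd : ∀ f, ∀ i ∈ s, ∀ j ∈ s, B i f → B j f → i = j) :
    ∑ i ∈ s, pb (B i) ≤ pb A := by
  unfold pb
  rw [← ex_sum]
  refine ex_mono fun f => ?_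
  by_cases hA : ∃ i ∈ s, B i f
  · obtain ⟨i, hi, hB⟩ := hA
    rw [Finset.sum_eq_single_of_mem i hi]
    · simp [hB, h f i hi hB]
    · intro j hj hji
      rw [if_neg]
      exact fun hBj => hji (hd f j hj i hi hBj hB)
  · push Not at hA
    rw [Finset.sum_eq_zero fun i hi => if_neg (hA i hi)]
    split_ifs <;> norm_num

lemma markov {X : LinExt Q → ℝ} (hX : ∀ f, 0 ≤ X f) (a : ℝ) :
    a * pb (fun f => a ≤ X f) ≤ ex X := by
  unfold pb
  rw [← ex_mul]
  refine ex_mono fun f => ?_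
  split_ifs with h
  · simpa using h
  · simpa using hX f

lemma exists_of_pb_pos {A : LinExt Q → Prop} (h : 0 < pb A) : ∃ f, A f := by
  by_contra! hA
  rw [pb_false hA] at h
  exact lt_irrefl _ h

/-- The mean position of `x`. -/
def mn (x : Q) : ℝ := ex fun f => (rk f x : ℝ)

lemma mn_sub (u v : Q) : mn v - mn u = ex fun f => (rk f v : ℝ) - rk f u := by
  rw [ex_sub]; rfl

lemma mn_add_one_le {u v : Q} (h : u < v) : mn u + 1 ≤ mn v := by
  have : (1 : ℝ) ≤ mn v - mn u := by
    rw [mn_sub, ← ex_const (Q := Q) 1]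
    refine ex_mono fun f => ?_
    have : rk f u + 1 ≤ rk f v := rk_lt h
    have : (rk f u + 1 : ℝ) ≤ rk f v := by exact_mod_cast this
    linarith
  linarith

lemma mn_lt {u v : Q} (h : u < v) : mn u < mn v := by linarith [mn_add_one_le h]

lemma mn_le {u v : Q} (h : u ≤ v) : mn u ≤ mn v := by
  rcases h.eq_or_lt with rfl | h
  · exact le_rfl
  · exact (mn_lt h).le

/-- The probability that `x` precedes `y`. -/
def pr (x y : Q) : ℝ := pb fun f => rk f x < rk f y

lemma prLT_eq (x y : Q) : prLT x y = pr x y := by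
  unfold prLT Pr pr pb ex
  rw [Nat.card_eq_fintype_card, Nat.card_eq_fintype_card, Fintype.card_subtype]
  congr 1
  simp [_root_.val, rk]

lemma pr_add {x y : Q} (h : x ≠ y) : pr x y + pr y x = 1 := by
  have : pr y x = pb fun f => ¬ (rk f x < rk f y) :=
    pb_congr fun f => by
      have : rk f x ≠ rk f y := fun hh => h (rk_inj.1 hh)
      omega
  rw [this, pb_not]
  unfold pr
  ring

lemma pr_of_lt {x y : Q} (h : x < y) : pr x y = 1 := pb_true fun _ => rk_lt h

end

end Balance

namespace Balance

open scoped Classical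

noncomputable section

variable {Q : Type*} [Fintype Q] [PartialOrder Q]

/-- The elements at positions `j` and `j + 1` exist and may be exchanged. -/
def Swappable (j : ℕ) (f : LinExt Q) : Prop :=
  ∃ x y, rk f x = j ∧ rk f y = j + 1 ∧ ¬ x < y

lemma swappable_lt {j : ℕ} {f : LinExt Q} (h : Swappable j f) : j + 1 < Fintype.card Q := by
  obtain ⟨x, y, -, hy, -⟩ := h
  rw [← hy]
  exact rk_lt_card f y

lemma val_swap {n : ℕ} (i j k : Fin n) :
    (Equiv.swap i j k : ℕ) = if (k : ℕ) = i then (j : ℕ) else if (k : ℕ) = j then i else k := by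
  rw [Equiv.swap_apply_def]
  simp only [Fin.ext_iff]
  split_ifs <;> rfl

/-- Exchange the elements at positions `j` and `j + 1` when this is possible. -/
def swp (j : ℕ) (f : LinExt Q) : LinExt Q :=
  if h : Swappable j f then
    ⟨f.1.trans (Equiv.swap ⟨j, by have := swappable_lt h; omega⟩ ⟨j + 1, swappable_lt h⟩), by
      intro x y hxy
      obtain ⟨a, b, ha, hb, hab⟩ := h
      have h1 : rk f x < rk f y := rk_lt hxy
      have h2 : ¬ (rk f x = j ∧ rk f y = j + 1) := by
        rintro ⟨hx, hy⟩
        rw [← ha, rk_inj] at hx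
        rw [← hb, rk_inj] at hy
        exact hab (hx ▸ hy ▸ hxy)
      rw [Fin.lt_def]
      simp only [Equiv.trans_apply, val_swap]
      change (if rk f x = j then _ else if rk f x = j + 1 then _ else rk f x) <
        (if rk f y = j then _ else if rk f y = j + 1 then _ else rk f y)
      split_ifs <;> omega⟩
  else f

lemma rk_swp {j : ℕ} {f : LinExt Q} (h : Swappable j f) (z : Q) :
    rk (swp j f) z = if rk f z = j then j + 1 else if rk f z = j + 1 then j else rk f z := by
  have e : swp j f = _ := dif_pos h
  rw [e]
  exact val_swap _ _ (f.1 z)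

lemma swp_of_not {j : ℕ} {f : LinExt Q} (h : ¬ Swappable j f) : swp j f = f := dif_neg h

lemma ext_rk {f g : LinExt Q} (h : ∀ x, rk f x = rk g x) : f = g :=
  Subtype.ext (Equiv.ext fun x => Fin.ext (h x))

lemma Swappable.swp {j : ℕ} {f : LinExt Q} (h : Swappable j f) : Swappable j (swp j f) := by
  have h' := h
  obtain ⟨x, y, hx, hy, -⟩ := h
  refine ⟨y, x, ?_, ?_, fun hyx => ?_⟩
  · rw [rk_swp h', hy]; simp
  · rw [rk_swp h', hx]; simp
  · have := rk_lt (f := f) hyx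
    omega

lemma swp_invol (j : ℕ) : Function.Involutive (swp j : LinExt Q → LinExt Q) := by
  intro f
  by_cases h : Swappable j f
  · refine ext_rk fun x => ?_
    rw [rk_swp h.swp, rk_swp h]
    split_ifs <;> omega
  · rw [swp_of_not h, swp_of_not h]

lemma rk_swp_of_ne {j : ℕ} {f : LinExt Q} {z : Q} (h1 : rk f z ≠ j) (h2 : rk f z ≠ j + 1) :
    rk (swp j f) z = rk f z := by
  by_cases h : Swappable j f
  · rw [rk_swp h, if_neg h1, if_neg h2]
  · rw [swp_of_not h]

lemma rk_swp_lt_iff {j i : ℕ} (f : LinExt Q) (z : Q) (hi : i ≠ j + 1) :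
    rk (swp j f) z < i ↔ rk f z < i := by
  by_cases h : Swappable j f
  · rw [rk_swp h]
    split_ifs <;> omega
  · rw [swp_of_not h]

lemma pb_eq_card (A : LinExt Q → Prop) :
    pb A = ((Finset.univ.filter A).card : ℝ) / Fintype.card (LinExt Q) := by
  simp [pb, ex]

lemma pb_le_of_injOn {A B : LinExt Q → Prop} (σ : LinExt Q → LinExt Q)
    (h : ∀ f, A f → B (σ f)) (hinj : ∀ f g, A f → A g → σ f = σ g → f = g) : pb A ≤ pb B := by
  rw [pb_eq_card, pb_eq_card]
  have := card_pos' (Q := Q)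
  refine div_le_div_of_nonneg_right (Nat.cast_le.2 ?_) this.le
  refine Finset.card_le_card_of_injOn σ (fun f hf => ?_) (fun f hf g hg hfg => ?_)
  · simp only [Finset.coe_filter, Finset.mem_univ, true_and, Set.mem_ofPred_eq] at hf ⊢
    exact h f hf
  · simp only [Finset.coe_filter, Finset.mem_univ, true_and, Set.mem_ofPred_eq] at hf hg
    exact hinj f g hf hg hfg

lemma pb_le_move_up (v : Q) {A B : LinExt Q → Prop}
    (h : ∀ f y, A f → rk f y = rk f v + 1 → ¬ v < y → ∀ g, rk g v = rk f v + 1 →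
      rk g y = rk f v → (∀ z, z ≠ v → z ≠ y → rk g z = rk f z) → B g) :
    pb (fun f => A f ∧ ∃ y, rk f y = rk f v + 1 ∧ ¬ v < y) ≤ pb B := by
  have key : ∀ f y, rk f y = rk f v + 1 → ¬ v < y → Swappable (rk f v) f :=
    fun f y h1 h2 => ⟨v, y, rfl, h1, h2⟩
  refine pb_le_of_injOn (fun f => swp (rk f v) f) ?_ ?_
  · rintro f ⟨hA, y, h1, h2⟩
    refine h f y hA h1 h2 _ ?_ ?_ ?_
    · rw [rk_swp (key f y h1 h2)]; simp
    · rw [rk_swp (key f y h1 h2), h1]; simp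
    · intro z hz hzy
      refine rk_swp_of_ne (fun hh => hz (rk_inj.1 hh)) (fun hh => hzy ?_)
      rw [← h1] at hh
      exact rk_inj.1 hh
  · rintro f g ⟨-, y, h1, h2⟩ ⟨-, y', h1', h2'⟩ hfg
    have hv : rk f v = rk g v := by
      have h3 := rk_swp (key f y h1 h2) v
      have h4 := rk_swp (key g y' h1' h2') v
      simp only [if_true] at h3 h4
      rw [show _ = _ from hfg] at h3
      omega
    simp only [hv] at hfg
    exact (swp_invol _).injective hfg

lemma pb_le_move_down (v : Q) {A B : LinExt Q → Prop}
    (h : ∀ f y, A f → rk f y + 1 = rk f v → ¬ y < v → ∀ g, rk g v + 1 = rk f v →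
      rk g y = rk f v → (∀ z, z ≠ v → z ≠ y → rk g z = rk f z) → B g) :
    pb (fun f => A f ∧ ∃ y, rk f y + 1 = rk f v ∧ ¬ y < v) ≤ pb B := by
  have key : ∀ f y, rk f y + 1 = rk f v → ¬ y < v → Swappable (rk f v - 1) f :=
    fun f y h1 h2 => ⟨y, v, by omega, by omega, h2⟩
  refine pb_le_of_injOn (fun f => swp (rk f v - 1) f) ?_ ?_
  · rintro f ⟨hA, y, h1, h2⟩
    refine h f y hA h1 h2 _ ?_ ?_ ?_
    · rw [rk_swp (key f y h1 h2)]; split_ifs <;> omega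
    · rw [rk_swp (key f y h1 h2)]; split_ifs <;> omega
    · intro z hz hzy
      have hz' : rk f z ≠ rk f v := fun hh => hz (rk_inj.1 hh)
      have hzy' : rk f z ≠ rk f y := fun hh => hzy (rk_inj.1 hh)
      exact rk_swp_of_ne (by omega) (by omega)
  · rintro f g ⟨-, y, h1, h2⟩ ⟨-, y', h1', h2'⟩ hfg
    have hv : rk f v = rk g v := by
      have h3 := rk_swp (key f y h1 h2) v
      have h4 := rk_swp (key g y' h1' h2') v
      rw [if_neg (by omega), if_pos (by omega)] at h3 h4
      rw [show _ = _ from hfg] at h3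
      omega
    simp only [hv] at hfg
    exact (swp_invol _).injective hfg

/-- The probability that `v` comes immediately after `u`. -/
def cp (u v : Q) : ℝ := pb fun f => rk f v = rk f u + 1

/-- The probability that the element immediately after `u` is greater than `u`. -/
def up (u : Q) : ℝ := pb fun f => ∃ v, rk f v = rk f u + 1 ∧ u < v

/-- The probability that the element immediately before `u` is smaller than `u`. -/
def dn (u : Q) : ℝ := pb fun f => ∃ v, rk f v + 1 = rk f u ∧ v < u

lemma cp_nonneg (u v : Q) : 0 ≤ cp u v := pb_nonneg _

lemma up_le_one (u : Q) : up u ≤ 1 := pb_le_one _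

lemma up_eq_sum (u : Q) : up u = ∑ v ∈ Finset.univ.filter (u < ·), cp u v := by
  refine le_antisymm (pb_exists_le _ _ fun f => ?_) (sum_pb_le _ _ (fun f v hv h => ?_) ?_)
  · rintro ⟨v, h1, h2⟩
    exact ⟨v, by simpa using h2, h1⟩
  · exact ⟨v, h, by simpa using hv⟩
  · intro f v _ v' _ h h'
    exact rk_inj.1 (h.trans h'.symm)

lemma dn_eq_sum (u : Q) : dn u = ∑ v ∈ Finset.univ.filter (· < u), cp v u := by
  refine le_antisymm (pb_exists_le _ _ fun f => ?_) (sum_pb_le _ _ (fun f v hv h => ?_) ?_)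
  · rintro ⟨v, h1, h2⟩
    exact ⟨v, by simpa using h2, h1.symm⟩
  · exact ⟨v, h.symm, by simpa using hv⟩
  · intro f v _ v' _ h h'
    exact rk_inj.1 (Nat.succ_injective (h.symm.trans h'))

lemma sum_telescope_le {a b : ℕ → ℝ} (k m : ℕ) (h : ∀ i, k ≤ i → a i ≤ b i + a (i + 1)) :
    a k ≤ ∑ i ∈ Finset.range m, b (k + i) + a (k + m) := by
  induction m with
  | zero => simp
  | succ m ih =>
    rw [Finset.sum_range_succ]
    have := h (k + m) (by omega)
    rw [← add_assoc]
    linarith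

section Bounded

variable [BoundedOrder Q]

lemma exists_next {f : LinExt Q} {u : Q} (hu : u ≠ ⊤) : ∃ y, rk f y = rk f u + 1 := by
  refine exists_rk_eq f ?_
  have h1 : rk f u < rk f ⊤ := rk_lt (lt_top_iff_ne_top.2 hu)
  have h2 := rk_lt_card f ⊤
  omega

lemma exists_prev {f : LinExt Q} {u : Q} (hu : u ≠ ⊥) : ∃ y, rk f y + 1 = rk f u := by
  have h1 : rk f ⊥ < rk f u := rk_lt (bot_lt_iff_ne_bot.2 hu)
  obtain ⟨y, hy⟩ := exists_rk_eq f (j := rk f u - 1) (by have := rk_lt_card f u; omega)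
  exact ⟨y, by omega⟩

lemma up_bot [Nontrivial Q] : up (⊥ : Q) = 1 := by
  refine pb_true fun f => ?_
  obtain ⟨y, hy⟩ := exists_next (f := f) (bot_ne_top (α := Q))
  refine ⟨y, hy, bot_lt_iff_ne_bot.2 ?_⟩
  rintro rfl
  omega

lemma one_sub_up {u : Q} (hu : u ≠ ⊤) :
    1 - up u = pb fun f => ∃ y, rk f y = rk f u + 1 ∧ ¬ u < y := by
  unfold up
  rw [← pb_not]
  refine pb_congr fun f => ?_
  obtain ⟨y, hy⟩ := exists_next (f := f) hu
  constructor
  · intro h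
    exact ⟨y, hy, fun h' => h ⟨y, hy, h'⟩⟩
  · rintro ⟨z, hz, hz'⟩ ⟨z', hz1, hz2⟩
    have : z = z' := rk_inj.1 (hz.trans hz1.symm)
    exact hz' (this ▸ hz2)

lemma one_sub_dn {u : Q} (hu : u ≠ ⊥) :
    1 - dn u = pb fun f => ∃ y, rk f y + 1 = rk f u ∧ ¬ y < u := by
  unfold dn
  rw [← pb_not]
  refine pb_congr fun f => ?_
  obtain ⟨y, hy⟩ := exists_prev (f := f) hu
  constructor
  · intro h
    exact ⟨y, hy, fun h' => h ⟨y, hy, h'⟩⟩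
  · rintro ⟨z, hz, hz'⟩ ⟨z', hz1, hz2⟩
    have : z = z' := rk_inj.1 (Nat.succ_injective (hz.trans hz1.symm))
    exact hz' (this ▸ hz2)

lemma up_eq_dn {u : Q} (h1 : u ≠ ⊥) (h2 : u ≠ ⊤) : up u = dn u := by
  have hle : 1 - up u ≤ 1 - dn u := by
    rw [one_sub_up h2, one_sub_dn h1]
    refine le_trans (pb_mono fun f h => ⟨trivial, h⟩) (pb_le_move_up u (A := fun _ => True) ?_)
    intro f y _ hy1 _ g hg1 hg2 _
    refine ⟨y, by omega, fun hh => ?_⟩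
    have := rk_lt (f := f) hh
    omega
  have hge : 1 - dn u ≤ 1 - up u := by
    rw [one_sub_up h2, one_sub_dn h1]
    refine le_trans (pb_mono fun f h => ⟨trivial, h⟩) (pb_le_move_down u (A := fun _ => True) ?_)
    intro f y _ hy1 _ g hg1 hg2 _
    refine ⟨y, by omega, fun hh => ?_⟩
    have := rk_lt (f := f) hh
    omega
  linarith

lemma pb_diff_le_up {u v : Q} (hv : v ≠ ⊤) {k : ℕ} (hk : 1 ≤ k) :
    pb (fun f => rk f v = rk f u + k) ≤ up v := by
  set n := Fintype.card Q
  have h := sum_telescope_le (a := fun k => pb (fun f => rk f v = rk f u + k))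
    (b := fun k => pb (fun f => rk f v = rk f u + k ∧ ∃ y, rk f y = rk f v + 1 ∧ v < y)) k n ?_
  · refine h.trans ?_
    have h0 : pb (fun f => rk f v = rk f u + (k + n)) = 0 := pb_false fun f hf => by
      have := rk_lt_card f v
      omega
    rw [h0, add_zero]
    refine sum_pb_le _ _ (fun f i _ hf => hf.2) (fun f i _ j _ hi hj => ?_)
    have := hi.1
    have := hj.1
    omega
  · intro i hi
    have h1 : pb (fun f => rk f v = rk f u + i ∧ ∃ y, rk f y = rk f v + 1 ∧ ¬ v < y) ≤
        pb (fun f => rk f v = rk f u + (i + 1)) := by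
      refine pb_le_move_up v ?_
      intro f y hA hy _ g hg1 _ hg
      have hu : rk g u = rk f u := hg u (by rintro rfl; omega) (by rintro rfl; omega)
      omega
    refine le_trans ?_ (add_le_add le_rfl h1)
    refine pb_or_le fun f hf => ?_
    obtain ⟨y, hy⟩ := exists_next (f := f) hv
    by_cases hvy : v < y
    · exact Or.inl ⟨hf, y, hy, hvy⟩
    · exact Or.inr ⟨hf, y, hy, hvy⟩

lemma pb_diff_le_dn {u v : Q} (hu : u ≠ ⊥) {k : ℕ} (hk : 1 ≤ k) :
    pb (fun f => rk f v = rk f u + k) ≤ dn u := by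
  set n := Fintype.card Q
  have h := sum_telescope_le (a := fun k => pb (fun f => rk f v = rk f u + k))
    (b := fun k => pb (fun f => rk f v = rk f u + k ∧ ∃ y, rk f y + 1 = rk f u ∧ y < u)) k n ?_
  · refine h.trans ?_
    have h0 : pb (fun f => rk f v = rk f u + (k + n)) = 0 := pb_false fun f hf => by
      have := rk_lt_card f v
      omega
    rw [h0, add_zero]
    refine sum_pb_le _ _ (fun f i _ hf => hf.2) (fun f i _ j _ hi hj => ?_)
    have := hi.1
    have := hj.1
    omega
  · intro i hi
    have h1 : pb (fun f => rk f v = rk f u + i ∧ ∃ y, rk f y + 1 = rk f u ∧ ¬ y < u) ≤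
        pb (fun f => rk f v = rk f u + (i + 1)) := by
      refine pb_le_move_down u ?_
      intro f y hA hy _ g hg1 _ hg
      have hv : rk g v = rk f v := hg v (by rintro rfl; omega) (by rintro rfl; omega)
      omega
    refine le_trans ?_ (add_le_add le_rfl h1)
    refine pb_or_le fun f hf => ?_
    obtain ⟨y, hy⟩ := exists_prev (f := f) hu
    by_cases hvy : y < u
    · exact Or.inl ⟨hf, y, hy, hvy⟩
    · exact Or.inr ⟨hf, y, hy, hvy⟩

/-- The probability that `v` comes after `u`, by at most `t` places. -/
def near (u v : Q) (t : ℕ) : ℝ := pb fun f => rk f u < rk f v ∧ rk f v ≤ rk f u + t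

omit [BoundedOrder Q] in
lemma near_le_of {u v : Q} {c : ℝ} (h : ∀ k, 1 ≤ k → pb (fun f => rk f v = rk f u + k) ≤ c)
    (t : ℕ) : near u v t ≤ t * c := by
  have : near u v t ≤ ∑ i ∈ Finset.range t, pb (fun f => rk f v = rk f u + (i + 1)) := by
    refine pb_exists_le _ _ fun f hf => ⟨rk f v - rk f u - 1, ?_, ?_⟩
    · simp only [Finset.mem_range]; omega
    · omega
  refine this.trans ((Finset.sum_le_sum fun i _ => h (i + 1) (by omega)).trans ?_)
  simp

lemma near_le_up {u v : Q} (hv : v ≠ ⊤) (t : ℕ) : near u v t ≤ t * up v :=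
  near_le_of (fun _ hk => pb_diff_le_up hv hk) t

lemma near_le_dn {u v : Q} (hu : u ≠ ⊥) (t : ℕ) : near u v t ≤ t * dn u :=
  near_le_of (fun _ hk => pb_diff_le_dn hu hk) t

omit [BoundedOrder Q] in
lemma near_eq_one_of_lt {u v : Q} (h : u < v) : near u v (Fintype.card Q) = 1 :=
  pb_true fun f => ⟨rk_lt h, by have := rk_lt_card f v; omega⟩

lemma up_pos [Nontrivial Q] {u : Q} (hu : u ≠ ⊤) : 0 < up u := by
  by_cases h : u = ⊥
  · rw [h, up_bot]; norm_num
  · have h1 := near_le_up (u := ⊥) hu (Fintype.card Q)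
    rw [near_eq_one_of_lt (bot_lt_iff_ne_bot.2 h)] at h1
    by_contra! hh
    have : (Fintype.card Q : ℝ) * up u ≤ 0 := mul_nonpos_of_nonneg_of_nonpos (by positivity) hh
    linarith

lemma dn_pos {u : Q} (hu : u ≠ ⊥) : 0 < dn u := by
  by_cases h : u = ⊤
  · have h1 := near_le_dn (v := ⊤) hu (Fintype.card Q)
    subst h
    have : dn (⊤ : Q) = 1 := by
      refine pb_true fun f => ?_
      obtain ⟨y, hy⟩ := exists_prev (f := f) hu
      refine ⟨y, hy, lt_top_iff_ne_top.2 ?_⟩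
      rintro rfl
      omega
    rw [this]; norm_num
  · have h1 := near_le_dn (v := ⊤) hu (Fintype.card Q)
    rw [near_eq_one_of_lt (lt_top_iff_ne_top.2 h)] at h1
    by_contra! hh
    have : (Fintype.card Q : ℝ) * dn u ≤ 0 := mul_nonpos_of_nonneg_of_nonpos (by positivity) hh
    linarith

omit [BoundedOrder Q] in
lemma one_le_of_near {u v : Q} (h : u < v) {c : ℝ} (hc : 0 < c)
    (hn : ∀ t : ℕ, near u v t ≤ t * c) : 1 ≤ 4 * c * (mn v - mn u) := by
  set t := ⌊1 / (2 * c)⌋₊ with ht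
  have h1 : (t : ℝ) ≤ 1 / (2 * c) := Nat.floor_le (by positivity)
  have h2 : 1 / (2 * c) < t + 1 := Nat.lt_floor_add_one _
  have h3 : near u v t ≤ 1 / 2 := by
    refine (hn t).trans ?_
    calc (t : ℝ) * c ≤ 1 / (2 * c) * c := by gcongr
      _ = 1 / 2 := by field_simp
  have h4 := markov (X := fun f => (rk f v : ℝ) - rk f u) (fun f => by
    have : rk f u < rk f v := rk_lt h
    have : (rk f u : ℝ) < rk f v := by exact_mod_cast this
    linarith) (t + 1)
  rw [← mn_sub] at h4
  have h5 : pb (fun f => (t + 1 : ℝ) ≤ (rk f v : ℝ) - rk f u) = 1 - near u v t := by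
    unfold near
    rw [← pb_not]
    refine pb_congr fun f => ?_
    have h6 : rk f u < rk f v := rk_lt h
    rw [le_sub_iff_add_le]
    have : ((t : ℝ) + 1 + rk f u ≤ rk f v) ↔ t + 1 + rk f u ≤ rk f v := by norm_cast
    rw [this]
    omega
  rw [h5] at h4
  have h6 : 1 / (2 * c) * (1 / 2) ≤ mn v - mn u := by
    refine le_trans ?_ h4
    have : (0 : ℝ) ≤ t := by positivity
    have h7 : (0 : ℝ) < 1 / (2 * c) := by positivity
    nlinarith
  calc 1 = 4 * c * (1 / (2 * c) * (1 / 2)) := by field_simp; norm_num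
    _ ≤ _ := by gcongr

lemma one_le_dn_mul {u v : Q} (h : u < v) (hu : u ≠ ⊥) :
    1 ≤ 4 * dn u * (mn v - mn u) :=
  one_le_of_near h (dn_pos hu) (near_le_dn hu)

end Bounded

end

end Balance

namespace Balance

open scoped Classical

noncomputable section

/-- Compositions of `N` into `n` positive parts. -/
def comps (n N : ℕ) : Finset (Fin n → ℕ) :=
  (Fintype.piFinset fun _ => Finset.range (N + 1)).filter fun g => (∀ i, 1 ≤ g i) ∧ ∑ i, g i = N

variable {n N : ℕ}

lemma mem_comps {g : Fin n → ℕ} : g ∈ comps n N ↔ (∀ i, 1 ≤ g i) ∧ ∑ i, g i = N := by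
  unfold comps
  rw [Finset.mem_filter, Fintype.mem_piFinset, and_iff_right_of_imp]
  rintro ⟨-, h⟩ i
  rw [Finset.mem_range, Nat.lt_succ_iff, ← h]
  exact Finset.single_le_sum (fun _ _ => Nat.zero_le _) (Finset.mem_univ i)

lemma sum_comps_comp (σ : Equiv.Perm (Fin n)) (F : (Fin n → ℕ) → ℝ) :
    ∑ g ∈ comps n N, F (fun i => g (σ i)) = ∑ g ∈ comps n N, F g := by
  refine Finset.sum_nbij' (fun g i => g (σ i)) (fun g i => g (σ.symm i)) ?_ ?_ ?_ ?_ ?_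
  · intro g hg
    rw [mem_comps] at hg ⊢
    exact ⟨fun i => hg.1 _, by rw [Equiv.sum_comp σ]; exact hg.2⟩
  · intro g hg
    rw [mem_comps] at hg ⊢
    exact ⟨fun i => hg.1 _, by rw [Equiv.sum_comp σ.symm]; exact hg.2⟩
  · intro g _; simp
  · intro g _; simp
  · intro g _; rfl

lemma sum_comps_apply (hn : 0 < n) (M : ℕ) (i : Fin n) :
    ∑ g ∈ comps n (n * M), (g i : ℝ) = M * (comps n (n * M)).card := by
  have h1 : ∀ j, ∑ g ∈ comps n (n * M), (g j : ℝ) = ∑ g ∈ comps n (n * M), (g i : ℝ) := by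
    intro j
    rw [← sum_comps_comp (Equiv.swap i j) fun g => (g i : ℝ)]
    simp
  have h2 : ∑ j, ∑ g ∈ comps n (n * M), (g j : ℝ) = n * M * (comps n (n * M)).card := by
    rw [Finset.sum_comm, Finset.sum_congr rfl (g := fun _ => (n * M : ℝ))]
    · simp [mul_comm]
    · intro g hg
      have := (mem_comps.1 hg).2
      exact_mod_cast this
  rw [Finset.sum_congr rfl fun j _ => h1 j] at h2
  simp only [Finset.sum_const, Finset.card_univ, Fintype.card_fin, nsmul_eq_mul] at h2
  have : (0 : ℝ) < n := by exact_mod_cast hn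
  have h3 : (n : ℝ) * (∑ g ∈ comps n (n * M), (g i : ℝ)) = n * (M * (comps n (n * M)).card) := by
    rw [h2]; ring
  exact mul_left_cancel₀ this.ne' h3

lemma sum_comps_sq_le {i j : Fin n} (hij : i ≠ j) :
    ∑ g ∈ comps n N, (g i : ℝ) ^ 2 ≤ 2 * ∑ g ∈ comps n N, (g i : ℝ) * g j := by
  set A := (comps n N).sigma fun g => Finset.Icc 1 (g i)
  set B := (comps n N).sigma fun g => Finset.Icc 1 (g j)
  let φ : (Σ _ : Fin n → ℕ, ℕ) → (Σ _ : Fin n → ℕ, ℕ) := fun x =>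
    ⟨Function.update (Function.update x.1 j (x.1 i + x.1 j - x.2)) i x.2, x.1 i - x.2 + 1⟩
  have hi : ∀ x, (φ x).1 i = x.2 := fun x => by simp [φ]
  have hj : ∀ x, (φ x).1 j = x.1 i + x.1 j - x.2 := fun x => by simp [φ, hij.symm]
  have hk : ∀ x k, k ≠ i → k ≠ j → (φ x).1 k = x.1 k := fun x k h1 h2 => by simp [φ, h1, h2]
  have hA : ∀ x, x ∈ A ↔ x.1 ∈ comps n N ∧ 1 ≤ x.2 ∧ x.2 ≤ x.1 i := fun x => by simp [A]
  have hB : ∀ x, x ∈ B ↔ x.1 ∈ comps n N ∧ 1 ≤ x.2 ∧ x.2 ≤ x.1 j := fun x => by simp [B]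
  have hmaps : ∀ x ∈ A, φ x ∈ B := by
    intro x hx
    obtain ⟨hx, h1, h2⟩ := (hA x).1 hx
    have hx' := mem_comps.1 hx
    have h3 := hx'.1 j
    refine (hB _).2 ⟨mem_comps.2 ⟨fun k => ?_, ?_⟩, ?_, ?_⟩
    · by_cases hki : k = i
      · rw [hki, hi]; exact h1
      · by_cases hkj : k = j
        · rw [hkj, hj]; omega
        · rw [hk x k hki hkj]; exact hx'.1 k
    · rw [← hx'.2]
      have hs : ∀ g : Fin n → ℕ, ∑ k, g k = g i + g j +
          ∑ k ∈ (Finset.univ.erase i).erase j, g k := fun g => by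
        rw [add_assoc, Finset.add_sum_erase _ _ (by simp [hij.symm]),
          Finset.add_sum_erase _ _ (by simp)]
      rw [hs, hs x.1, hi, hj, Finset.sum_congr rfl fun k hk' => ?_]
      · congr 1; omega
      · simp only [Finset.mem_erase] at hk'
        exact hk x k hk'.2.1 hk'.1
    · change 1 ≤ x.1 i - x.2 + 1; omega
    · rw [hj]; change x.1 i - x.2 + 1 ≤ _; omega
  have hinj : Set.InjOn φ A := by
    intro x hx y hy hxy
    obtain ⟨hx, h1, h2⟩ := (hA x).1 hx
    obtain ⟨hy, h3, h4⟩ := (hA y).1 hy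
    have e1 : x.2 = y.2 := by rw [← hi x, ← hi y, hxy]
    have e2 : x.1 i + x.1 j - x.2 = y.1 i + y.1 j - y.2 := by rw [← hj x, ← hj y, hxy]
    have e3 : x.1 i - x.2 + 1 = y.1 i - y.2 + 1 := congrArg (fun z => z.2) hxy
    obtain ⟨x1, x2⟩ := x
    obtain ⟨y1, y2⟩ := y
    simp only at *
    subst e1
    congr 1
    funext k
    by_cases hki : k = i
    · rw [hki]; omega
    · by_cases hkj : k = j
      · rw [hkj]; omega
      · have := hk ⟨x1, x2⟩ k hki hkj
        rw [hxy, hk _ k hki hkj] at this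
        exact this.symm
  have h1 : ∑ x ∈ A, (x.2 : ℝ) ≤ ∑ x ∈ B, (x.1 i : ℝ) := by
    calc ∑ x ∈ A, (x.2 : ℝ) = ∑ x ∈ A, ((φ x).1 i : ℝ) := by simp [hi]
      _ = ∑ x ∈ A.image φ, (x.1 i : ℝ) := (Finset.sum_image (f := fun x => (x.1 i : ℝ)) hinj).symm
      _ ≤ _ := Finset.sum_le_sum_of_subset_of_nonneg
        (Finset.image_subset_iff.2 hmaps) fun _ _ _ => by positivity
  have h2 : ∑ x ∈ A, (x.2 : ℝ) = ∑ g ∈ comps n N, (g i : ℝ) * (g i + 1) / 2 := by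
    rw [Finset.sum_sigma]
    refine Finset.sum_congr rfl fun g _ => ?_
    have : ∀ m : ℕ, ∑ r ∈ Finset.Icc 1 m, (r : ℝ) = m * (m + 1) / 2 := fun m => by
      induction m with
      | zero => simp
      | succ m ih => rw [Finset.sum_Icc_succ_top (by omega), ih]; push_cast; ring
    exact this _
  have h3 : ∑ x ∈ B, (x.1 i : ℝ) = ∑ g ∈ comps n N, (g i : ℝ) * g j := by
    rw [Finset.sum_sigma]
    refine Finset.sum_congr rfl fun g _ => ?_
    simp [mul_comm]
  rw [h2, h3] at h1
  have h4 : ∑ g ∈ comps n N, (g i : ℝ) ^ 2 ≤ 2 * ∑ g ∈ comps n N, (g i : ℝ) * (g i + 1) / 2 := by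
    rw [Finset.mul_sum]
    refine Finset.sum_le_sum fun g _ => ?_
    have : (0 : ℝ) ≤ g i := by positivity
    nlinarith
  linarith

lemma sum_comps_mul_le (M : ℕ) {i j : Fin n} (hij : i ≠ j) :
    ∑ g ∈ comps n (n * M), (g i : ℝ) * g j ≤ (M : ℝ) ^ 2 * (comps n (n * M)).card := by
  set C := ∑ g ∈ comps n (n * M), (g i : ℝ) * g j with hC
  have h1 : ∀ k l, k ≠ l → ∑ g ∈ comps n (n * M), (g k : ℝ) * g l = C := by
    intro k l hkl
    obtain ⟨σ, hσ1, hσ2⟩ : ∃ σ : Equiv.Perm (Fin n), σ i = k ∧ σ j = l := by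
      refine ⟨(Equiv.swap i k).trans (Equiv.swap (Equiv.swap i k j) l), ?_, ?_⟩
      · rw [Equiv.trans_apply, Equiv.swap_apply_left, Equiv.swap_apply_of_ne_of_ne _ hkl]
        intro h
        exact hij ((Equiv.swap i k).injective ((Equiv.swap_apply_left i k).trans h))
      · simp
    rw [hC, ← sum_comps_comp σ fun g => (g i : ℝ) * g j]
    simp only [hσ1, hσ2]
  have h2 : ∀ k l, C ≤ ∑ g ∈ comps n (n * M), (g k : ℝ) * g l := by
    intro k l
    by_cases hkl : k = l
    · subst hkl
      obtain ⟨m, hm⟩ : ∃ m, m ≠ k := by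
        by_cases h : i = k
        · exact ⟨j, fun hh => hij (h.trans hh.symm)⟩
        · exact ⟨i, h⟩
      have h3 : ∑ g ∈ comps n (n * M), (g m : ℝ) * g m =
          ∑ g ∈ comps n (n * M), (g k : ℝ) * g k := by
        rw [← sum_comps_comp (Equiv.swap k m) fun g => (g k : ℝ) * g k]
        simp
      have h4 : 0 ≤ ∑ g ∈ comps n (n * M), ((g k : ℝ) - g m) ^ 2 :=
        Finset.sum_nonneg fun _ _ => sq_nonneg _
      have h5 : ∑ g ∈ comps n (n * M), ((g k : ℝ) - g m) ^ 2 =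
          ∑ g ∈ comps n (n * M), (g k : ℝ) * g k + ∑ g ∈ comps n (n * M), (g m : ℝ) * g m
            - 2 * ∑ g ∈ comps n (n * M), (g k : ℝ) * g m := by
        rw [Finset.mul_sum, ← Finset.sum_add_distrib, ← Finset.sum_sub_distrib]
        exact Finset.sum_congr rfl fun _ _ => by ring
      rw [h1 k m hm.symm, h3] at h5
      linarith
    · exact (h1 k l hkl).ge
  have h3 : ∑ k, ∑ l, ∑ g ∈ comps n (n * M), (g k : ℝ) * g l =
      (n * M : ℝ) ^ 2 * (comps n (n * M)).card := by
    have : ∀ k, ∑ l, ∑ g ∈ comps n (n * M), (g k : ℝ) * g l =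
        ∑ g ∈ comps n (n * M), (g k : ℝ) * (n * M) := fun k => by
      rw [Finset.sum_comm]
      refine Finset.sum_congr rfl fun g hg => ?_
      rw [← Finset.mul_sum]
      have := (mem_comps.1 hg).2
      congr 1
      exact_mod_cast this
    rw [Finset.sum_congr rfl fun k _ => this k, Finset.sum_comm]
    rw [Finset.sum_congr rfl (g := fun _ => (n * M : ℝ) ^ 2)]
    · simp [mul_comm]
    · intro g hg
      rw [← Finset.sum_mul]
      have : (∑ k, (g k : ℝ)) = n * M := by exact_mod_cast (mem_comps.1 hg).2
      rw [this]; ring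
  have h4 : (n : ℝ) ^ 2 * C ≤ ∑ k, ∑ l, ∑ g ∈ comps n (n * M), (g k : ℝ) * g l := by
    calc (n : ℝ) ^ 2 * C = ∑ k : Fin n, ∑ l : Fin n, C := by simp; ring
      _ ≤ _ := Finset.sum_le_sum fun k _ => Finset.sum_le_sum fun l _ => h2 k l
  rw [h3] at h4
  have hn : (0 : ℝ) < n := by exact_mod_cast i.pos
  have h5 : (n : ℝ) ^ 2 * C ≤ (n : ℝ) ^ 2 * ((M : ℝ) ^ 2 * (comps n (n * M)).card) := by
    linarith
  exact le_of_mul_le_mul_left h5 (by positivity)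

lemma sum_comps_block (M : ℕ) (I : Finset (Fin n)) :
    ∑ g ∈ comps n (n * M), (∑ i ∈ I, (g i : ℝ)) = I.card * M * (comps n (n * M)).card := by
  rw [Finset.sum_comm, Finset.sum_congr rfl fun i _ => sum_comps_apply i.pos M i]
  simp [mul_assoc]

lemma sum_comps_block_sq (M : ℕ) (hn : 2 ≤ n) (I : Finset (Fin n)) :
    ∑ g ∈ comps n (n * M), (∑ i ∈ I, (g i : ℝ)) ^ 2 ≤
      2 * (I.card * M : ℝ) ^ 2 * (comps n (n * M)).card := by
  have h1 : ∑ g ∈ comps n (n * M), (∑ i ∈ I, (g i : ℝ)) ^ 2 =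
      ∑ i ∈ I, ∑ j ∈ I, ∑ g ∈ comps n (n * M), (g i : ℝ) * g j := by
    calc _ = ∑ g ∈ comps n (n * M), ∑ i ∈ I, ∑ j ∈ I, (g i : ℝ) * g j :=
          Finset.sum_congr rfl fun g _ => by rw [sq, Finset.sum_mul_sum]
      _ = ∑ i ∈ I, ∑ g ∈ comps n (n * M), ∑ j ∈ I, (g i : ℝ) * g j := Finset.sum_comm
      _ = _ := Finset.sum_congr rfl fun i _ => Finset.sum_comm
  have h2 : ∀ i j : Fin n, ∑ g ∈ comps n (n * M), (g i : ℝ) * g j ≤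
      2 * ((M : ℝ) ^ 2 * (comps n (n * M)).card) := by
    intro i j
    have h0 : 0 ≤ (M : ℝ) ^ 2 * (comps n (n * M)).card := by positivity
    by_cases hij : i = j
    · subst hij
      obtain ⟨k, hk⟩ : ∃ k : Fin n, i ≠ k := by
        by_cases h : i = ⟨0, by omega⟩
        · exact ⟨⟨1, by omega⟩, by rw [h]; simp⟩
        · exact ⟨_, h⟩
      have h3 := sum_comps_sq_le (N := n * M) hk
      have h4 := sum_comps_mul_le M hk
      simp only [← sq]
      linarith
    · linarith [sum_comps_mul_le M hij]
  rw [h1]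
  refine (Finset.sum_le_sum fun i _ => Finset.sum_le_sum fun j _ => h2 i j).trans (le_of_eq ?_)
  simp
  ring

lemma card_block_ge_le (M y : ℕ) (I : Finset (Fin n)) :
    (y : ℝ) * ((comps n (n * M)).filter fun g => y ≤ ∑ i ∈ I, g i).card ≤
      I.card * M * (comps n (n * M)).card := by
  rw [← sum_comps_block, mul_comm, ← nsmul_eq_mul, ← Finset.sum_const, Finset.sum_filter]
  refine Finset.sum_le_sum fun g _ => ?_
  split_ifs with h
  · exact_mod_cast h
  · positivity

lemma card_le_card_block (M : ℕ) (hM : 1 ≤ M) (hn : 2 ≤ n) (I : Finset (Fin n)) (y : ℕ)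
    (hy : 2 * y ≤ I.card * M) :
    ((comps n (n * M)).card : ℝ) ≤
      8 * ((comps n (n * M)).filter fun g => y ≤ ∑ i ∈ I, g i).card := by
  rcases I.eq_empty_or_nonempty with rfl | hI
  · have hy0 : y = 0 := by simpa using hy
    subst hy0
    simp
    have : (0 : ℝ) ≤ (comps n (n * M)).card := by positivity
    linarith
  set m : ℝ := I.card * M with hm
  have hm0 : 0 < m := by
    have h1 : 0 < I.card := hI.card_pos
    positivity
  have hy' : (y : ℝ) ≤ m / 2 := by
    have : (2 * y : ℝ) ≤ I.card * M := by exact_mod_cast hy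
    linarith
  have h1 := sum_comps_block M I
  have h2 := sum_comps_block_sq M hn I
  have h3 : ∑ g ∈ comps n (n * M), (∑ i ∈ I, (g i : ℝ)) ≤
      ∑ g ∈ comps n (n * M), (m / 2 + (∑ i ∈ I, (g i : ℝ)) ^ 2 / (8 * m) +
        if y ≤ ∑ i ∈ I, g i then 2 * m else 0) := by
    refine Finset.sum_le_sum fun g _ => ?_
    split_ifs with h
    · set s := ∑ i ∈ I, (g i : ℝ)
      have : s ≤ s ^ 2 / (8 * m) + 2 * m := by
        rw [← sub_nonneg]
        have : s ^ 2 / (8 * m) + 2 * m - s = (s - 4 * m) ^ 2 / (8 * m) := by field_simp; ring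
        rw [this]; positivity
      linarith
    · have h4 : (∑ i ∈ I, (g i : ℝ)) ≤ y := by
        have : ∑ i ∈ I, g i ≤ y := by omega
        exact_mod_cast this
      have : 0 ≤ (∑ i ∈ I, (g i : ℝ)) ^ 2 / (8 * m) := by positivity
      linarith
  rw [Finset.sum_add_distrib, Finset.sum_add_distrib, ← Finset.sum_filter, Finset.sum_const,
    Finset.sum_const, ← Finset.sum_div, nsmul_eq_mul, nsmul_eq_mul] at h3
  rw [h1] at h3
  have h4 : (∑ g ∈ comps n (n * M), (∑ i ∈ I, (g i : ℝ)) ^ 2) / (8 * m) ≤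
      m / 4 * (comps n (n * M)).card := by
    rw [div_le_iff₀ (by positivity)]
    refine h2.trans (le_of_eq ?_)
    ring
  set G : ℝ := ((comps n (n * M)).card : ℝ)
  set H : ℝ := (((comps n (n * M)).filter fun g => y ≤ ∑ i ∈ I, g i).card : ℝ)
  have h5 : m * G ≤ m * (8 * H) := by
    change m * G ≤ _ at h3
    linarith
  exact le_of_mul_le_mul_left h5 hm0

end

end Balance

namespace Balance

open scoped Classical

noncomputable section

lemma exists_equiv_fin {Q Λ : Type*} [Fintype Q] [LinearOrder Λ] {K : Q → Λ}
    (hK : Function.Injective K) :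
    ∃ f : Q ≃ Fin (Fintype.card Q), ∀ x y, K x < K y → f x < f y := by
  let _ : LinearOrder Q := LinearOrder.lift' K hK
  let e := Fintype.orderIsoFinOfCardEq Q rfl
  exact ⟨e.symm.toEquiv, fun x y h => e.symm.lt_iff_lt.2 h⟩

variable {Q : Type*} [Fintype Q] [PartialOrder Q]

lemma exists_linExt_of_monotone {X : Q → ℤ} (hX : Monotone X) :
    ∃ f : LinExt Q, ∀ x y, X x < X y → rk f x < rk f y := by
  obtain ⟨f0⟩ : Nonempty (LinExt Q) := inferInstance
  obtain ⟨f, hf⟩ := exists_equiv_fin (K := fun x => toLex (X x, rk f0 x)) (by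
    intro x y h
    have : rk f0 x = rk f0 y := congrArg (fun z => (ofLex z).2) h
    exact rk_inj.1 this)
  refine ⟨⟨f, fun x y hxy => hf x y ?_⟩, fun x y hxy => hf x y ?_⟩
  · rw [Prod.Lex.toLex_lt_toLex]
    rcases (hX hxy.le).lt_or_eq with h | h
    · exact Or.inl h
    · exact Or.inr ⟨h, rk_lt hxy⟩
  · rw [Prod.Lex.toLex_lt_toLex]
    exact Or.inl hxy

/-- Monotone integer labellings vanishing at `a`, of spread less than `N`, with label at least
`p` at `b`. -/
def labels (N : ℤ) (a b : Q) (p : ℤ) : Finset (Q → ℤ) :=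
  (Fintype.piFinset fun _ => Finset.Icc (-N) N).filter fun X =>
    Monotone X ∧ X a = 0 ∧ (∀ e e', X e - X e' < N) ∧ p ≤ X b

lemma mem_labels {N : ℤ} {a b : Q} {p : ℤ} {X : Q → ℤ} : X ∈ labels N a b p ↔
    Monotone X ∧ X a = 0 ∧ (∀ e e', X e - X e' < N) ∧ p ≤ X b := by
  unfold labels
  rw [Finset.mem_filter, Fintype.mem_piFinset, and_iff_right_of_imp]
  rintro ⟨-, h1, h2, -⟩ e
  have := h2 e a
  have := h2 a e
  rw [Finset.mem_Icc]
  omega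

lemma card_labels_mul_le (N : ℤ) (a b : Q) {y : ℤ} (hy : 1 ≤ y) (j : ℕ) :
    (labels N a b ((j + 1 : ℕ) * y)).card * (labels N a b 1).card ≤
      (labels N a b (j * y)).card * (labels N a b y).card := by
  set s : ℤ := j * y with hs
  have hs0 : 0 ≤ s := by positivity
  have hs1 : ((j + 1 : ℕ) : ℤ) * y = s + y := by push_cast; ring
  rw [hs1]
  let A := (labels N a b (s + y)).image fun X e => X e - s
  let B := (labels N a b s).image fun X e => X e - s
  have hinj : Function.Injective fun (X : Q → ℤ) e => X e - s := by
    intro X Y h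
    funext e
    have := congrFun h e
    simp only at this
    omega
  have hA : A.card = (labels N a b (s + y)).card := Finset.card_image_of_injective _ hinj
  have hB : B.card = (labels N a b s).card := Finset.card_image_of_injective _ hinj
  rw [← hA, ← hB]
  refine (Finset.le_card_infs_mul_card_sups A (labels N a b 1)).trans
    (Nat.mul_le_mul (Finset.card_le_card ?_) (Finset.card_le_card ?_))
  · intro Z hZ
    rw [Finset.mem_infs] at hZ
    obtain ⟨X', hX', Y, hY, rfl⟩ := hZ
    obtain ⟨X, hX, rfl⟩ := Finset.mem_image.1 hX'
    rw [mem_labels] at hX hY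
    refine Finset.mem_image.2 ⟨fun e => min (X e) (Y e + s), mem_labels.2 ⟨?_, ?_, ?_, ?_⟩, ?_⟩
    · intro e e' h
      have := hX.1 h
      have := hY.1 h
      simp only
      omega
    · have := hX.2.1
      have := hY.2.1
      omega
    · intro e e'
      have := hX.2.2.1 e e'
      have := hY.2.2.1 e e'
      omega
    · have := hX.2.2.2
      have := hY.2.2.2
      omega
    · funext e
      simp only [Pi.inf_apply]
      omega
  · intro Z hZ
    rw [Finset.mem_sups] at hZ
    obtain ⟨X', hX', Y, hY, rfl⟩ := hZ
    obtain ⟨X, hX, rfl⟩ := Finset.mem_image.1 hX'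
    rw [mem_labels] at hX hY
    refine mem_labels.2 ⟨?_, ?_, ?_, ?_⟩
    · intro e e' h
      have := hX.1 h
      have := hY.1 h
      simp only [Pi.sup_apply]
      omega
    · have := hX.2.1
      have := hY.2.1
      simp only [Pi.sup_apply]
      omega
    · intro e e'
      have := hX.2.2.1 e e'
      have := hY.2.2.1 e e'
      simp only [Pi.sup_apply]
      omega
    · have := hX.2.2.2
      simp only [Pi.sup_apply]
      omega

/-- The indices `i` with `k ≤ i < l`. -/
def blk {n : ℕ} (k l : ℕ) : Finset (Fin n) := Finset.univ.filter fun i => k ≤ (i : ℕ) ∧ (i : ℕ) < l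

lemma card_blk {n k l : ℕ} (hl : l ≤ n) : (blk k l : Finset (Fin n)).card = l - k := by
  have : (blk k l : Finset (Fin n)).map Fin.valEmbedding = Finset.Ico k l := by
    ext i
    simp only [blk, Finset.mem_map, Finset.mem_filter, Finset.mem_univ, true_and,
      Fin.valEmbedding_apply, Finset.mem_Ico]
    constructor
    · rintro ⟨j, hj, rfl⟩; exact hj
    · intro h; exact ⟨⟨i, by omega⟩, h, rfl⟩
  rw [← Finset.card_map Fin.valEmbedding, this, Nat.card_Ico]

/-- Partial sums of a sequence of gaps. -/
def psum {n : ℕ} (g : Fin n → ℕ) (k : ℕ) : ℕ := ∑ i ∈ blk 0 k, g i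

lemma psum_add {n : ℕ} (g : Fin n → ℕ) {k l : ℕ} (h : k ≤ l) :
    psum g l = psum g k + ∑ i ∈ blk k l, g i := by
  unfold psum
  rw [← Finset.sum_union]
  · congr 1
    ext i
    simp only [blk, Finset.mem_filter, Finset.mem_univ, true_and, Finset.mem_union]
    omega
  · rw [Finset.disjoint_left]
    intro i
    simp only [blk, Finset.mem_filter, Finset.mem_univ, true_and]
    omega

lemma psum_succ {n : ℕ} (g : Fin n → ℕ) {k : ℕ} (h : k < n) :
    psum g (k + 1) = psum g k + g ⟨k, h⟩ := by
  rw [psum_add g (Nat.le_succ k)]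
  congr 1
  rw [show (blk k (k + 1) : Finset (Fin n)) = {⟨k, h⟩} from ?_, Finset.sum_singleton]
  ext i
  simp only [blk, Finset.mem_filter, Finset.mem_univ, true_and, Finset.mem_singleton, Fin.ext_iff]
  omega

lemma psum_zero {n : ℕ} (g : Fin n → ℕ) : psum g 0 = 0 := by
  simp [psum, blk]

lemma psum_card {n : ℕ} (g : Fin n → ℕ) : psum g n = ∑ i, g i := by
  unfold psum
  congr 1
  ext i
  simp [blk]

lemma psum_mono {n : ℕ} (g : Fin n → ℕ) : Monotone (psum g) := fun k l h => by
  rw [psum_add g h]; exact Nat.le_add_right _ _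

lemma psum_lt {n : ℕ} {g : Fin n → ℕ} (hg : ∀ i, 1 ≤ g i) {k l : ℕ} (h : k < l) (hk : k < n) :
    psum g k < psum g l := by
  have h1 := psum_succ g hk
  have h2 := hg ⟨k, hk⟩
  have h3 := psum_mono g (show k + 1 ≤ l from h)
  omega

/-- The labelling with gaps `g` along the linear extension `f`, normalised to vanish at `a`. -/
def lab (a : Q) (x : LinExt Q × (Fin (Fintype.card Q) → ℕ)) (e : Q) : ℤ :=
  (psum x.2 (rk x.1 e) : ℤ) - psum x.2 (rk x.1 a)

lemma lab_lt {a : Q} {x : LinExt Q × (Fin (Fintype.card Q) → ℕ)} (hx : ∀ i, 1 ≤ x.2 i) {e e' : Q} :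
    lab a x e < lab a x e' ↔ rk x.1 e < rk x.1 e' := by
  unfold lab
  constructor
  · intro h
    by_contra! hh
    have := psum_mono x.2 hh
    omega
  · intro h
    have := psum_lt hx h (rk_lt_card _ _)
    omega

lemma lab_mem_labels {N : ℕ} {a b : Q} {p : ℤ} {x : LinExt Q × (Fin (Fintype.card Q) → ℕ)}
    (hx : x.2 ∈ comps (Fintype.card Q) N) (hp : p ≤ lab a x b) : lab a x ∈ labels N a b p := by
  rw [mem_comps] at hx
  refine mem_labels.2 ⟨fun e e' h => ?_, by simp [lab], fun e e' => ?_, hp⟩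
  · rcases h.eq_or_lt with rfl | h
    · exact le_rfl
    · exact ((lab_lt hx.1).2 (rk_lt h)).le
  · have h1 := psum_lt hx.1 (rk_lt_card x.1 e) (rk_lt_card x.1 e)
    rw [psum_card, hx.2] at h1
    simp only [lab]
    omega

lemma rk_eq_card (f : LinExt Q) (e : Q) :
    rk f e = (Finset.univ.filter fun e' => rk f e' < rk f e).card := by
  have : (Finset.univ.filter fun e' => rk f e' < rk f e).map f.1.toEmbedding =
      blk 0 (rk f e) := by
    ext i
    simp only [blk, Finset.mem_map, Finset.mem_filter, Finset.mem_univ, true_and,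
      Equiv.coe_toEmbedding, zero_le]
    constructor
    · rintro ⟨j, hj, rfl⟩; exact hj
    · intro h; exact ⟨f.1.symm i, by simpa [rk] using h, by simp⟩
  rw [← Finset.card_map f.1.toEmbedding, this, card_blk (rk_lt_card f e).le]
  simp

lemma lab_injOn (a : Q) (N : ℕ) :
    Set.InjOn (lab a) {x | x.2 ∈ comps (Fintype.card Q) N} := by
  rintro x hx y hy hxy
  have hx := mem_comps.1 (show x.2 ∈ comps (Fintype.card Q) N from hx)
  have hy := mem_comps.1 (show y.2 ∈ comps (Fintype.card Q) N from hy)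
  have h1 : x.1 = y.1 := by
    refine ext_rk fun e => ?_
    rw [rk_eq_card x.1 e, rk_eq_card y.1 e]
    congr 1
    ext e'
    simp only [Finset.mem_filter, Finset.mem_univ, true_and]
    rw [← lab_lt (a := a) hx.1, hxy, lab_lt hy.1]
  have hn : 0 < Fintype.card Q := Fintype.card_pos_iff.2 ⟨a⟩
  have h2 : ∀ k < Fintype.card Q, psum x.2 k = psum y.2 k := by
    intro k hk
    obtain ⟨e0, he0⟩ := exists_rk_eq x.1 hn
    obtain ⟨e, he⟩ := exists_rk_eq x.1 hk
    have h3 := congrFun hxy e0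
    have h4 := congrFun hxy e
    simp only [lab, ← h1, he0, he, psum_zero] at h3 h4
    omega
  have h3 : ∀ k ≤ Fintype.card Q, psum x.2 k = psum y.2 k := by
    intro k hk
    rcases hk.lt_or_eq with h | rfl
    · exact h2 k h
    · rw [psum_card, psum_card, hx.2, hy.2]
  refine Prod.ext h1 (funext fun i => ?_)
  have h4 := psum_succ x.2 i.2
  have h5 := psum_succ y.2 i.2
  rw [h3 _ i.2.le, h3 _ i.2, h5] at h4
  simpa using h4.symm

/-- Sequences of gaps with a vanishing gap before the last one. -/
def badGaps (n N : ℕ) : Finset (Fin n → ℕ) :=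
  (Fintype.piFinset fun _ => Finset.range (N + 1)).filter fun g =>
    ∑ i, g i = N ∧ ∃ i : Fin n, (i : ℕ) + 1 < n ∧ g i = 0

lemma mem_badGaps {n N : ℕ} {g : Fin n → ℕ} : g ∈ badGaps n N ↔
    ∑ i, g i = N ∧ ∃ i : Fin n, (i : ℕ) + 1 < n ∧ g i = 0 := by
  unfold badGaps
  rw [Finset.mem_filter, Fintype.mem_piFinset, and_iff_right_of_imp]
  rintro ⟨h, -⟩ i
  rw [Finset.mem_range, Nat.lt_succ_iff, ← h]
  exact Finset.single_le_sum (fun _ _ => Nat.zero_le _) (Finset.mem_univ i)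

lemma exists_lab_eq {N : ℕ} {a b : Q} {p : ℤ} {X : Q → ℤ} (hX : X ∈ labels N a b p) :
    ∃ x : LinExt Q × (Fin (Fintype.card Q) → ℕ), lab a x = X ∧
      (x.2 ∈ comps (Fintype.card Q) N ∨ x.2 ∈ badGaps (Fintype.card Q) N) := by
  obtain ⟨hmono, ha, hspread, -⟩ := mem_labels.1 hX
  obtain ⟨f, hf⟩ := exists_linExt_of_monotone hmono
  set n := Fintype.card Q with hn'
  have hn : 0 < n := Fintype.card_pos_iff.2 ⟨a⟩
  let x0 := X (f.1.symm ⟨0, hn⟩)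
  let Y : ℕ → ℤ := fun k => if h : k < n then X (f.1.symm ⟨k, h⟩) else N + x0
  have hY : ∀ e, Y (rk f e) = X e := fun e => by
    simp only [Y]
    rw [dif_pos (rk_lt_card f e)]
    simp [rk]
  have hY0 : Y 0 = x0 := by simp [Y, hn, x0]
  have hYn : Y n = N + x0 := by simp [Y]
  have hYlast : Y (n - 1) < Y n := by
    rw [hYn]
    simp only [Y]
    rw [dif_pos (by omega)]
    have := hspread (f.1.symm ⟨n - 1, by omega⟩) (f.1.symm ⟨0, hn⟩)
    simp only [x0]
    omega
  have hYmono : ∀ k < n, Y k ≤ Y (k + 1) := by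
    intro k hk
    rcases (show k + 1 ≤ n from hk).lt_or_eq with h | h
    · obtain ⟨u, hu⟩ := exists_rk_eq f hk
      obtain ⟨v, hv⟩ := exists_rk_eq f h
      rw [← hu, show rk f u + 1 = rk f v by omega, hY, hY]
      by_contra! hh
      have := hf _ _ hh
      omega
    · have : k = n - 1 := by omega
      subst this
      rw [h]
      exact hYlast.le
  let g : Fin n → ℕ := fun i => (Y (i + 1) - Y i).toNat
  have hg : ∀ i : Fin n, (g i : ℤ) = Y (i + 1) - Y i := fun i => by
    have := hYmono i i.2
    simp only [g]
    omega
  have hps : ∀ k ≤ n, (psum g k : ℤ) = Y k - Y 0 := by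
    intro k
    induction k with
    | zero => simp [psum_zero]
    | succ k ih =>
      intro hk
      rw [psum_succ g hk]
      push_cast
      rw [ih (by omega), hg]
      simp
  have hsum : ∑ i, g i = N := by
    have := hps n le_rfl
    rw [psum_card, hYn, hY0] at this
    omega
  refine ⟨(f, g), ?_, ?_⟩
  · funext e
    simp only [lab]
    rw [hps _ (rk_lt_card f e).le, hps _ (rk_lt_card f a).le, hY, hY, ha]
    ring
  · by_cases h : ∃ i : Fin n, (i : ℕ) + 1 < n ∧ g i = 0
    · exact Or.inr (mem_badGaps.2 ⟨hsum, h⟩)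
    · refine Or.inl (mem_comps.2 ⟨fun i => ?_, hsum⟩)
      push Not at h
      rcases (show (i : ℕ) + 1 ≤ n from i.2).lt_or_eq with hi | hi
      · have := h i hi
        change 1 ≤ g i
        omega
      · have := hg i
        have h2 : (i : ℕ) = n - 1 := by omega
        rw [hi, h2] at this
        change 1 ≤ g i
        omega

/-- Pairs of a linear extension and strict gaps giving label at least `p` to `b`. -/
def strictLabels (N : ℕ) (a b : Q) (p : ℤ) : Finset (LinExt Q × (Fin (Fintype.card Q) → ℕ)) :=
  (Finset.univ ×ˢ comps (Fintype.card Q) N).filter fun x => p ≤ lab a x b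

lemma card_strictLabels_le (N : ℕ) (a b : Q) (p : ℤ) :
    (strictLabels N a b p).card ≤ (labels N a b p).card := by
  refine Finset.card_le_card_of_injOn (lab a) (fun x hx => ?_) (fun x hx y hy h => ?_)
  · simp only [strictLabels, Finset.mem_coe, Finset.mem_filter, Finset.mem_product,
      Finset.mem_univ, true_and] at hx
    exact lab_mem_labels hx.1 hx.2
  · simp only [strictLabels, Finset.mem_coe, Finset.mem_filter, Finset.mem_product,
      Finset.mem_univ, true_and] at hx hy
    exact lab_injOn a N hx.1 hy.1 h

lemma card_labels_le (N : ℕ) (a b : Q) (p : ℤ) :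
    (labels N a b p).card ≤ (strictLabels N a b p).card +
      Fintype.card (LinExt Q) * (badGaps (Fintype.card Q) N).card := by
  have : labels N a b p ⊆ (strictLabels N a b p).image (lab a) ∪
      ((Finset.univ : Finset (LinExt Q)) ×ˢ badGaps (Fintype.card Q) N).image (lab a) := by
    intro X hX
    obtain ⟨x, rfl, h | h⟩ := exists_lab_eq hX
    · refine Finset.mem_union_left _ (Finset.mem_image_of_mem _ ?_)
      simp only [strictLabels, Finset.mem_filter, Finset.mem_product, Finset.mem_univ, true_and]
      exact ⟨h, (mem_labels.1 hX).2.2.2⟩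
    · exact Finset.mem_union_right _ (Finset.mem_image_of_mem _ (by simpa using h))
  refine (Finset.card_le_card this).trans ((Finset.card_union_le _ _).trans ?_)
  refine Nat.add_le_add Finset.card_image_le (Finset.card_image_le.trans ?_)
  rw [Finset.card_product, Finset.card_univ]

lemma card_badGaps_le {n : ℕ} (hn : 2 ≤ n) (N : ℕ) :
    (badGaps n N).card ≤ n * (N + 1) ^ (n - 2) := by
  let l : Fin n := ⟨n - 1, by omega⟩
  have h1 : badGaps n N ⊆ (Finset.univ.erase l).biUnion fun i =>
      (badGaps n N).filter fun g => g i = 0 := by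
    intro g hg
    obtain ⟨-, i, hi, hgi⟩ := mem_badGaps.1 hg
    refine Finset.mem_biUnion.2 ⟨i, ?_, Finset.mem_filter.2 ⟨hg, hgi⟩⟩
    simp only [Finset.mem_erase, Finset.mem_univ, and_true, l, ne_eq, Fin.ext_iff]
    omega
  have h2 : ∀ i ∈ Finset.univ.erase l,
      ((badGaps n N).filter fun g => g i = 0).card ≤ (N + 1) ^ (n - 2) := by
    intro i hi
    have hil : i ≠ l := by simpa using hi
    have hcard : Fintype.card {j // j ≠ l ∧ j ≠ i} = n - 2 := by
      rw [Fintype.card_subtype]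
      have : (Finset.univ.filter fun j : Fin n => j ≠ l ∧ j ≠ i) = (Finset.univ.erase l).erase i := by
        ext j; simp [and_comm]
      rw [this, Finset.card_erase_of_mem (by simpa using hil), Finset.card_erase_of_mem (by simp)]
      simp
      omega
    have : (Fintype.piFinset fun _ : {j // j ≠ l ∧ j ≠ i} => Finset.range (N + 1)).card =
        (N + 1) ^ (n - 2) := by
      rw [Fintype.card_piFinset]
      simp [-ne_eq, hcard]
    rw [← this]
    refine Finset.card_le_card_of_injOn (fun g j => g j.1) (fun g hg => ?_) ?_
    · have hg := Finset.mem_filter.1 hg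
      have hg2 := (Finset.mem_filter.1 hg.1).1
      rw [Fintype.mem_piFinset] at hg2
      exact Fintype.mem_piFinset.2 fun j => hg2 j.1
    · intro g hg g' hg' h
      have hg := Finset.mem_filter.1 hg
      have hg' := Finset.mem_filter.1 hg'
      have h3 : ∀ j, j ≠ l → g j = g' j := by
        intro j hj
        by_cases hji : j = i
        · rw [hji, hg.2, hg'.2]
        · exact congrFun h ⟨j, hj, hji⟩
      have h4 : g l = g' l := by
        have e1 := (mem_badGaps.1 hg.1).1
        have e2 := (mem_badGaps.1 hg'.1).1
        rw [← Finset.add_sum_erase _ _ (Finset.mem_univ l)] at e1 e2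
        have e3 : ∑ j ∈ Finset.univ.erase l, g j = ∑ j ∈ Finset.univ.erase l, g' j :=
          Finset.sum_congr rfl fun j hj => h3 j (Finset.ne_of_mem_erase hj)
        omega
      funext j
      by_cases hj : j = l
      · rw [hj, h4]
      · exact h3 j hj
  refine (Finset.card_le_card h1).trans (Finset.card_biUnion_le.trans ?_)
  refine (Finset.sum_le_sum h2).trans ?_
  rw [Finset.sum_const, smul_eq_mul]
  refine Nat.mul_le_mul_right _ ((Finset.card_erase_le).trans ?_)
  simp

lemma le_card_comps {n : ℕ} (hn : 1 ≤ n) {M : ℕ} (hM : 1 ≤ M) :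
    M ^ (n - 1) ≤ (comps n (n * M)).card := by
  let l : Fin n := ⟨n - 1, by omega⟩
  have hcard : Fintype.card {j // j ≠ l} = n - 1 := by simp
  have : (Fintype.piFinset fun _ : {j // j ≠ l} => Finset.Icc 1 M).card = M ^ (n - 1) := by
    rw [Fintype.card_piFinset]
    simp [-ne_eq, hcard]
  rw [← this]
  let F : ({j // j ≠ l} → ℕ) → Fin n → ℕ := fun h j =>
    if hj : j = l then n * M - ∑ i, h i else h ⟨j, hj⟩
  have hFl : ∀ h, F h l = n * M - ∑ i, h i := fun h => by simp [F]
  have hFj : ∀ h (j : {j // j ≠ l}), F h j = h j := fun h j => by simp [F, j.2]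
  refine Finset.card_le_card_of_injOn F (fun h hh => ?_) ?_
  · have hh : ∀ j, 1 ≤ h j ∧ h j ≤ M := fun j =>
      Finset.mem_Icc.1 (Fintype.mem_piFinset.1 hh j)
    have hs : ∑ i, h i ≤ (n - 1) * M := by
      calc ∑ i, h i ≤ ∑ _i : {j // j ≠ l}, M := Finset.sum_le_sum fun i _ => (hh i).2
        _ = (n - 1) * M := by simp [-ne_eq, hcard]
    have hnM : (n - 1) * M + M = n * M := by
      obtain ⟨m, rfl⟩ : ∃ m, n = m + 1 := ⟨n - 1, by omega⟩
      simp; ring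
    refine mem_comps.2 ⟨fun j => ?_, ?_⟩
    · by_cases hj : j = l
      · rw [hj, hFl]; omega
      · have := hFj h ⟨j, hj⟩
        simp only at this
        rw [this]; exact (hh _).1
    · rw [← Finset.add_sum_erase _ _ (Finset.mem_univ l), hFl]
      have : ∑ x ∈ Finset.univ.erase l, F h x = ∑ i, h i := by
        rw [← Finset.sum_congr rfl fun i _ => hFj h i]
        refine (Finset.sum_subtype (p := fun j => j ≠ l) _ (fun x => by simp) _)
      rw [this]
      omega
  · intro h _ h' _ hhh
    funext j
    rw [← hFj h, ← hFj h', hhh]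

end

end Balance

namespace Balance

open scoped Classical

noncomputable section

lemma le_pow_add_of_rec {s : ℕ → ℝ} {s1 p η : ℝ} (hp : 0 < p) (hp1 : p ≤ 1) (hη : 0 ≤ η)
    (hη1 : η ≤ 1)
    (hs0 : ∀ j, 0 ≤ s j) (hs : ∀ j, s j ≤ 1) (h1 : s1 ≤ 1) (hsub : p / 2 ≤ s1 - s 1)
    (hrec : ∀ j, s (j + 1) * s1 ≤ (s j + η) * (s 1 + η)) (k : ℕ) :
    s k ≤ (1 - p / 2) ^ k + k * (6 * η / p) := by
  have hs1 : p / 2 ≤ s1 := by linarith [hs0 1]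
  have hs1' : 0 < s1 := by linarith
  have step : ∀ j, s (j + 1) ≤ (1 - p / 2) * s j + 6 * η / p := by
    intro j
    have h2 : s (j + 1) * s1 ≤ s1 * ((1 - p / 2) * s j + 6 * η / p) := by
      have e1 : (s j + η) * (s 1 + η) ≤ s j * (s1 - p / 2) + 3 * η := by
        have := hs0 j
        have := hs j
        have := hs 1
        nlinarith [mul_nonneg (hs0 j) (sub_nonneg.2 hsub), mul_nonneg hη (sub_nonneg.2 (hs j)),
          mul_nonneg hη (sub_nonneg.2 (hs 1)), mul_nonneg hη (sub_nonneg.2 hη1)]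
      have e2 : 3 * η ≤ s1 * (6 * η / p) := by
        calc 3 * η = p / 2 * (6 * η / p) := by field_simp; ring
          _ ≤ _ := by gcongr
      have e3 : s j * (s1 - p / 2) ≤ s1 * ((1 - p / 2) * s j) := by
        nlinarith [mul_nonneg (mul_nonneg (hs0 j) hp.le) (sub_nonneg.2 h1)]
      linarith [hrec j]
    rw [mul_comm] at h2
    exact le_of_mul_le_mul_left h2 hs1'
  induction k with
  | zero => simpa using hs 0
  | succ k ih =>
    refine (step k).trans ?_
    have h0 : 0 ≤ 6 * η / p := by positivity
    have h3 : (1 - p / 2) * s k ≤ (1 - p / 2) * ((1 - p / 2) ^ k + k * (6 * η / p)) :=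
      mul_le_mul_of_nonneg_left ih (by linarith)
    have h4 : (1 - p / 2) * (k * (6 * η / p)) ≤ k * (6 * η / p) := by
      have : 0 ≤ k * (6 * η / p) := by positivity
      nlinarith
    push_cast
    rw [pow_succ]
    linarith

variable {Q : Type*} [Fintype Q] [PartialOrder Q]

lemma card_strictLabels_eq (N : ℕ) (a b : Q) (p : ℤ) :
    ((strictLabels N a b p).card : ℝ) =
      ∑ f, (((comps (Fintype.card Q) N).filter fun g => p ≤ lab a (f, g) b).card : ℝ) := by
  unfold strictLabels
  rw [Finset.card_filter, Finset.sum_product]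
  push_cast
  refine Finset.sum_congr rfl fun f _ => ?_
  rw [Finset.card_filter]
  push_cast
  rfl

lemma lab_eq {a b : Q} {f : LinExt Q} (h : rk f a ≤ rk f b) (g : Fin (Fintype.card Q) → ℕ) :
    lab a (f, g) b = (∑ i ∈ blk (rk f a) (rk f b), g i : ℕ) := by
  unfold lab
  rw [psum_add g h]
  push_cast
  ring

lemma sum_ite_eq_pb (A : LinExt Q → Prop) (c : ℝ) :
    ∑ f, (if A f then c else 0) = Fintype.card (LinExt Q) * c * pb A := by
  have := card_pos' (Q := Q)
  unfold pb ex
  rw [mul_comm _ c, mul_assoc, mul_div_cancel₀ _ this.ne', Finset.mul_sum]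
  simp

lemma pb_far_le_card (a b : Q) (hn : 2 ≤ Fintype.card Q) {M : ℕ} (hM : 1 ≤ M) (t k : ℕ) :
    Fintype.card (LinExt Q) * (comps (Fintype.card Q) (Fintype.card Q * M)).card *
      pb (fun f => rk f a + 4 * k * t ≤ rk f b) ≤
      8 * (strictLabels (Fintype.card Q * M) a b (k * (2 * t * M : ℕ))).card := by
  rw [card_strictLabels_eq, ← sum_ite_eq_pb, Finset.mul_sum]
  refine Finset.sum_le_sum fun f _ => ?_
  split_ifs with h
  · have h1 := card_le_card_block M hM hn (blk (rk f a) (rk f b)) (k * (2 * t * M)) (by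
      rw [card_blk (rk_lt_card f b).le]
      calc 2 * (k * (2 * t * M)) = (4 * k * t) * M := by ring
        _ ≤ _ := Nat.mul_le_mul_right _ (by omega))
    refine h1.trans (le_of_eq ?_)
    congr 3
    refine Finset.filter_congr fun g _ => ?_
    rw [lab_eq (by omega)]
    norm_cast
  · positivity

lemma near_le_card (a b : Q) {M t : ℕ} (hM : 1 ≤ M) (ht : 1 ≤ t) :
    Fintype.card (LinExt Q) * (comps (Fintype.card Q) (Fintype.card Q * M)).card *
      near a b t ≤
      2 * ((strictLabels (Fintype.card Q * M) a b 1).card -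
        (strictLabels (Fintype.card Q * M) a b (2 * t * M : ℕ)).card) := by
  rw [card_strictLabels_eq, card_strictLabels_eq]
  unfold near
  rw [← sum_ite_eq_pb, ← Finset.sum_sub_distrib, Finset.mul_sum]
  refine Finset.sum_le_sum fun f _ => ?_
  set Γ := comps (Fintype.card Q) (Fintype.card Q * M)
  have hMt : 1 ≤ t * M := Nat.mul_pos ht hM
  split_ifs with h
  · have h1 : (Γ.filter fun g => (1 : ℤ) ≤ lab a (f, g) b) = Γ := by
      refine Finset.filter_true_of_mem fun g hg => ?_
      have := (lab_lt (a := a) (x := (f, g)) (mem_comps.1 hg).1 (e := a) (e' := b)).2 h.1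
      have h0 : lab a (f, g) a = 0 := by simp [lab]
      omega
    rw [h1]
    have h2 := card_block_ge_le (n := Fintype.card Q) M (2 * t * M) (blk (rk f a) (rk f b))
    rw [card_blk (rk_lt_card f b).le] at h2
    have h3 : (Γ.filter fun g => ((2 * t * M : ℕ) : ℤ) ≤ lab a (f, g) b) =
        Γ.filter fun g => 2 * t * M ≤ ∑ i ∈ blk (rk f a) (rk f b), g i := by
      refine Finset.filter_congr fun g _ => ?_
      rw [lab_eq h.1.le]
      norm_cast
    rw [h3]
    have h4 : (((rk f b - rk f a : ℕ)) : ℝ) * M ≤ t * M := by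
      gcongr
      omega
    have h5 : (0 : ℝ) < t * M := by exact_mod_cast hMt
    have h6 : (t * M : ℝ) * (2 * ((Γ.filter fun g => 2 * t * M ≤
        ∑ i ∈ blk (rk f a) (rk f b), g i).card : ℝ)) ≤ t * M * Γ.card := by
      have h7 : (((rk f b - rk f a : ℕ)) : ℝ) * M * Γ.card ≤ t * M * Γ.card := by gcongr
      push_cast at h2 ⊢
      calc _ = (2 * t * M : ℝ) * ((Γ.filter fun g => 2 * t * M ≤
            ∑ i ∈ blk (rk f a) (rk f b), g i).card : ℝ) := by ring
        _ ≤ _ := h2.trans h7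
    have := le_of_mul_le_mul_left h6 h5
    linarith
  · have : (Γ.filter fun g => ((2 * t * M : ℕ) : ℤ) ≤ lab a (f, g) b).card ≤
        (Γ.filter fun g => (1 : ℤ) ≤ lab a (f, g) b).card := by
      refine Finset.card_le_card (Finset.monotone_filter_right _ fun g _ hg => ?_)
      have : (1 : ℤ) ≤ (2 * t * M : ℕ) := by
        have : 2 * t * M = 2 * (t * M) := by ring
        omega
      exact this.trans hg
    have : (((Γ.filter fun g => ((2 * t * M : ℕ) : ℤ) ≤ lab a (f, g) b).card : ℕ) : ℝ) ≤
        (Γ.filter fun g => (1 : ℤ) ≤ lab a (f, g) b).card := by exact_mod_cast this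
    linarith

lemma exists_badGaps_le {n : ℕ} (hn : 2 ≤ n) {δ : ℝ} (hδ : 0 < δ) :
    ∃ M : ℕ, 1 ≤ M ∧ ((badGaps n (n * M)).card : ℝ) ≤ δ * (comps n (n * M)).card := by
  obtain ⟨M, hM⟩ := exists_nat_ge (max 1 (n * (2 * n) ^ (n - 2) / δ))
  have hM1 : (1 : ℝ) ≤ M := (le_max_left _ _).trans hM
  have hM2 : n * (2 * n) ^ (n - 2) / δ ≤ (M : ℝ) := (le_max_right _ _).trans hM
  have hM1' : 1 ≤ M := by exact_mod_cast hM1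
  refine ⟨M, hM1', ?_⟩
  rw [div_le_iff₀ hδ] at hM2
  have h1 : ((badGaps n (n * M)).card : ℝ) ≤ n * (n * M + 1) ^ (n - 2) := by
    exact_mod_cast card_badGaps_le hn (n * M)
  have h2 : (M : ℝ) ^ (n - 1) ≤ (comps n (n * M)).card := by
    exact_mod_cast le_card_comps (by omega) hM1'
  have hn' : (2 : ℝ) ≤ n := by exact_mod_cast hn
  calc ((badGaps n (n * M)).card : ℝ) ≤ n * (n * M + 1) ^ (n - 2) := h1
    _ ≤ n * (2 * n * M) ^ (n - 2) := by
      have : (n * M + 1 : ℝ) ≤ 2 * n * M := by nlinarith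
      gcongr
    _ = n * (2 * n) ^ (n - 2) * M ^ (n - 2) := by rw [mul_pow]; ring
    _ ≤ M * δ * M ^ (n - 2) := by gcongr
    _ = δ * M ^ (n - 1) := by
      rw [show n - 1 = (n - 2) + 1 by omega, pow_succ]; ring
    _ ≤ _ := by gcongr

/-- If with probability at least `p` the element `b` follows `a` by at most `t` places, then the
distance from `a` to `b` has an exponential tail. -/
theorem pb_far_le {a b : Q} (hab : a ≠ b) {t : ℕ} (ht : 1 ≤ t) {p : ℝ} (hp : 0 < p)
    (hnear : p ≤ near a b t) (k : ℕ) :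
    pb (fun f => rk f a + 4 * k * t ≤ rk f b) ≤ 8 * (1 - p / 2) ^ k := by
  have hn : 2 ≤ Fintype.card Q := Fintype.one_lt_card_iff.2 ⟨a, b, hab⟩
  have hp1 : p ≤ 1 := hnear.trans (pb_le_one _)
  refine le_of_forall_pos_le_add fun δ hδ => ?_
  set η : ℝ := min 1 (δ * p / (48 * (k + 1))) with hη
  have hη0 : 0 < η := lt_min one_pos (by positivity)
  obtain ⟨M, hM, hbad⟩ := exists_badGaps_le hn hη0
  set n := Fintype.card Q with hn'
  set L : ℝ := (Fintype.card (LinExt Q) : ℝ) with hL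
  set G : ℝ := ((comps n (n * M)).card : ℝ) with hG
  have hL0 : 0 < L := card_pos'
  have hG0 : 0 < G := by
    have : 0 < M ^ (n - 1) := Nat.pow_pos hM
    have := le_card_comps (n := n) (by omega) hM
    have : 0 < (comps n (n * M)).card := by omega
    rw [hG]
    exact_mod_cast this
  set y : ℕ := 2 * t * M with hy
  have hy1 : 1 ≤ y := by
    have : 1 ≤ t * M := Nat.mul_pos ht hM
    have : 2 * t * M = 2 * (t * M) := by ring
    omega
  let S : ℤ → ℝ := fun q => (strictLabels (n * M) a b q).card / (L * G)
  have hLG : 0 < L * G := by positivity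
  have hS0 : ∀ q, 0 ≤ S q := fun q => by positivity
  have hS1 : ∀ q, S q ≤ 1 := fun q => by
    simp only [S]
    rw [div_le_one hLG]
    have : (strictLabels (n * M) a b q).card ≤ Fintype.card (LinExt Q) * (comps n (n * M)).card := by
      refine (Finset.card_filter_le _ _).trans ?_
      rw [Finset.card_product, Finset.card_univ]
    rw [hL, hG]
    exact_mod_cast this
  have hup : ∀ q, ((labels (n * M : ℕ) a b q).card : ℝ) ≤ (S q + η) * (L * G) := by
    intro q
    have h1 : ((labels (n * M : ℕ) a b q).card : ℝ) ≤ (strictLabels (n * M) a b q).card +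
        L * (badGaps n (n * M)).card := by
      rw [hL]
      exact_mod_cast card_labels_le (n * M) a b q
    have h2 : L * ((badGaps n (n * M)).card : ℝ) ≤ L * (η * G) := by gcongr
    have h3 : S q * (L * G) = (strictLabels (n * M) a b q).card := by
      simp only [S]; field_simp
    rw [add_mul, h3]
    linarith
  have hlo : ∀ q, S q * (L * G) ≤ ((labels (n * M : ℕ) a b q).card : ℝ) := by
    intro q
    have h3 : S q * (L * G) = (strictLabels (n * M) a b q).card := by
      simp only [S]; field_simp
    rw [h3]
    exact_mod_cast card_strictLabels_le (n * M) a b q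
  have main := le_pow_add_of_rec (s := fun j => S (j * y)) (s1 := S 1) (p := p) (η := η) hp hp1
    hη0.le (min_le_left _ _) (fun j => hS0 _) (fun j => hS1 _) (hS1 1) ?_ ?_ k
  · have h1 := pb_far_le_card a b hn hM t k
    have h2 : (L * G) * pb (fun f => rk f a + 4 * k * t ≤ rk f b) ≤ (L * G) * (8 * S (k * y)) := by
      have h3 : S (k * y) * (L * G) = (strictLabels (n * M) a b (k * y)).card := by
        simp only [S]; field_simp
      calc _ ≤ _ := h1
        _ = _ := by rw [← h3]; ring
    have h3 := le_of_mul_le_mul_left h2 hLG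
    have h4 : 8 * (k * (6 * η / p)) ≤ δ := by
      have h5 : η ≤ δ * p / (48 * (k + 1)) := min_le_right _ _
      calc 8 * (k * (6 * η / p)) ≤ 8 * ((k + 1) * (6 * (δ * p / (48 * (k + 1))) / p)) := by
            gcongr
            linarith
        _ = δ := by field_simp; norm_num
    linarith
  · have h1 := near_le_card a b hM ht
    have e1 : S 1 * (L * G) = (strictLabels (n * M) a b 1).card := by
      simp only [S]; field_simp
    have e2 : S y * (L * G) = (strictLabels (n * M) a b y).card := by
      simp only [S]; field_simp
    have h2 : (L * G) * (p / 2) ≤ (L * G) * (S 1 - S y) := by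
      have h3 : (L * G) * p ≤ (L * G) * near a b t := by gcongr
      have h4 : (L * G) * near a b t ≤ 2 * (S 1 * (L * G) - S y * (L * G)) := by
        rw [e1, e2]; exact h1
      linarith
    have h3 := le_of_mul_le_mul_left h2 hLG
    simpa using h3
  · intro j
    have h1 := card_labels_mul_le ((n * M : ℕ) : ℤ) a b (y := y) (by exact_mod_cast hy1) j
    have h2 : ((labels (n * M : ℕ) a b ((j + 1 : ℕ) * y)).card : ℝ) *
        (labels (n * M : ℕ) a b 1).card ≤
        (labels (n * M : ℕ) a b (j * y)).card * (labels (n * M : ℕ) a b y).card := by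
      exact_mod_cast h1
    have h3 : (S ((j + 1 : ℕ) * y) * (L * G)) * (S 1 * (L * G)) ≤
        ((S (j * y) + η) * (L * G)) * ((S y + η) * (L * G)) := by
      refine le_trans ?_ (h2.trans ?_)
      · exact mul_le_mul (hlo _) (hlo _) (mul_nonneg (hS0 _) hLG.le) (by positivity)
      · exact mul_le_mul (hup _) (hup _) (by positivity)
          (mul_nonneg (add_nonneg (hS0 _) hη0.le) hLG.le)
    have h4 : ((L * G) * (L * G)) * (S ((j + 1 : ℕ) * y) * S 1) ≤
        ((L * G) * (L * G)) * ((S (j * y) + η) * (S y + η)) := by linarith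
    have h5 := le_of_mul_le_mul_left h4 (by positivity)
    simpa using h5

end

end Balance

namespace Balance

open scoped Classical

noncomputable section

variable {Q : Type*} [Fintype Q] [PartialOrder Q]

/-- The expected excess of the position of `v` over that of `u`. -/
def exc (u v : Q) : ℝ := ex fun f => max 0 ((rk f v : ℝ) - rk f u)

lemma mn_sub_le_exc (u v : Q) : mn v - mn u ≤ exc u v := by
  rw [mn_sub]
  exact ex_mono fun f => le_max_right _ _

lemma exc_nonneg (u v : Q) : 0 ≤ exc u v := ex_nonneg fun _ => le_max_left _ _

lemma exc_of_lt {u v : Q} (h : u < v) : exc u v = mn v - mn u := by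
  rw [mn_sub]
  refine congrArg ex (funext fun f => max_eq_right ?_)
  have : rk f u < rk f v := rk_lt h
  have : (rk f u : ℝ) < rk f v := by exact_mod_cast this
  linarith

lemma pb_gt_mul_le (u v : Q) (a : ℝ) :
    a * pb (fun f => (rk f u : ℝ) + a ≤ rk f v) ≤ exc u v := by
  rcases lt_or_ge a 0 with ha | ha
  · exact (mul_nonpos_of_nonpos_of_nonneg ha.le (pb_nonneg _)).trans (exc_nonneg _ _)
  refine le_trans (mul_le_mul_of_nonneg_left (pb_mono fun f h => ?_) ha)
    (markov (fun f => le_max_left 0 ((rk f v : ℝ) - rk f u)) a)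
  exact le_max_of_le_right (by linarith)

lemma near_nonneg (u v : Q) (t : ℕ) : 0 ≤ near u v t := pb_nonneg _

lemma near_le_one (u v : Q) (t : ℕ) : near u v t ≤ 1 := pb_le_one _

lemma mul_exc_le {a b : Q} (hab : a ≠ b) {t : ℕ} (ht : 1 ≤ t) {p : ℝ} (hp : 0 < p)
    (hnear : p ≤ near a b t) : p * exc a b ≤ 64 * t := by
  have hp1 : p ≤ 1 := hnear.trans (near_le_one _ _ _)
  set n := Fintype.card Q
  have h1 : exc a b ≤ ex fun f => ∑ k ∈ Finset.range n,
      4 * (t : ℝ) * if rk f a + 4 * k * t ≤ rk f b then 1 else 0 := by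
    refine ex_mono fun f => max_le (Finset.sum_nonneg fun k _ => by positivity) ?_
    by_cases hab : rk f b ≤ rk f a
    · have : (rk f b : ℝ) ≤ rk f a := by exact_mod_cast hab
      refine le_trans (by linarith) (Finset.sum_nonneg fun k _ => by positivity)
    · set q := (rk f b - rk f a) / (4 * t) with hq
      have ht4 : 0 < 4 * t := by omega
      have hq1 : rk f b - rk f a < 4 * t * (q + 1) := Nat.lt_mul_div_succ _ ht4
      have hq2 : 4 * t * q ≤ rk f b - rk f a := Nat.mul_div_le _ _
      have hqn : q < n := by
        have : q ≤ rk f b - rk f a := Nat.div_le_self _ _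
        have := rk_lt_card f b
        omega
      calc (rk f b : ℝ) - rk f a ≤ 4 * t * (q + 1) := by
            have : rk f b ≤ rk f a + 4 * t * (q + 1) := by omega
            have : (rk f b : ℝ) ≤ rk f a + 4 * t * (q + 1) := by exact_mod_cast this
            linarith
        _ = ∑ k ∈ Finset.range (q + 1),
              4 * (t : ℝ) * if rk f a + 4 * k * t ≤ rk f b then 1 else 0 := by
            rw [Finset.sum_congr rfl (g := fun _ => 4 * (t : ℝ))]
            · simp; ring
            · intro k hk
              rw [if_pos, mul_one]
              have hk : k ≤ q := by simpa [Nat.lt_succ_iff] using hk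
              have : 4 * k * t ≤ 4 * t * q := by
                calc 4 * k * t = 4 * t * k := by ring
                  _ ≤ _ := Nat.mul_le_mul_left _ hk
              omega
        _ ≤ _ := Finset.sum_le_sum_of_subset_of_nonneg
            (by intro k hk; simp only [Finset.mem_range] at hk ⊢; omega)
            fun k _ _ => by positivity
  rw [ex_sum] at h1
  have h2 : ∑ k ∈ Finset.range n, ex (fun f => 4 * (t : ℝ) *
      if rk f a + 4 * k * t ≤ rk f b then 1 else 0) ≤
      ∑ k ∈ Finset.range n, 32 * (t : ℝ) * (1 - p / 2) ^ k := by
    refine Finset.sum_le_sum fun k _ => ?_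
    rw [ex_mul]
    have := pb_far_le hab ht hp hnear k
    unfold pb at this
    calc _ ≤ 4 * (t : ℝ) * (8 * (1 - p / 2) ^ k) := by
          gcongr
          refine (le_of_eq (congrArg ex (funext fun f => ?_))).trans this
          congr
      _ = _ := by ring
  rw [← Finset.mul_sum] at h2
  have h3 : p * ∑ k ∈ Finset.range n, (1 - p / 2) ^ k ≤ 2 := by
    have := geom_sum_mul (1 - p / 2) n
    have h4 : (∑ k ∈ Finset.range n, (1 - p / 2) ^ k) * (p / 2) = 1 - (1 - p / 2) ^ n := by
      linarith
    have h5 : 0 ≤ (1 - p / 2) ^ n := pow_nonneg (by linarith) _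
    linarith
  have ht0 : (0 : ℝ) ≤ t := by positivity
  calc p * exc a b ≤ p * (32 * (t : ℝ) * ∑ k ∈ Finset.range n, (1 - p / 2) ^ k) := by
        gcongr
        exact h1.trans h2
    _ = 32 * t * (p * ∑ k ∈ Finset.range n, (1 - p / 2) ^ k) := by ring
    _ ≤ 32 * t * 2 := by gcongr
    _ = _ := by ring

lemma near_mul_le {u v : Q} (h : u < v) (t : ℕ) : near u v t * (mn v - mn u) ≤ 64 * t := by
  rcases Nat.eq_zero_or_pos t with rfl | ht
  · have : near u v 0 = 0 := pb_false fun f hf => by omega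
    simp [this]
  rcases (near_nonneg u v t).eq_or_lt with h0 | h0
  · rw [← h0]; simp
  · rw [← exc_of_lt h]
    exact mul_exc_le h.ne ht h0 le_rfl

lemma cp_le_near (u v : Q) : cp u v ≤ near u v 1 := pb_mono fun f hf => by omega

lemma cp_mul_le {u v : Q} (h : u < v) : cp u v * (mn v - mn u) ≤ 64 := by
  have h1 := near_mul_le h 1
  have h2 : cp u v * (mn v - mn u) ≤ near u v 1 * (mn v - mn u) :=
    mul_le_mul_of_nonneg_right (cp_le_near u v) (by linarith [mn_lt h])
  simp at h1
  linarith

/-- Every antichain has at most `w` elements. -/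
def WidthLE (Q : Type*) [PartialOrder Q] (w : ℕ) : Prop :=
  ∀ A : Finset Q, IsAntichain (· ≤ ·) (A : Set Q) → A.card ≤ w

omit [Fintype Q] in
lemma antichain_of_lt {A : Finset Q} (h : ∀ x ∈ A, ∀ y ∈ A, ¬ x < y) :
    IsAntichain (· ≤ ·) (A : Set Q) :=
  fun x hx y hy hxy hle => h x hx y hy (lt_of_le_of_ne hle hxy)

omit [Fintype Q] [PartialOrder Q] in
lemma exists_le_mul {A : Finset Q} {w : ℕ} (hA : A.card ≤ w) {F : Q → ℝ} {c : ℝ} (hc : 0 < c)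
    (hF : ∀ x ∈ A, 0 ≤ F x) (hs : ∑ x ∈ A, F x = c) : ∃ x ∈ A, c ≤ w * F x := by
  have hne : A.Nonempty := by
    rw [Finset.nonempty_iff_ne_empty]
    rintro rfl
    simp at hs
    linarith
  obtain ⟨x, hx, hmax⟩ := A.exists_max_image F hne
  refine ⟨x, hx, ?_⟩
  calc c = ∑ x ∈ A, F x := hs.symm
    _ ≤ ∑ _y ∈ A, F x := Finset.sum_le_sum hmax
    _ = A.card * F x := by simp
    _ ≤ w * F x := by
      have := hF x hx
      gcongr

lemma not_lt_of_cp_pos_right {u v v' : Q} (h : u < v) (hc : 0 < cp u v') : ¬ v < v' := by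
  intro hv
  obtain ⟨f, hf⟩ := exists_of_pb_pos hc
  have h1 : rk f u < rk f v := rk_lt h
  have h2 : rk f v < rk f v' := rk_lt hv
  omega

lemma not_lt_of_cp_pos_left {u u' v : Q} (h : u < v) (hc : 0 < cp u' v) : ¬ u' < u := by
  intro hv
  obtain ⟨f, hf⟩ := exists_of_pb_pos hc
  have h1 : rk f u < rk f v := rk_lt h
  have h2 : rk f u' < rk f u := rk_lt hv
  omega

section Bounded

variable [BoundedOrder Q]

lemma exists_gt_near [Nontrivial Q] {w : ℕ} (hw : WidthLE Q w) {u : Q} (hu : u ≠ ⊤) :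
    ∃ v, u < v ∧ up u * (mn v - mn u) ≤ 64 * w := by
  set A := Finset.univ.filter fun v => u < v ∧ 0 < cp u v with hA
  have hA' : ∀ v, v ∈ A ↔ u < v ∧ 0 < cp u v := fun v => by simp [hA]
  have hcard : A.card ≤ w := hw A (antichain_of_lt fun x hx y hy =>
    not_lt_of_cp_pos_right ((hA' x).1 hx).1 ((hA' y).1 hy).2)
  have hs : ∑ v ∈ A, cp u v = up u := by
    rw [up_eq_sum]
    refine Finset.sum_subset (fun v hv => by simpa using ((hA' v).1 hv).1) fun v hv hv' => ?_
    have h1 : u < v := by simpa using hv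
    by_contra h
    exact hv' ((hA' v).2 ⟨h1, lt_of_le_of_ne (cp_nonneg _ _) (Ne.symm h)⟩)
  obtain ⟨v, hv, hle⟩ := exists_le_mul hcard (up_pos hu) (fun v _ => cp_nonneg u v) hs
  have huv := ((hA' v).1 hv).1
  refine ⟨v, huv, ?_⟩
  have h0 : 0 ≤ mn v - mn u := by linarith [mn_lt huv]
  calc up u * (mn v - mn u) ≤ w * cp u v * (mn v - mn u) := by gcongr
    _ = w * (cp u v * (mn v - mn u)) := by ring
    _ ≤ w * 64 := by gcongr; exact cp_mul_le huv
    _ = _ := by ring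

lemma exists_lt_near {w : ℕ} (hw : WidthLE Q w) {u : Q} (hu : u ≠ ⊥) :
    ∃ v, v < u ∧ dn u * (mn u - mn v) ≤ 64 * w := by
  set A := Finset.univ.filter fun v => v < u ∧ 0 < cp v u with hA
  have hA' : ∀ v, v ∈ A ↔ v < u ∧ 0 < cp v u := fun v => by simp [hA]
  have hcard : A.card ≤ w := hw A (antichain_of_lt fun x hx y hy =>
    not_lt_of_cp_pos_left ((hA' y).1 hy).1 ((hA' x).1 hx).2)
  have hs : ∑ v ∈ A, cp v u = dn u := by
    rw [dn_eq_sum]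
    refine Finset.sum_subset (fun v hv => by simpa using ((hA' v).1 hv).1) fun v hv hv' => ?_
    have h1 : v < u := by simpa using hv
    by_contra h
    exact hv' ((hA' v).2 ⟨h1, lt_of_le_of_ne (cp_nonneg _ _) (Ne.symm h)⟩)
  obtain ⟨v, hv, hle⟩ := exists_le_mul hcard (dn_pos hu) (fun v _ => cp_nonneg v u) hs
  have huv := ((hA' v).1 hv).1
  refine ⟨v, huv, ?_⟩
  have h0 : 0 ≤ mn u - mn v := by linarith [mn_lt huv]
  calc dn u * (mn u - mn v) ≤ w * cp v u * (mn u - mn v) := by gcongr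
    _ = w * (cp v u * (mn u - mn v)) := by ring
    _ ≤ w * 64 := by gcongr; exact cp_mul_le huv
    _ = _ := by ring

end Bounded

lemma card_le_of_separated {w : ℕ} (hw : WidthLE Q w) {S : Finset Q} {s L z : ℝ} (hs : 0 < s)
    (hL : 0 ≤ L) (hS : ∀ x ∈ S, z ≤ mn x ∧ mn x ≤ z + L)
    (hsep : ∀ x ∈ S, ∀ y ∈ S, x < y → s ≤ mn y - mn x) : (S.card : ℝ) ≤ w * (L / s + 1) := by
  have h1 : S.card ≤ w * (Finset.range (⌊L / s⌋₊ + 1)).card := by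
    refine Finset.card_le_mul_card_image_of_maps_to (f := fun x => ⌊(mn x - z) / s⌋₊)
      (fun x hx => ?_) w fun k _ => hw _ (antichain_of_lt fun x hx y hy hxy => ?_)
    · rw [Finset.mem_range, Nat.lt_succ_iff]
      refine Nat.floor_le_floor ?_
      gcongr
      linarith [(hS x hx).2]
    · simp only [Finset.mem_filter] at hx hy
      have e1 := hsep x hx.1 y hy.1 hxy
      have h0 : 0 ≤ (mn x - z) / s := div_nonneg (by linarith [(hS x hx.1).1]) hs.le
      have h2 := Nat.floor_le h0
      have h3 := Nat.lt_floor_add_one ((mn y - z) / s)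
      rw [hx.2] at h2
      rw [hy.2] at h3
      rw [le_div_iff₀ hs] at h2
      rw [div_lt_iff₀ hs] at h3
      linarith
  rw [Finset.card_range] at h1
  have h2 : (⌊L / s⌋₊ : ℝ) ≤ L / s := Nat.floor_le (by positivity)
  calc (S.card : ℝ) ≤ w * (⌊L / s⌋₊ + 1) := by exact_mod_cast h1
    _ ≤ _ := by gcongr

lemma card_le_of_interval {w : ℕ} (hw : WidthLE Q w) {S : Finset Q} {L z : ℝ}
    (hL : 0 ≤ L) (hS : ∀ x ∈ S, z ≤ mn x ∧ mn x ≤ z + L) : (S.card : ℝ) ≤ w * (L + 1) := by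
  have := card_le_of_separated hw one_pos hL hS fun x _ y _ hxy => by linarith [mn_add_one_le hxy]
  simpa using this

/-- No pair of distinct elements is balanced to within `ε`. -/
def Unbalanced (Q : Type*) [Fintype Q] [PartialOrder Q] (ε : ℝ) : Prop :=
  ∀ x y : Q, x ≠ y → 1 / 2 + ε ≤ pr x y ∨ pr x y ≤ 1 / 2 - ε

lemma pr_self (x : Q) : pr x x = 0 := pb_false fun _ => lt_irrefl _

lemma pr_of_gt {x y : Q} (h : y ≤ x) : pr x y = 0 := pb_false fun f hf => by
  have := rk_le (f := f) h
  omega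

/-- The facts used when `c` lies, in the majority order, between `u` and `v` with `u < v`. -/
lemma near_of_cross {ε : ℝ} {u v c : Q} (huv : u < v) (h1 : 1 / 2 + ε ≤ pr u c)
    (h2 : pr v c ≤ 1 / 2 - ε) {t : ℕ} (ht : 1 ≤ t) (hd : mn v - mn u ≤ ε * t) :
    ε ≤ near u c t ∧ (v = c ∨ ε ≤ near c v t) := by
  have h3 : pb (fun f => (rk f u : ℝ) + t ≤ rk f v) ≤ ε := by
    have h4 := pb_gt_mul_le u v t
    rw [exc_of_lt huv] at h4
    have ht' : (0 : ℝ) < t := by exact_mod_cast ht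
    have : (t : ℝ) * pb (fun f => (rk f u : ℝ) + t ≤ rk f v) ≤ t * ε := by linarith
    exact le_of_mul_le_mul_left this ht'
  have key : ∀ A : LinExt Q → Prop,
      (∀ f, rk f u < rk f c → ¬ rk f v < rk f c → ¬ rk f u + t ≤ rk f v → A f) → ε ≤ pb A := by
    intro A hA
    have h4 : pr u c ≤ pb (fun f => rk f v < rk f c ∨ rk f u + t ≤ rk f v) + pb A := by
      refine pb_or_le fun f hf => ?_
      by_cases h5 : rk f v < rk f c ∨ rk f u + t ≤ rk f v
      · exact Or.inl h5
      · push Not at h5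
        exact Or.inr (hA f hf (by omega) (by omega))
    have h5 : pb (fun f => rk f v < rk f c ∨ rk f u + t ≤ rk f v) ≤
        pr v c + pb (fun f => (rk f u : ℝ) + t ≤ rk f v) := by
      refine pb_or_le fun f hf => ?_
      rcases hf with hf | hf
      · exact Or.inl hf
      · exact Or.inr (by exact_mod_cast hf)
    linarith
  refine ⟨key _ fun f h4 h5 h6 => ⟨h4, by omega⟩, ?_⟩
  by_cases hvc : v = c
  · exact Or.inl hvc
  · refine Or.inr (key _ fun f h4 h5 h6 => ?_)
    have : rk f v ≠ rk f c := fun hh => hvc (rk_inj.1 hh)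
    exact ⟨by omega, by omega⟩

section Crossing

variable [BoundedOrder Q]

/-- Every element other than `⊤` has a larger element within mean distance `D`, and every
element other than `⊥` has a smaller one. -/
def Steps (Q : Type*) [Fintype Q] [PartialOrder Q] [BoundedOrder Q] (D : ℝ) : Prop :=
  (∀ u : Q, u ≠ ⊤ → ∃ v, u < v ∧ mn v - mn u ≤ D) ∧
    ∀ u : Q, u ≠ ⊥ → ∃ v, v < u ∧ mn u - mn v ≤ D

variable {ε D : ℝ} (hε : 0 < ε) (hε2 : ε ≤ 1 / 2) (hU : Unbalanced Q ε) (hD : Steps Q D) {t : ℕ}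
  (ht : 1 ≤ t) (htD : D ≤ ε * t)

include hε hε2 hU hD in
lemma exists_cross_up {e c : Q} (h : 1 / 2 + ε ≤ pr e c) :
    ∃ u v, e ≤ u ∧ u < v ∧ mn v - mn u ≤ D ∧ 1 / 2 + ε ≤ pr u c ∧ pr v c ≤ 1 / 2 - ε := by
  obtain ⟨u, hu⟩ := (Set.toFinite {u : Q | e ≤ u ∧ 1 / 2 + ε ≤ pr u c}).exists_maximal ⟨e, le_rfl, h⟩
  have hut : u ≠ ⊤ := by
    rintro rfl
    have := hu.prop.2
    rw [pr_of_gt le_top] at this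
    linarith
  obtain ⟨v, huv, hd⟩ := hD.1 u hut
  refine ⟨u, v, hu.prop.1, huv, hd, hu.prop.2, ?_⟩
  by_cases hvc : v = c
  · rw [hvc, pr_self]; linarith
  · refine (hU v c hvc).resolve_left fun h1 => ?_
    exact hu.not_prop_of_gt huv ⟨hu.prop.1.trans huv.le, h1⟩

include hU hD in
lemma exists_cross_down {e c : Q} (hc : c ≠ ⊥) (hε2 : ε ≤ 1 / 2) (h : pr e c ≤ 1 / 2 - ε)
    (hε : 0 < ε) :
    ∃ u v, v ≤ e ∧ u < v ∧ mn v - mn u ≤ D ∧ 1 / 2 + ε ≤ pr u c ∧ pr v c ≤ 1 / 2 - ε := by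
  obtain ⟨v, hv⟩ := (Set.toFinite {v : Q | v ≤ e ∧ pr v c ≤ 1 / 2 - ε}).exists_minimal ⟨e, le_rfl, h⟩
  have hvb : v ≠ ⊥ := by
    rintro rfl
    have := hv.prop.2
    rw [pr_of_lt (bot_lt_iff_ne_bot.2 hc)] at this
    linarith
  obtain ⟨u, huv, hd⟩ := hD.2 v hvb
  have hu : ¬ pr u c ≤ 1 / 2 - ε := fun h1 =>
    hv.not_prop_of_lt huv ⟨huv.le.trans hv.prop.1, h1⟩
  refine ⟨u, v, hv.prop.1, huv, hd, ?_, hv.prop.2⟩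
  by_cases huc : u = c
  · rw [huc, pr_self] at hu
    exact absurd (by linarith) hu
  · exact (hU u c huc).resolve_right hu

include hε ht in
omit [BoundedOrder Q] in
lemma exc_le_of_near {a b : Q} (hab : a ≠ b) (h : ε ≤ near a b t) : exc a b ≤ 64 * t / ε := by
  rw [le_div_iff₀ hε, mul_comm]
  exact mul_exc_le hab ht hε h

include hε hε2 hU hD ht htD in
lemma mn_le_of_pr {u c : Q} (h : 1 / 2 + ε ≤ pr u c) : mn u ≤ mn c + 64 * t / ε := by
  have huc : u ≠ c := by
    rintro rfl
    rw [pr_self] at h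
    linarith
  by_cases hu : u = ⊥
  · subst hu
    have := mn_le (bot_le (a := c))
    have : 0 ≤ 64 * (t : ℝ) / ε := by positivity
    linarith
  have h1 : pr c u ≤ 1 / 2 - ε := by linarith [pr_add huc]
  obtain ⟨u', v', h2, h3, h4, h5, h6⟩ := exists_cross_down hU hD hu hε2 h1 hε
  have h7 := (near_of_cross h3 h5 h6 ht (h4.trans htD)).1
  have hu' : u' ≠ u := by
    rintro rfl
    rw [pr_self] at h5
    linarith
  have h8 := exc_le_of_near hε ht hu' h7
  have h9 := mn_sub_le_exc u' u
  have h10 := mn_le (h3.le.trans h2)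
  linarith

include hε hε2 hU hD ht htD in
lemma pr_of_mn_lt {c b : Q} (h : mn c + 64 * t / ε < mn b) : 1 / 2 + ε ≤ pr c b := by
  have hcb : c ≠ b := by
    rintro rfl
    have : 0 ≤ 64 * (t : ℝ) / ε := by positivity
    linarith
  refine (hU c b hcb).resolve_right fun h1 => ?_
  have := mn_le_of_pr hε hε2 hU hD ht htD (u := b) (c := c) (by linarith [pr_add hcb])
  linarith

include hε hε2 hU hD ht htD in
lemma exists_cross {e c : Q} (h : 1 / 2 + ε ≤ pr e c) :
    ∃ u v, e ≤ u ∧ u < v ∧ mn v - mn u ≤ D ∧ 1 / 2 + ε ≤ pr u c ∧ pr v c ≤ 1 / 2 - ε ∧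
      exc u c ≤ 64 * t / ε ∧ exc c v ≤ 64 * t / ε := by
  obtain ⟨u, v, h1, h2, h3, h4, h5⟩ := exists_cross_up hε hε2 hU hD h
  obtain ⟨h6, h7⟩ := near_of_cross h2 h4 h5 ht (h3.trans htD)
  have huc : u ≠ c := by
    rintro rfl
    rw [pr_self] at h4
    linarith
  refine ⟨u, v, h1, h2, h3, h4, h5, exc_le_of_near hε ht huc h6, ?_⟩
  by_cases hvc : v = c
  · have : exc c v = 0 := by simp [exc, hvc, ex_const]
    rw [this]; positivity
  · exact exc_le_of_near hε ht (Ne.symm hvc) (h7.resolve_left hvc)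

include hε hε2 hU hD ht htD in
lemma pr_far_le {v s : Q} {Y : ℝ} (hY : 64 * t / ε < Y) (h : mn s + Y ≤ mn v) {a : ℕ}
    (ha : 1 ≤ a) : pr v s ≤ 64 * a / (Y - 64 * t / ε) + 64 * t / ε / a := by
  set H : ℝ := 64 * t / ε with hH
  obtain ⟨u, v', h1, h2, -, -, -, h6, h7⟩ := exists_cross hε hε2 hU hD ht htD
    (pr_of_mn_lt hε hε2 hU hD ht htD (c := s) (b := v) (by linarith))
  have h8 : Y - H ≤ mn u - mn s := by linarith [mn_sub_le_exc u v]
  have hsu : s < u := by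
    refine lt_of_le_of_ne h1 ?_
    rintro rfl
    linarith
  have ha' : (0 : ℝ) < a := by exact_mod_cast ha
  have h9 : near s u a ≤ 64 * a / (Y - H) := by
    rw [le_div_iff₀ (by linarith)]
    refine le_trans ?_ (near_mul_le hsu a)
    exact mul_le_mul_of_nonneg_left h8 (near_nonneg _ _ _)
  have h10 : pb (fun f => (rk f v : ℝ) + a ≤ rk f v') ≤ H / a := by
    rw [le_div_iff₀ ha', mul_comm]
    exact (pb_gt_mul_le v v' a).trans h7
  refine le_trans (pb_or_le fun f hf => ?_) (add_le_add h9 h10)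
  have h11 : rk f s < rk f u := rk_lt hsu
  have h12 : rk f u < rk f v' := rk_lt h2
  by_cases h13 : rk f u ≤ rk f s + a
  · exact Or.inl ⟨h11, h13⟩
  · right
    have : rk f v + a ≤ rk f v' := by omega
    exact_mod_cast this

end Crossing

end

end Balance

namespace Balance

open scoped Classical

noncomputable section

variable {Q : Type*} [Fintype Q] [PartialOrder Q] [BoundedOrder Q]

lemma dn_top [Nontrivial Q] : dn (⊤ : Q) = 1 := by
  refine pb_true fun f => ?_
  obtain ⟨y, hy⟩ := exists_prev (f := f) (top_ne_bot (α := Q))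
  refine ⟨y, hy, lt_top_iff_ne_top.2 ?_⟩
  rintro rfl
  omega

lemma one_le_up_mul_left [Nontrivial Q] {u v : Q} (h : u < v) : 1 ≤ 4 * up u * (mn v - mn u) := by
  by_cases hu : u = ⊥
  · subst hu
    rw [up_bot]
    linarith [mn_add_one_le h]
  · rw [up_eq_dn hu h.ne_top]
    exact one_le_dn_mul h hu

lemma steps_of_le_up [Nontrivial Q] {w : ℕ} (hw : WidthLE Q w) {G : ℝ} (hG : 1 ≤ G)
    (h : ∀ u : Q, u ≠ ⊤ → 1 ≤ G * up u) : Steps Q (64 * w * G) := by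
  have key : ∀ φ d : ℝ, 0 ≤ d → 1 ≤ G * φ → φ * d ≤ 64 * w → d ≤ 64 * w * G := by
    intro φ d hd h1 h2
    calc d = 1 * d := by ring
      _ ≤ G * φ * d := by gcongr
      _ = G * (φ * d) := by ring
      _ ≤ G * (64 * w) := by gcongr
      _ = _ := by ring
  refine ⟨fun u hu => ?_, fun u hu => ?_⟩
  · obtain ⟨v, h1, h2⟩ := exists_gt_near hw hu
    exact ⟨v, h1, key _ _ (by linarith [mn_lt h1]) (h u hu) h2⟩
  · obtain ⟨v, h1, h2⟩ := exists_lt_near hw hu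
    refine ⟨v, h1, key _ _ (by linarith [mn_lt h1]) ?_ h2⟩
    by_cases hu' : u = ⊤
    · rw [hu', dn_top]; linarith
    · rw [← up_eq_dn hu hu']; exact h u hu'

section

variable {ε D : ℝ} (hε : 0 < ε) (hε2 : ε ≤ 1 / 2) (hU : Unbalanced Q ε) (hD : Steps Q D) {t : ℕ}
  (ht : 1 ≤ t) (htD : D ≤ ε * t) {w : ℕ} (hw : WidthLE Q w)

include hε hε2 hU hD ht htD hw in
lemma pb_exists_far_above_le {s : Q} {Y : ℝ} {a : ℕ} (ha : 1 ≤ a) (hw1 : 1 ≤ w)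
    (haH : 16 * w * (64 * t / ε) ≤ a) (hY : Y = 64 * t / ε + 1024 * w * a) :
    pb (fun f => ∃ e, mn s + Y < mn e ∧ rk f e < rk f s) ≤ 1 / 8 ∧
    pb (fun f => ∃ e, mn e + Y < mn s ∧ rk f s < rk f e) ≤ 1 / 8 := by
  have ha' : (1 : ℝ) ≤ a := by exact_mod_cast ha
  have hw' : (1 : ℝ) ≤ w := by exact_mod_cast hw1
  have hwa : (0 : ℝ) < w * a := by positivity
  have hbound : 64 * (a : ℝ) / (Y - 64 * t / ε) + 64 * t / ε / a ≤ 1 / (8 * w) := by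
    have h1 : 64 * (a : ℝ) / (Y - 64 * t / ε) = 1 / (16 * w) := by
      rw [hY, add_sub_cancel_left]
      field_simp
      norm_num
    have h2 : 64 * (t : ℝ) / ε / a ≤ 1 / (16 * w) := by
      rw [div_le_div_iff₀ (by positivity) (by positivity)]
      linarith
    rw [h1]
    refine (add_le_add le_rfl h2).trans (le_of_eq ?_)
    field_simp
    norm_num
  have hsum : ∀ (A : Finset Q) (F : Q → ℝ), IsAntichain (· ≤ ·) (A : Set Q) →
      (∀ x ∈ A, F x ≤ 1 / (8 * w)) → ∑ x ∈ A, F x ≤ 1 / 8 := by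
    intro A F hA hF
    calc ∑ x ∈ A, F x ≤ ∑ _x ∈ A, 1 / (8 * (w : ℝ)) := Finset.sum_le_sum hF
      _ = A.card * (1 / (8 * (w : ℝ))) := by simp
      _ ≤ w * (1 / (8 * (w : ℝ))) := by
        have : (A.card : ℝ) ≤ w := by exact_mod_cast hw A hA
        gcongr
      _ = 1 / 8 := by field_simp
  constructor
  · set A := Finset.univ.filter fun e : Q => Minimal (fun e => mn s + Y < mn e) e
    refine (pb_exists_le A (fun e f => rk f e < rk f s) ?_).trans
      (hsum A (fun e => pr e s) (antichain_of_lt fun x hx y hy hxy => ?_) fun x hx => ?_)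
    · rintro f ⟨e, h1, h2⟩
      obtain ⟨e', h3, h4⟩ := (Set.toFinite {e : Q | mn s + Y < mn e}).exists_le_minimal h1
      exact ⟨e', by simpa [A] using h4, lt_of_le_of_lt (rk_le h3) h2⟩
    · simp only [A, Finset.mem_filter_univ] at hx hy
      exact hy.not_prop_of_lt hxy hx.prop
    · simp only [A, Finset.mem_filter_univ] at hx
      exact (pr_far_le hε hε2 hU hD ht htD (by rw [hY]; nlinarith) hx.prop.le ha).trans hbound
  · set A := Finset.univ.filter fun e : Q => Maximal (fun e => mn e + Y < mn s) e
    refine (pb_exists_le A (fun e f => rk f s < rk f e) ?_).trans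
      (hsum A (fun e => pr s e) (antichain_of_lt fun x hx y hy hxy => ?_) fun x hx => ?_)
    · rintro f ⟨e, h1, h2⟩
      obtain ⟨e', h3, h4⟩ := (Set.toFinite {e : Q | mn e + Y < mn s}).exists_le_maximal h1
      exact ⟨e', by simpa [A] using h4, lt_of_lt_of_le h2 (rk_le h3)⟩
    · simp only [A, Finset.mem_filter_univ] at hx hy
      exact hx.not_prop_of_gt hxy hy.prop
    · simp only [A, Finset.mem_filter_univ] at hx
      exact (pr_far_le hε hε2 hU hD ht htD (by rw [hY]; nlinarith) hx.prop.le ha).trans hbound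

include hε hε2 hU hD ht htD hw in
lemma exists_dense [Nontrivial Q] {p s : Q} {Y τ : ℝ} {a : ℕ} (ha : 1 ≤ a) (hw1 : 1 ≤ w)
    (haH : 16 * w * (64 * t / ε) ≤ a) (hY : Y = 64 * t / ε + 1024 * w * a)
    (hps : p < s) (hd1 : D ≤ mn s - mn p) (hd2 : mn s - mn p ≤ 2 * D) (hs : mn s + Y < mn (⊤ : Q))
    (hτ : 1 / 4 ≤ τ) (hτD : 64 * (w * ((2 * Y + 2 * D) / τ + 1)) < 3 / 4 * D) :
    ∃ c : Q, c ≠ ⊤ ∧ mn p - Y ≤ mn c ∧ mn c ≤ mn s + Y ∧ 1 / (4 * τ) ≤ up c := by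
  by_contra! hcon
  have hY0 : 0 ≤ Y := by rw [hY]; positivity
  have hps' := mn_lt hps
  set S := Finset.univ.filter fun c : Q => mn p - Y ≤ mn c ∧ mn c ≤ mn s + Y with hS
  have hcard : (S.card : ℝ) ≤ w * ((2 * Y + 2 * D) / τ + 1) := by
    refine card_le_of_separated hw (by linarith) (by linarith) (z := mn p - Y)
      (fun x hx => ?_) fun x hx y hy hxy => ?_
    · simp only [hS, Finset.mem_filter_univ] at hx
      exact ⟨hx.1, by linarith⟩
    · simp only [hS, Finset.mem_filter_univ] at hx
      have hxt : x ≠ ⊤ := hxy.ne_top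
      have h1 := hcon x hxt hx.1 hx.2
      have h2 := one_le_up_mul_left hxy
      have h3 := mn_lt hxy
      rw [lt_div_iff₀ (by linarith)] at h1
      by_contra! h4
      nlinarith [up_pos hxt]
  have hnear : 3 / 4 ≤ near p s S.card := by
    obtain ⟨h1, -⟩ := pb_exists_far_above_le hε hε2 hU hD ht htD hw (s := s) ha hw1 haH hY
    obtain ⟨-, h2⟩ := pb_exists_far_above_le hε hε2 hU hD ht htD hw (s := p) ha hw1 haH hY
    have h3 : (1 : ℝ) = pb fun _ : LinExt Q => True := (pb_true fun _ => trivial).symm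
    have h4 : pb (fun _ : LinExt Q => True) ≤
        pb (fun f => (∃ e, mn s + Y < mn e ∧ rk f e < rk f s) ∨
          ∃ e, mn e + Y < mn p ∧ rk f p < rk f e) + near p s S.card := by
      refine pb_or_le fun f _ => ?_
      by_cases hf : (∃ e, mn s + Y < mn e ∧ rk f e < rk f s) ∨
          ∃ e, mn e + Y < mn p ∧ rk f p < rk f e
      · exact Or.inl hf
      · push Not at hf
        refine Or.inr ⟨rk_lt hps, ?_⟩
        have h5 : (Finset.Ioc (rk f p) (rk f s)).card ≤ S.card := by
          refine Finset.card_le_card_of_surjOn (rk f) fun j hj => ?_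
          simp only [Finset.coe_Ioc, Set.mem_Ioc] at hj
          obtain ⟨e, rfl⟩ := exists_rk_eq f (lt_of_le_of_lt hj.2 (rk_lt_card f s))
          refine ⟨e, ?_, rfl⟩
          have h6 : mn p - Y ≤ mn e := by
            by_contra! h
            exact absurd (hf.2 e (by linarith)) (by omega)
          have h7 : mn e ≤ mn s + Y := by
            by_contra! h
            have h8 := hf.1 e h
            have : e = s := rk_inj.1 (le_antisymm hj.2 h8)
            subst this
            linarith
          exact Finset.mem_coe.2 ((Finset.mem_filter_univ _).2 ⟨h6, h7⟩)
        rw [Nat.card_Ioc] at h5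
        omega
    have h5 := pb_or_le (A := fun f => (∃ e, mn s + Y < mn e ∧ rk f e < rk f s) ∨
          ∃ e, mn e + Y < mn p ∧ rk f p < rk f e) fun f hf => hf
    linarith
  have h6 := near_mul_le hps S.card
  have h7 : 3 / 4 * D ≤ near p s S.card * (mn s - mn p) := by
    have : 0 ≤ near p s S.card := near_nonneg _ _ _
    nlinarith
  linarith

include hε hε2 hU hD ht htD hw in
lemma exists_base [Nontrivial Q] {b : Q} (hb : b ≠ ⊥) {Y τ : ℝ} {a : ℕ} (ha : 1 ≤ a)
    (hw1 : 1 ≤ w)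
    (haH : 16 * w * (64 * t / ε) ≤ a) (hY : Y = 64 * t / ε + 1024 * w * a) (hD0 : 0 < D)
    (hτ : 1 / 4 ≤ τ) (hτD : 64 * (w * ((2 * Y + 2 * D) / τ + 1)) < 3 / 4 * D) :
    ∃ e : Q, 1 / 2 + ε ≤ pr e b ∧ 1 / (4 * τ) ≤ up e ∧
      mn b - mn e ≤ 64 * t / ε + 2 * Y + 1 + 3 * D := by
  have hY0 : 0 ≤ Y := by rw [hY]; positivity
  set H : ℝ := 64 * t / ε with hH
  have hH0 : 0 ≤ H := by rw [hH]; positivity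
  set z := mn b - H - Y - 1 with hz
  by_cases hroom : mn (⊥ : Q) ≤ z - 2 * D
  · have down : ∀ (x : Q) (y : ℝ), y < mn x → mn (⊥ : Q) ≤ y →
        ∃ s, s < x ∧ mn s ≤ y ∧ y - D < mn s := by
      intro x y hxy hy
      obtain ⟨s', hs'⟩ := (Set.toFinite {s : Q | s ≤ x ∧ y < mn s}).exists_minimal ⟨x, le_rfl, hxy⟩
      have hs'b : s' ≠ ⊥ := by
        rintro rfl
        linarith [hs'.prop.2]
      obtain ⟨s, hs1, hs2⟩ := hD.2 s' hs'b
      refine ⟨s, lt_of_lt_of_le hs1 hs'.prop.1, ?_, by linarith [hs'.prop.2]⟩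
      by_contra! h
      exact hs'.not_prop_of_lt hs1 ⟨hs1.le.trans hs'.prop.1, h⟩
    obtain ⟨s, h1, h2, h3⟩ := down b z (by linarith) (by linarith)
    obtain ⟨p, h4, h5, h6⟩ := down s (mn s - D) (by linarith) (by linarith)
    have hbt := mn_le (le_top (a := b))
    obtain ⟨c, h7, h8, h9, h10⟩ := exists_dense hε hε2 hU hD ht htD hw ha hw1 haH hY h4
      (by linarith) (by linarith) (by linarith) hτ hτD
    exact ⟨c, pr_of_mn_lt hε hε2 hU hD ht htD (by rw [← hH]; linarith), h10, by linarith⟩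
  · refine ⟨⊥, ?_, ?_, by linarith⟩
    · rw [pr_of_lt (bot_lt_iff_ne_bot.2 hb)]; linarith
    · rw [up_bot, div_le_one (by linarith)]; linarith

end

end

end Balance

namespace Balance

open scoped Classical

noncomputable section

variable {Q : Type*} [Fintype Q] [PartialOrder Q] [BoundedOrder Q]

lemma one_le_exp_mul {y : ℝ} (hy0 : 0 ≤ y) (hy : y ≤ 1 / 2) : 1 ≤ Real.exp (2 * y) * (1 - y) := by
  have h1 := Real.add_one_le_exp (2 * y)
  have h2 : (2 * y + 1) * (1 - y) ≤ Real.exp (2 * y) * (1 - y) := by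
    gcongr; linarith
  nlinarith

/-- A cover relation crossing the majority cut at an element `b` of small flow is long. -/
lemma cross_length {ε : ℝ} (hε : 0 < ε) {u v b : Q} (hb : b ≠ ⊤) {G : ℝ} (hG : up b * G = 1)
    (hGε : 2 ≤ ε * G) (huv : u < v) (h1 : 1 / 2 + ε ≤ pr u b) (h2 : pr v b ≤ 1 / 2 - ε) :
    ε ^ 2 / 2 * G ≤ mn v - mn u := by
  have hd := mn_lt huv
  have hd' : 0 < (mn v - mn u) / ε := div_pos (by linarith) hε
  have h3 := (near_of_cross huv h1 h2 (t := ⌈(mn v - mn u) / ε⌉₊) (Nat.ceil_pos.2 hd') (by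
    have := Nat.le_ceil ((mn v - mn u) / ε)
    rwa [div_le_iff₀ hε, mul_comm] at this)).1
  have h4 := h3.trans (near_le_up hb _)
  have h5 := Nat.ceil_lt_add_one hd'.le
  have hG0 : 0 < G := by
    by_contra! h
    nlinarith
  have h6 : ε * G ≤ ⌈(mn v - mn u) / ε⌉₊ := by
    calc ε * G ≤ ⌈(mn v - mn u) / ε⌉₊ * up b * G := by gcongr
      _ = ⌈(mn v - mn u) / ε⌉₊ * (up b * G) := by ring
      _ = _ := by rw [hG, mul_one]
  have h7 : ε * G / 2 ≤ (mn v - mn u) / ε := by linarith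
  rw [le_div_iff₀ hε] at h7
  nlinarith

lemma up_mul_le_sum [Nontrivial Q] {ε : ℝ} (hε : 0 < ε) (hU : Unbalanced Q ε) {w : ℕ}
    (hw : WidthLE Q w) (hw1 : 1 ≤ w) {u b : Q} (hb : b ≠ ⊤) {G μ θ : ℝ} (hG : up b * G = 1)
    (hGε : 2 ≤ ε * G) (hμ : μ = 512 * w / ε ^ 2) (hθ : μ * θ = 2) (hu : 1 / 2 + ε ≤ pr u b)
    (hup : 1 < up u * (θ * G)) :
    up u * Real.exp (2 * μ * mn u / G) ≤
      ∑ v ∈ Finset.univ.filter (fun v => u < v ∧ 1 / 2 + ε ≤ pr v b),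
        cp u v * Real.exp (2 * μ * mn v / G) := by
  have hw' : (1 : ℝ) ≤ w := by exact_mod_cast hw1
  have hG0 : 0 < G := by
    by_contra! h
    nlinarith
  have hut : u ≠ ⊤ := by
    rintro rfl
    rw [pr_of_gt le_top] at hu
    linarith
  have hφ := up_pos hut
  have hμ0 : 0 < μ := by rw [hμ]; positivity
  set φ := up u with hφdef
  set x := 1 / (4 * φ * G) with hx
  have hx0 : 0 < x := by positivity
  have hμx : μ * x ≤ 1 / 2 := by
    rw [hx, mul_one_div, div_le_iff₀ (by positivity)]
    have h1 : μ * 1 ≤ μ * (φ * (θ * G)) := by gcongr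
    have h2 : μ * (φ * (θ * G)) = 2 * (φ * G) := by
      calc _ = μ * θ * (φ * G) := by ring
        _ = _ := by rw [hθ]
    linarith
  have hgood : ∀ v, u < v → Real.exp (2 * μ * mn u / G) * Real.exp (2 * (μ * x)) ≤
      Real.exp (2 * μ * mn v / G) := by
    intro v huv
    rw [← Real.exp_add]
    refine Real.exp_le_exp.2 ?_
    have h1 := one_le_up_mul_left huv
    rw [← hφdef] at h1
    have h2 : x ≤ (mn v - mn u) / G := by
      rw [hx, div_le_div_iff₀ (by positivity) hG0]
      calc 1 * G ≤ 4 * φ * (mn v - mn u) * G := by gcongr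
        _ = _ := by ring
    calc 2 * μ * mn u / G + 2 * (μ * x) ≤ 2 * μ * mn u / G + 2 * (μ * ((mn v - mn u) / G)) := by
          gcongr
      _ = _ := by ring
  have hsplit : φ = ∑ v ∈ Finset.univ.filter (fun v => u < v ∧ 1 / 2 + ε ≤ pr v b), cp u v +
      ∑ v ∈ Finset.univ.filter (fun v => u < v ∧ ¬ 1 / 2 + ε ≤ pr v b), cp u v := by
    rw [hφdef, up_eq_sum, ← Finset.sum_filter_add_sum_filter_not _ (fun v => 1 / 2 + ε ≤ pr v b),
      Finset.filter_filter, Finset.filter_filter]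
  have hleak : ∑ v ∈ Finset.univ.filter (fun v => u < v ∧ ¬ 1 / 2 + ε ≤ pr v b), cp u v ≤
      φ * (μ * x) := by
    set A := Finset.univ.filter (fun v => u < v ∧ ¬ 1 / 2 + ε ≤ pr v b) with hA
    have hfil : ∑ v ∈ A, cp u v = ∑ v ∈ A.filter (fun v => 0 < cp u v), cp u v :=
      (Finset.sum_filter_of_ne fun v _ h =>
        lt_of_le_of_ne (cp_nonneg _ _) (Ne.symm h)).symm
    have hcard : (A.filter fun v => 0 < cp u v).card ≤ w := by
      refine hw _ (antichain_of_lt fun y hy z hz => ?_)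
      simp only [hA, Finset.mem_filter, Finset.mem_univ, true_and] at hy hz
      exact not_lt_of_cp_pos_right hy.1.1 hz.2
    rw [hfil]
    calc _ ≤ ∑ _v ∈ A.filter (fun v => 0 < cp u v), 64 / (ε ^ 2 / 2 * G) := by
          refine Finset.sum_le_sum fun v hv => ?_
          simp only [hA, Finset.mem_filter, Finset.mem_univ, true_and] at hv
          have h1 : pr v b ≤ 1 / 2 - ε := by
            by_cases hvb : v = b
            · have h7 : pr u b ≤ 1 := pb_le_one _
              rw [hvb, pr_self]
              linarith
            · exact (hU v b hvb).resolve_left hv.1.2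
          have h2 := cross_length hε hb hG hGε hv.1.1 hu h1
          have h3 := cp_mul_le hv.1.1
          rw [le_div_iff₀ (by positivity)]
          exact (mul_le_mul_of_nonneg_left h2 (cp_nonneg _ _)).trans h3
      _ = (A.filter fun v => 0 < cp u v).card * (64 / (ε ^ 2 / 2 * G)) := by simp
      _ ≤ w * (64 / (ε ^ 2 / 2 * G)) := by
        have : ((A.filter fun v => 0 < cp u v).card : ℝ) ≤ w := by exact_mod_cast hcard
        gcongr
      _ = φ * (μ * x) := by
        rw [hμ, hx]
        field_simp
        norm_num
  have hE := Real.exp_pos (2 * μ * mn u / G)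
  set E := Real.exp (2 * μ * mn u / G)
  calc φ * E = φ * E * 1 := by ring
    _ ≤ φ * E * (Real.exp (2 * (μ * x)) * (1 - μ * x)) := by
      gcongr
      exact one_le_exp_mul (by positivity) hμx
    _ = (φ - φ * (μ * x)) * (E * Real.exp (2 * (μ * x))) := by ring
    _ ≤ (∑ v ∈ Finset.univ.filter (fun v => u < v ∧ 1 / 2 + ε ≤ pr v b), cp u v) *
        (E * Real.exp (2 * (μ * x))) := by
      gcongr
      linarith
    _ = ∑ v ∈ Finset.univ.filter (fun v => u < v ∧ 1 / 2 + ε ≤ pr v b),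
        cp u v * (E * Real.exp (2 * (μ * x))) := by rw [Finset.sum_mul]
    _ ≤ _ := by
      refine Finset.sum_le_sum fun v hv => ?_
      simp only [Finset.mem_filter_univ] at hv
      exact mul_le_mul_of_nonneg_left (hgood v hv.1) (cp_nonneg _ _)

/-- Conservation of flow: if the weighted flow does not decrease along the elements of `S`, then
the flow out of the base is bounded by the flow into the exits. -/
lemma flow_le {S I : Finset Q} {e : Q} {a : Q → ℝ} {T : Q → Prop} (ha : ∀ v, 0 ≤ a v)
    (heS : e ∈ S) (hS : ∀ u ∈ S, up u * a u ≤
      ∑ v ∈ Finset.univ.filter (fun v => u < v ∧ T v), cp u v * a v)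
    (hT : ∀ u ∈ S, ∀ v, u < v → T v → v ∈ S.erase e ∨ v ∈ I)
    (hne : ∀ v, v ∈ S.erase e ∨ v ∈ I → v ≠ ⊥ ∧ v ≠ ⊤) :
    up e * a e ≤ ∑ v ∈ I, up v * a v := by
  have h1 : ∑ u ∈ S, up u * a u ≤ ∑ u ∈ S, ∑ v ∈ (S.erase e ∪ I).filter (u < ·), cp u v * a v := by
    refine Finset.sum_le_sum fun u hu => (hS u hu).trans ?_
    refine Finset.sum_le_sum_of_subset_of_nonneg (fun v hv => ?_)
      fun v _ _ => mul_nonneg (cp_nonneg _ _) (ha v)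
    simp only [Finset.mem_filter_univ] at hv
    rw [Finset.mem_filter, Finset.mem_union]
    exact ⟨hT u hu v hv.1 hv.2, hv.1⟩
  have h2 : ∑ u ∈ S, ∑ v ∈ (S.erase e ∪ I).filter (u < ·), cp u v * a v =
      ∑ v ∈ S.erase e ∪ I, ∑ u ∈ S.filter (· < v), cp u v * a v := by
    refine Finset.sum_comm' fun u v => ?_
    simp only [Finset.mem_filter]
    tauto
  have h3 : ∑ v ∈ S.erase e ∪ I, ∑ u ∈ S.filter (· < v), cp u v * a v ≤
      ∑ v ∈ S.erase e ∪ I, up v * a v := by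
    refine Finset.sum_le_sum fun v hv => ?_
    obtain ⟨h4, h5⟩ := hne v (Finset.mem_union.1 hv)
    rw [up_eq_dn h4 h5, dn_eq_sum, Finset.sum_mul]
    exact Finset.sum_le_sum_of_subset_of_nonneg
      (Finset.filter_subset_filter _ (Finset.subset_univ _))
      fun u _ _ => mul_nonneg (cp_nonneg _ _) (ha v)
  have hnn : ∀ v, 0 ≤ up v * a v := fun v => mul_nonneg (pb_nonneg _) (ha v)
  have h4 : ∑ v ∈ S.erase e ∪ I, up v * a v ≤
      ∑ v ∈ S.erase e, up v * a v + ∑ v ∈ I, up v * a v := by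
    rw [← Finset.sum_union_inter]
    exact le_add_of_nonneg_right (Finset.sum_nonneg fun v _ => hnn v)
  have h5 := Finset.add_sum_erase S (fun v => up v * a v) heS
  linarith

end

end Balance

namespace Balance

open scoped Classical

noncomputable section

section

variable {Q : Type*} [Fintype Q] [PartialOrder Q] [BoundedOrder Q]

lemma le_of_base [Nontrivial Q] {ε D : ℝ} (hε : 0 < ε) (hε2 : ε ≤ 1 / 2) (hU : Unbalanced Q ε)
    (hD : Steps Q D) {t : ℕ} (ht : 1 ≤ t) (htD : D ≤ ε * t) {w : ℕ} (hw : WidthLE Q w)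
    (hw1 : 1 ≤ w) {e b : Q} (hb : b ≠ ⊤) {G μ θ τ ζ : ℝ} (hG : up b * G = 1)
    (hGε : 2 ≤ ε * G) (hμ : μ = 512 * w / ε ^ 2) (hθ : μ * θ = 2) (he : 1 / 2 + ε ≤ pr e b)
    (hτ : 0 < τ) (hτe : 1 / (4 * τ) ≤ up e) (hτG : 4 * τ < θ * G)
    (hζ : mn b - mn e + 64 * t / ε ≤ ζ * G) :
    θ * G ≤ 4 * τ * (w * (ζ / (θ / 4) + 1) * Real.exp (2 * μ * ζ)) := by
  have hw' : (1 : ℝ) ≤ w := by exact_mod_cast hw1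
  have hG0 : 0 < G := by
    by_contra! h
    nlinarith
  have hμ0 : 0 < μ := by rw [hμ]; positivity
  have hθ0 : 0 < θ := by
    by_contra! h
    nlinarith
  have htop : ∀ v : Q, 1 / 2 + ε ≤ pr v b → v ≠ ⊤ := by
    rintro v hv rfl
    rw [pr_of_gt le_top] at hv
    linarith
  set S := Finset.univ.filter fun u : Q => e ≤ u ∧ 1 / 2 + ε ≤ pr u b ∧ 1 < up u * (θ * G) with hS
  set I := Finset.univ.filter fun u : Q => e < u ∧ 1 / 2 + ε ≤ pr u b ∧ ¬ 1 < up u * (θ * G) with hI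
  have heS : e ∈ S := by
    rw [hS, Finset.mem_filter_univ]
    refine ⟨le_rfl, he, ?_⟩
    rw [div_le_iff₀ (by positivity)] at hτe
    have : 0 < up e := up_pos (htop e he)
    nlinarith
  have hmem : ∀ v, v ∈ S.erase e ∨ v ∈ I → e < v ∧ 1 / 2 + ε ≤ pr v b := by
    rintro v (hv | hv)
    · rw [Finset.mem_erase, hS, Finset.mem_filter_univ] at hv
      exact ⟨lt_of_le_of_ne hv.2.1 (Ne.symm hv.1), hv.2.2.1⟩
    · rw [hI, Finset.mem_filter_univ] at hv
      exact ⟨hv.1, hv.2.1⟩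
  have hflow := flow_le (S := S) (I := I) (e := e) (a := fun v => Real.exp (2 * μ * mn v / G))
    (T := fun v => 1 / 2 + ε ≤ pr v b) (fun v => (Real.exp_pos _).le) heS
    (fun u hu => by
      rw [hS, Finset.mem_filter_univ] at hu
      exact up_mul_le_sum hε hU hw hw1 hb hG hGε hμ hθ hu.2.1 hu.2.2)
    (fun u hu v huv hv => by
      rw [hS, Finset.mem_filter_univ] at hu
      have h1 := lt_of_le_of_lt hu.1 huv
      by_cases h : 1 < up v * (θ * G)
      · left
        rw [Finset.mem_erase, hS, Finset.mem_filter_univ]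
        exact ⟨h1.ne', h1.le, hv, h⟩
      · right
        rw [hI, Finset.mem_filter_univ]
        exact ⟨h1, hv, h⟩)
    (fun v hv => ⟨(hmem v hv).1.ne_bot, htop v (hmem v hv).2⟩)
  have hζ0 : 0 ≤ ζ * G := by
    have := mn_le_of_pr hε hε2 hU hD ht htD he
    linarith
  have hcard : (I.card : ℝ) ≤ w * (ζ * G / (θ * G / 4) + 1) := by
    refine card_le_of_separated hw (by positivity) hζ0 (z := mn e) (fun x hx => ?_)
      fun x hx y hy hxy => ?_
    · obtain ⟨h1, h2⟩ := hmem x (Or.inr hx)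
      have := mn_le_of_pr hε hε2 hU hD ht htD h2
      exact ⟨mn_le h1.le, by linarith⟩
    · rw [hI, Finset.mem_filter_univ] at hx
      have h1 := one_le_up_mul_left hxy
      have h2 := mn_lt hxy
      have h3 := hx.2.2
      by_contra! h4
      have h5 : 0 < up x := up_pos hxy.ne_top
      nlinarith
  have hcard' : (I.card : ℝ) ≤ w * (ζ / (θ / 4) + 1) := by
    refine hcard.trans (le_of_eq ?_)
    field_simp
  have hI' : ∑ v ∈ I, up v * Real.exp (2 * μ * mn v / G) ≤
      I.card * (1 / (θ * G) * (Real.exp (2 * μ * mn e / G) * Real.exp (2 * μ * ζ))) := by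
    rw [← nsmul_eq_mul]
    refine Finset.sum_le_card_nsmul _ _ _ fun v hv => ?_
    have h1 := mn_le_of_pr hε hε2 hU hD ht htD (hmem v (Or.inr hv)).2
    rw [hI, Finset.mem_filter_univ] at hv
    rw [← Real.exp_add]
    have h2 : up v ≤ 1 / (θ * G) := by
      rw [le_div_iff₀ (by positivity)]
      exact not_lt.1 hv.2.2
    have h3 : 2 * μ * mn v / G ≤ 2 * μ * mn e / G + 2 * μ * ζ := by
      rw [div_add' _ _ _ hG0.ne']
      gcongr
      nlinarith
    exact mul_le_mul h2 (Real.exp_le_exp.2 h3) (Real.exp_pos _).le (by positivity)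
  have hE := Real.exp_pos (2 * μ * mn e / G)
  set E := Real.exp (2 * μ * mn e / G)
  have h1 : 1 / (4 * τ) * E ≤ (w * (ζ / (θ / 4) + 1) * Real.exp (2 * μ * ζ)) / (θ * G) * E := by
    calc 1 / (4 * τ) * E ≤ up e * E := by gcongr
      _ ≤ I.card * (1 / (θ * G) * (E * Real.exp (2 * μ * ζ))) := hflow.trans hI'
      _ ≤ w * (ζ / (θ / 4) + 1) * (1 / (θ * G) * (E * Real.exp (2 * μ * ζ))) := by gcongr
      _ = _ := by ring
  have h2 := le_of_mul_le_mul_right h1 hE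
  rw [div_le_div_iff₀ (by positivity) (by positivity)] at h2
  linarith

end

universe u

set_option maxHeartbeats 1000000 in
/-- In an unbalanced poset of bounded width, cover steps have bounded mean length. -/
theorem exists_steps (w : ℕ) (hw1 : 1 ≤ w) (ε : ℝ) (hε : 0 < ε) (hε2 : ε ≤ 1 / 2) :
    ∃ D : ℝ, 1 ≤ D ∧ ∀ (Q : Type u) [Fintype Q] [PartialOrder Q] [BoundedOrder Q] [Nontrivial Q],
      WidthLE Q w → Unbalanced Q ε → Steps Q D := by
  have hw' : (1 : ℝ) ≤ w := by exact_mod_cast hw1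
  obtain ⟨h, hh⟩ : ∃ h : ℝ, h = 8192 * w / ε ^ 2 := ⟨_, rfl⟩
  obtain ⟨y, hy⟩ : ∃ y : ℝ, y = (1 + 32768 * w ^ 2) * h := ⟨_, rfl⟩
  obtain ⟨ζ, hζ⟩ : ∃ ζ : ℝ, ζ = 2 * h + 2 * y + 1 + 192 * w := ⟨_, rfl⟩
  obtain ⟨τ, hτ⟩ : ∃ τ : ℝ, τ = 4 * (2 * y + 128 * w) := ⟨_, rfl⟩
  obtain ⟨μ, hμ⟩ : ∃ μ : ℝ, μ = 512 * w / ε ^ 2 := ⟨_, rfl⟩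
  obtain ⟨θ, hθ⟩ : ∃ θ : ℝ, θ = 2 / μ := ⟨_, rfl⟩
  have hh0 : 0 < h := by rw [hh]; positivity
  have hy0 : 0 < y := by rw [hy]; positivity
  have hζ0 : 0 < ζ := by rw [hζ]; positivity
  have hτ0 : 0 < τ := by rw [hτ]; positivity
  have hμ0 : 0 < μ := by rw [hμ]; positivity
  have hθ0 : 0 < θ := by rw [hθ]; positivity
  have hμθ : μ * θ = 2 := by rw [hθ]; field_simp
  obtain ⟨M, hM⟩ : ∃ M : ℝ, M = 4 * τ * (w * (ζ / (θ / 4) + 1) * Real.exp (2 * μ * ζ)) := ⟨_, rfl⟩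
  have hM0 : 0 < M := by rw [hM]; positivity
  obtain ⟨Gs, hGs⟩ : ∃ Gs : ℝ, Gs = 2 / ε + 3 + 4 * τ / θ + M / θ := ⟨_, rfl⟩
  have hGs3 : 3 ≤ Gs := by
    have : 0 < 2 / ε + 4 * τ / θ + M / θ := by positivity
    linarith
  refine ⟨64 * w * Gs, by
    have h1 : (1 : ℝ) * 3 ≤ w * Gs := by gcongr
    linarith, ?_⟩
  intro Q _ _ _ _ hw hU
  obtain ⟨b, hbt, hmin⟩ := (Finset.univ.filter fun u : Q => u ≠ ⊤).exists_min_image up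
    ⟨⊥, by simp⟩
  rw [Finset.mem_filter_univ] at hbt
  have hφ := up_pos hbt
  obtain ⟨G, hGdef⟩ : ∃ G : ℝ, G = 1 / up b := ⟨_, rfl⟩
  have hG : up b * G = 1 := by rw [hGdef]; field_simp
  have hG0 : 0 < G := by rw [hGdef]; positivity
  have hG1 : 1 ≤ G := by rw [hGdef, le_div_iff₀ hφ]; linarith [up_le_one b]
  have hall : ∀ u : Q, u ≠ ⊤ → 1 ≤ G * up u := by
    intro u hu
    have := hmin u (by simpa using hu)
    rw [← hG, mul_comm]
    gcongr
  suffices hle : G ≤ Gs from steps_of_le_up hw (by linarith) fun u hu => (hall u hu).trans (by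
    have := up_pos hu
    gcongr)
  by_contra! hlt
  have hpos1 : 0 < 2 / ε := by positivity
  have hpos2 : 0 < 4 * τ / θ := by positivity
  have hpos3 : 0 < M / θ := by positivity
  have hG3 : 3 < G := by linarith
  have hGε : 2 ≤ ε * G := by
    have : 2 / ε < G := by linarith
    rw [div_lt_iff₀ hε] at this
    linarith
  have hGτ : 4 * τ < θ * G := by
    have : 4 * τ / θ < G := by linarith
    rw [div_lt_iff₀ hθ0] at this
    linarith
  have hGM : M < θ * G := by
    have : M / θ < G := by linarith
    rw [div_lt_iff₀ hθ0] at this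
    linarith
  have hbb : b ≠ ⊥ := by
    rintro rfl
    rw [up_bot, one_mul] at hG
    linarith
  obtain ⟨D, hDdef⟩ : ∃ D : ℝ, D = 64 * w * G := ⟨_, rfl⟩
  have hD : Steps Q D := hDdef ▸ steps_of_le_up hw hG1 hall
  have hD1 : 1 ≤ D := by
    have h1 : (1 : ℝ) * 1 ≤ w * G := by gcongr
    rw [hDdef]
    linarith
  obtain ⟨t, htdef⟩ : ∃ t : ℕ, t = ⌈D / ε⌉₊ := ⟨_, rfl⟩
  have ht : 1 ≤ t := by rw [htdef]; exact Nat.ceil_pos.2 (by positivity)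
  have htD : D ≤ ε * t := by
    have := Nat.le_ceil (D / ε)
    rwa [div_le_iff₀ hε, mul_comm, ← htdef] at this
  have ht2 : (t : ℝ) ≤ 2 * D / ε := by
    have h1 := Nat.ceil_lt_add_one (a := D / ε) (by positivity)
    rw [← htdef] at h1
    have h2 : 1 ≤ D / ε := by rw [le_div_iff₀ hε]; linarith
    have h3 : 2 * D / ε = D / ε + D / ε := by ring
    linarith
  obtain ⟨H, hH⟩ : ∃ H : ℝ, H = 64 * t / ε := ⟨_, rfl⟩
  have hHG : H ≤ h * G := by
    calc H ≤ 64 * (2 * D / ε) / ε := by rw [hH]; gcongr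
      _ = h * G := by rw [hDdef, hh]; field_simp; norm_num
  have hH1 : 1 ≤ H := by
    rw [hH, le_div_iff₀ hε]
    have : (1 : ℝ) ≤ t := by exact_mod_cast ht
    linarith
  obtain ⟨a, hadef⟩ : ∃ a : ℕ, a = ⌈16 * w * H⌉₊ := ⟨_, rfl⟩
  have ha : 1 ≤ a := by rw [hadef]; exact Nat.ceil_pos.2 (by positivity)
  have haH : 16 * w * H ≤ a := by rw [hadef]; exact Nat.le_ceil _
  have ha2 : (a : ℝ) ≤ 32 * w * H := by
    have h1 := Nat.ceil_lt_add_one (a := 16 * w * H) (by positivity)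
    rw [← hadef] at h1
    have h2 : (1 : ℝ) * 1 ≤ w * H := by gcongr
    linarith
  obtain ⟨Y, hY⟩ : ∃ Y : ℝ, Y = H + 1024 * w * a := ⟨_, rfl⟩
  have hYG : Y ≤ y * G := by
    calc Y ≤ H + 1024 * w * (32 * w * H) := by rw [hY]; gcongr
      _ = (1 + 32768 * w ^ 2) * H := by ring
      _ ≤ (1 + 32768 * w ^ 2) * (h * G) := by gcongr
      _ = _ := by rw [hy]; ring
  have hτ4 : 1 / 4 ≤ τ := by rw [hτ]; linarith
  have hτD : 64 * (w * ((2 * Y + 2 * D) / τ + 1)) < 3 / 4 * D := by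
    have h1 : (2 * Y + 2 * D) / τ ≤ G / 4 := by
      rw [div_le_iff₀ hτ0, hτ, hDdef]
      linarith
    have h2 : (w : ℝ) * ((2 * Y + 2 * D) / τ + 1) ≤ w * (G / 4 + 1) := by gcongr
    have h3 : 3 * (w : ℝ) < G * w := by gcongr
    have h4 : (w : ℝ) * (G / 4 + 1) = G * w / 4 + w := by ring
    have h5 : D = 64 * (G * w) := by rw [hDdef]; ring
    linarith
  obtain ⟨e, he1, he2, he3⟩ := exists_base hε hε2 hU hD ht htD hw hbb ha hw1 (hH ▸ haH)
    (hH ▸ hY) (by linarith) hτ4 hτD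
  rw [← hH] at he3
  have := le_of_base hε hε2 hU hD ht htD hw hw1 hbt hG hGε hμ hμθ he1 hτ0 he2 hGτ (ζ := ζ) (by
    rw [← hH, hζ]
    rw [hDdef] at he3
    linarith)
  linarith

end

end Balance

namespace Balance

open scoped Classical

noncomputable section

section

variable {Q : Type*} [Fintype Q] [PartialOrder Q] [BoundedOrder Q]

variable {ε D : ℝ} (hε : 0 < ε) (hε2 : ε ≤ 1 / 2) (hU : Unbalanced Q ε) (hD : Steps Q D) {t : ℕ}
  (ht : 1 ≤ t) (htD : D ≤ ε * t) (hD1 : 1 ≤ D)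

include hε hε2 hU hD hD1 in
lemma exists_cross_chain {c e : Q} (h : 1 / 2 + ε ≤ pr c e) :
    ∃ u v, u < v ∧ mn v - mn u ≤ D ∧ 1 / 2 + ε ≤ pr u e ∧ pr v e ≤ 1 / 2 - ε ∧
      ∀ f : LinExt Q, mn u - mn c ≤ D * ((rk f u : ℝ) - rk f c) := by
  obtain ⟨u, hu⟩ := (Set.toFinite {u : Q | 1 / 2 + ε ≤ pr u e ∧
    ∀ f : LinExt Q, mn u - mn c ≤ D * ((rk f u : ℝ) - rk f c)}).exists_maximal
    ⟨c, h, fun f => by simp⟩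
  have hut : u ≠ ⊤ := by
    rintro rfl
    have := hu.prop.1
    rw [pr_of_gt le_top] at this
    linarith
  obtain ⟨v, huv, hd⟩ := hD.1 u hut
  refine ⟨u, v, huv, hd, hu.prop.1, ?_, hu.prop.2⟩
  by_cases hve : v = e
  · rw [hve, pr_self]; linarith
  · refine (hU v e hve).resolve_left fun h1 => hu.not_prop_of_gt huv ⟨h1, fun f => ?_⟩
    have h2 : rk f u < rk f v := rk_lt huv
    have h3 : (rk f u : ℝ) + 1 ≤ rk f v := by exact_mod_cast h2
    have h4 := hu.prop.2 f
    have h5 : 0 ≤ (D : ℝ) * (rk f v - rk f u - 1) := mul_nonneg (by linarith) (by linarith)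
    linarith

include hε hε2 hU hD ht htD hD1 in
lemma pr_le_pow {c e : Q} (h : 1 / 2 + ε ≤ pr c e) {k : ℕ}
    (hk : 4 * k * t * D + 64 * t / ε ≤ mn e - mn c) : pr e c ≤ 8 * (1 - ε / 2) ^ k := by
  obtain ⟨u, v, h1, h2, h3, h4, h5⟩ := exists_cross_chain hε hε2 hU hD hD1 h
  obtain ⟨h6, h7⟩ := near_of_cross h1 h3 h4 ht (h2.trans htD)
  have hue : u ≠ e := by
    rintro rfl
    rw [pr_self] at h3
    linarith
  have h8 := (mn_sub_le_exc u e).trans (exc_le_of_near hε ht hue h6)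
  have key : ∀ f : LinExt Q, rk f c + 4 * k * t < rk f v := by
    intro f
    have h9 : rk f u < rk f v := rk_lt h1
    have h10 : D * (4 * k * t : ℕ) ≤ D * ((rk f u : ℝ) - rk f c) := by
      refine le_trans ?_ (h5 f)
      push_cast
      linarith
    have h11 := le_of_mul_le_mul_left h10 (by linarith)
    have h12 : ((4 * k * t + rk f c : ℕ) : ℝ) ≤ rk f u := by push_cast at h11 ⊢; linarith
    have h13 : 4 * k * t + rk f c ≤ rk f u := by exact_mod_cast h12
    omega
  rcases h7 with h7 | h7
  · have : pr e c = 0 := pb_false fun f hf => by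
      have := key f
      rw [h7] at this
      omega
    rw [this]
    have : 0 ≤ 1 - ε / 2 := by linarith
    positivity
  · by_cases hev : e = v
    · have : pr e c = 0 := pb_false fun f hf => by
        have := key f
        rw [← hev] at this
        omega
      rw [this]
      have : 0 ≤ 1 - ε / 2 := by linarith
      positivity
    refine le_trans (pb_mono fun f hf => ?_) (pb_far_le hev ht hε h7 k)
    have := key f
    omega

include hε hε2 hU hD ht htD hD1 in
lemma min_pr_le_pow {c e : Q} {k : ℕ} (hk : 4 * k * t * D + 64 * t / ε ≤ |mn e - mn c| ∨ k = 0) :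
    min (pr e c) (pr c e) ≤ 8 * (1 - ε / 2) ^ k := by
  by_cases hk1 : k = 0
  · subst hk1
    have : pr e c ≤ 1 := pb_le_one _
    exact (min_le_left _ _).trans (by simp; linarith)
  replace hk := hk.resolve_right hk1
  by_cases hce : c = e
  · subst hce
    simp only [min_self, pr_self]
    have : 0 ≤ 1 - ε / 2 := by linarith
    positivity
  have hH : 0 < 64 * (t : ℝ) / ε := by
    have : (0 : ℝ) < t := by exact_mod_cast ht
    positivity
  have hk0 : 0 < 4 * (k : ℝ) * t * D := by
    have h1 : 0 < k := by omega
    positivity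
  rcases hU c e hce with h | h
  · refine (min_le_left _ _).trans (pr_le_pow hε hε2 hU hD ht htD hD1 h ?_)
    have := mn_le_of_pr hε hε2 hU hD ht htD h
    rcases abs_cases (mn e - mn c) with h1 | h1 <;> linarith
  · have h : 1 / 2 + ε ≤ pr e c := by linarith [pr_add hce]
    refine (min_le_right _ _).trans (pr_le_pow hε hε2 hU hD ht htD hD1 h ?_)
    have := mn_le_of_pr hε hε2 hU hD ht htD h
    rcases abs_cases (mn e - mn c) with h1 | h1 <;> linarith

include hε hε2 hU hD ht htD hD1 in
lemma sum_min_pr_le {w : ℕ} (hw : WidthLE Q w) (c : Q) :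
    ∑ e, min (pr e c) (pr c e) ≤ 32 * w * (4 * t * D + 64 * t / ε + 1) / ε := by
  have ht' : (0 : ℝ) < t := by exact_mod_cast ht
  obtain ⟨H, hH⟩ : ∃ H : ℝ, H = 64 * t / ε := ⟨_, rfl⟩
  obtain ⟨s, hs⟩ : ∃ s : ℝ, s = 4 * t * D := ⟨_, rfl⟩
  have hH0 : 0 < H := by rw [hH]; positivity
  have hs0 : 0 < s := by rw [hs]; positivity
  rw [← hH, ← hs]
  set κ : Q → ℕ := fun e => ⌊(|mn e - mn c| - H) / s⌋₊ with hκ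
  set N := ∑ e, κ e + 1 with hN
  have hr : 0 ≤ 1 - ε / 2 := by linarith
  have hmaps : ∀ e ∈ (Finset.univ : Finset Q), κ e ∈ Finset.range N := fun e he => by
    have := Finset.single_le_sum (f := κ) (fun _ _ => Nat.zero_le _) he
    rw [Finset.mem_range]
    omega
  have hbin : ∀ k : ℕ, ((Finset.univ.filter fun e => κ e = k).card : ℝ) ≤ 2 * (w * (s + H + 1)) := by
    intro k
    have h1 : (Finset.univ.filter fun e => κ e = k) ⊆
        (Finset.univ.filter fun e => mn c + k * s ≤ mn e ∧ mn e ≤ mn c + k * s + (s + H)) ∪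
        Finset.univ.filter fun e => mn c - k * s - (s + H) ≤ mn e ∧
          mn e ≤ mn c - k * s - (s + H) + (s + H) := by
      intro e he
      rw [Finset.mem_filter_univ] at he
      rw [Finset.mem_union, Finset.mem_filter_univ, Finset.mem_filter_univ]
      have h2 : (|mn e - mn c| - H) / s < k + 1 := by
        rw [← he]; exact Nat.lt_floor_add_one _
      rw [div_lt_iff₀ hs0] at h2
      have h3 : k * s ≤ |mn e - mn c| := by
        rcases Nat.eq_zero_or_pos k with rfl | hk
        · simp
        · have h4 : (k : ℝ) ≤ (|mn e - mn c| - H) / s := by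
            rw [← he]
            refine Nat.floor_le (le_of_not_gt fun h => ?_)
            have : κ e = 0 := Nat.floor_of_nonpos h.le
            omega
          rw [le_div_iff₀ hs0] at h4
          linarith
      rcases abs_cases (mn e - mn c) with h4 | h4
      · left; constructor <;> linarith
      · right; constructor <;> linarith
    have h2 := Finset.card_le_card h1
    have h3 := h2.trans (Finset.card_union_le _ _)
    have h4 := card_le_of_interval hw (S := Finset.univ.filter fun e => mn c + k * s ≤ mn e ∧
      mn e ≤ mn c + k * s + (s + H)) (L := s + H) (by positivity) fun x hx => by
        rwa [Finset.mem_filter_univ] at hx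
    have h5 := card_le_of_interval hw (S := Finset.univ.filter fun e => mn c - k * s - (s + H) ≤ mn e ∧
          mn e ≤ mn c - k * s - (s + H) + (s + H)) (L := s + H) (by positivity) fun x hx => by
        rwa [Finset.mem_filter_univ] at hx
    have h6 := (Nat.cast_le (α := ℝ)).2 h3
    push_cast at h6
    linarith
  rw [← Finset.sum_fiberwise_of_maps_to hmaps]
  have hgeom : ε * ∑ k ∈ Finset.range N, (1 - ε / 2) ^ k ≤ 2 := by
    have h1 := geom_sum_mul (1 - ε / 2) N
    have h2 : (∑ k ∈ Finset.range N, (1 - ε / 2) ^ k) * (ε / 2) = 1 - (1 - ε / 2) ^ N := by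
      linarith
    have h3 : 0 ≤ (1 - ε / 2) ^ N := pow_nonneg hr _
    linarith
  calc ∑ k ∈ Finset.range N, ∑ e ∈ Finset.univ.filter (fun e => κ e = k), min (pr e c) (pr c e)
      ≤ ∑ k ∈ Finset.range N, 2 * (w * (s + H + 1)) * (8 * (1 - ε / 2) ^ k) := by
        refine Finset.sum_le_sum fun k _ => ?_
        calc _ ≤ (Finset.univ.filter fun e => κ e = k).card • (8 * (1 - ε / 2) ^ k) := by
              refine Finset.sum_le_card_nsmul _ _ _ fun e he => ?_
              rw [Finset.mem_filter_univ] at he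
              refine min_pr_le_pow hε hε2 hU hD ht htD hD1 ?_
              by_cases hk : k = 0
              · exact Or.inr hk
              left
              have h4 : (k : ℝ) ≤ (|mn e - mn c| - H) / s := by
                rw [← he]
                refine Nat.floor_le (le_of_not_gt fun h => ?_)
                have : κ e = 0 := Nat.floor_of_nonpos h.le
                omega
              rw [le_div_iff₀ hs0, hs] at h4
              rw [← hH]
              linarith
          _ ≤ _ := by
            rw [nsmul_eq_mul]
            have := hbin k
            gcongr
    _ = 16 * (w * (s + H + 1)) * ∑ k ∈ Finset.range N, (1 - ε / 2) ^ k := by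
        rw [Finset.mul_sum]
        exact Finset.sum_congr rfl fun k _ => by ring
    _ ≤ 16 * (w * (s + H + 1)) * (2 / ε) := by
        gcongr
        rw [le_div_iff₀ hε]
        linarith
    _ = _ := by ring

end

section

variable {Q : Type*} [Fintype Q] [PartialOrder Q]

lemma ex_abs_count_sub_le {ε Λ : ℝ} (hε : 0 < ε) (hU : Unbalanced Q ε) {c : Q}
    (hΛ : ∑ e, min (pr e c) (pr c e) ≤ Λ) (W : Finset Q) :
    ex (fun f => |((W.filter fun e => rk f e < rk f c).card : ℝ) -
      (W.filter fun e => 1 / 2 + ε ≤ pr e c).card|) ≤ Λ := by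
  have h1 : ∀ e : Q, ex (fun f => |(if rk f e < rk f c then (1 : ℝ) else 0) -
      if 1 / 2 + ε ≤ pr e c then 1 else 0|) ≤ min (pr e c) (pr c e) := by
    intro e
    by_cases hec : e = c
    · subst hec
      simp only [pr_self, min_self, lt_irrefl, if_false]
      rw [if_neg (by linarith)]
      simp [ex_const]
    by_cases hR : 1 / 2 + ε ≤ pr e c
    · have h2 : pr c e ≤ pr e c := by linarith [pr_add hec]
      rw [min_eq_right h2]
      refine ex_mono fun f => ?_
      have hne : rk f e ≠ rk f c := fun h => hec (rk_inj.1 h)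
      by_cases h3 : rk f e < rk f c
      · have h4 : ¬ rk f c < rk f e := by omega
        rw [if_pos hR]; simp [h3, h4]
      · have h4 : rk f c < rk f e := by omega
        rw [if_pos hR]; simp [h3, h4]
    · have h2 := (hU e c hec).resolve_left hR
      have h3 : pr e c ≤ pr c e := by linarith [pr_add hec]
      rw [min_eq_left h3]
      refine ex_mono fun f => ?_
      rw [if_neg hR]
      by_cases h3 : rk f e < rk f c <;> simp [h3]
  calc _ ≤ ex (fun f => ∑ e ∈ W, |(if rk f e < rk f c then (1 : ℝ) else 0) -
      if 1 / 2 + ε ≤ pr e c then 1 else 0|) := by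
        refine ex_mono fun f => ?_
        rw [Finset.natCast_card_filter, Finset.natCast_card_filter, ← Finset.sum_sub_distrib]
        exact Finset.abs_sum_le_sum_abs _ _
    _ ≤ ∑ e ∈ W, min (pr e c) (pr c e) := by
        rw [ex_sum]
        exact Finset.sum_le_sum fun e _ => h1 e
    _ ≤ ∑ e, min (pr e c) (pr c e) := Finset.sum_le_sum_of_subset_of_nonneg
        (Finset.subset_univ _) fun e _ _ => le_min (pb_nonneg _) (pb_nonneg _)
    _ ≤ Λ := hΛ

lemma card_filter_rk_lt (f : LinExt Q) {j : ℕ} (hj : j ≤ Fintype.card Q) :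
    (Finset.univ.filter fun e => rk f e < j).card = j := by
  rw [← Finset.card_range j]
  refine Finset.card_bij (fun e _ => rk f e) (fun e he => ?_) (fun a _ b _ h => rk_inj.1 h)
    fun i hi => ?_
  · simpa using he
  · rw [Finset.mem_range] at hi
    obtain ⟨e, rfl⟩ := exists_rk_eq f (lt_of_lt_of_le hi hj)
    exact ⟨e, by simpa using hi, rfl⟩

lemma ex_abs_rk_sub_mn_le {ε Λ : ℝ} (hε : 0 < ε) (hU : Unbalanced Q ε) {c : Q}
    (hΛ : ∑ e, min (pr e c) (pr c e) ≤ Λ) :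
    ex (fun f => |(rk f c : ℝ) - mn c|) ≤ 2 * Λ := by
  have h1 := ex_abs_count_sub_le hε hU hΛ Finset.univ
  set k : ℝ := ((Finset.univ.filter fun e => 1 / 2 + ε ≤ pr e c).card : ℝ) with hk
  have h2 : ex (fun f => |(rk f c : ℝ) - k|) ≤ Λ := by
    refine le_trans (le_of_eq (congrArg ex (funext fun f => ?_))) h1
    rw [card_filter_rk_lt f (rk_lt_card f c).le]
  have h3 : |mn c - k| ≤ Λ := by
    have h4 : mn c - k = ex fun f => (rk f c : ℝ) - k := by
      rw [ex_sub, ex_const]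
      rfl
    rw [abs_le, h4]
    constructor
    · have h5 : -ex (fun f => |(rk f c : ℝ) - k|) ≤ ex fun f => (rk f c : ℝ) - k := by
        rw [neg_eq_neg_one_mul, ← ex_mul]
        exact ex_mono fun f => by linarith [neg_abs_le ((rk f c : ℝ) - k)]
      linarith
    · exact (ex_mono fun f => le_abs_self _).trans h2
  calc _ ≤ ex (fun f => |(rk f c : ℝ) - k| + |mn c - k|) := ex_mono fun f => by
        have := abs_sub_le (rk f c : ℝ) k (mn c)
        rw [abs_sub_comm k] at this
        exact this
    _ = ex (fun f => |(rk f c : ℝ) - k|) + |mn c - k| := by rw [ex_add, ex_const]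
    _ ≤ _ := by linarith

end

universe u

/-- In an unbalanced poset of bounded width, cover steps are short and every position is
concentrated, with constants depending only on the width and the imbalance. -/
theorem exists_concentration (w : ℕ) (hw1 : 1 ≤ w) (ε : ℝ) (hε : 0 < ε) (hε2 : ε ≤ 1 / 2) :
    ∃ D Λ : ℝ, 1 ≤ D ∧ 1 ≤ Λ ∧
      ∀ (Q : Type u) [Fintype Q] [PartialOrder Q] [BoundedOrder Q] [Nontrivial Q],
      WidthLE Q w → Unbalanced Q ε → Steps Q D ∧ (∀ c d : Q, mn c + Λ < mn d → 1 / 2 + ε ≤ pr c d) ∧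
        ∀ c : Q, ∑ e, min (pr e c) (pr c e) ≤ Λ := by
  obtain ⟨D, hD1, hD⟩ := exists_steps.{u} w hw1 ε hε hε2
  obtain ⟨t, htdef⟩ : ∃ t : ℕ, t = ⌈D / ε⌉₊ := ⟨_, rfl⟩
  have ht : 1 ≤ t := by rw [htdef]; exact Nat.ceil_pos.2 (by positivity)
  have htD : D ≤ ε * t := by
    have := Nat.le_ceil (D / ε)
    rwa [div_le_iff₀ hε, mul_comm, ← htdef] at this
  have hw' : (1 : ℝ) ≤ w := by exact_mod_cast hw1
  have hH : 0 ≤ 64 * (t : ℝ) / ε := by positivity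
  have hs : 0 ≤ 4 * (t : ℝ) * D := by positivity
  have hle : 4 * t * D + 64 * t / ε + 1 ≤ 32 * w * (4 * t * D + 64 * t / ε + 1) / ε := by
    rw [le_div_iff₀ hε]
    have h0 : 0 ≤ 4 * t * D + 64 * t / ε + 1 := by positivity
    have h1 : ε ≤ 32 * w := by linarith
    rw [mul_comm]
    gcongr
  refine ⟨D, 32 * w * (4 * t * D + 64 * t / ε + 1) / ε, hD1, by linarith, ?_⟩
  intro Q _ _ _ _ hw hU
  exact ⟨hD Q hw hU, fun c d h => pr_of_mn_lt hε hε2 hU (hD Q hw hU) ht htD (by linarith),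
    sum_min_pr_le hε hε2 hU (hD Q hw hU) ht htD hD1 hw⟩

end

end Balance

namespace Balance

open scoped Classical

noncomputable section

variable {Q : Type*} [Fintype Q] [PartialOrder Q]

/-- The indicator of the event that position `a` is occupied by an element of `U`. -/
def occ (U : Finset Q) (a : ℕ) (f : LinExt Q) : ℝ := if ∃ u ∈ U, rk f u = a then 1 else 0

/-- The number of elements of `U` at positions smaller than `j`. -/
def cnt (U : Finset Q) (j : ℕ) (f : LinExt Q) : ℝ := (U.filter fun u => rk f u < j).card

variable {U : Finset Q}

lemma occ_eq (U : Finset Q) (a : ℕ) (f : LinExt Q) : occ U a f = 0 ∨ occ U a f = 1 := by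
  unfold occ
  split_ifs <;> simp

lemma occ_nonneg (U : Finset Q) (a : ℕ) (f : LinExt Q) : 0 ≤ occ U a f := by
  rcases occ_eq U a f with h | h <;> rw [h]; norm_num

lemma occ_le_one (U : Finset Q) (a : ℕ) (f : LinExt Q) : occ U a f ≤ 1 := by
  rcases occ_eq U a f with h | h <;> rw [h]; norm_num

lemma cnt_succ (U : Finset Q) (j : ℕ) (f : LinExt Q) : cnt U (j + 1) f = cnt U j f + occ U j f := by
  have h1 : (U.filter fun u => rk f u < j + 1).card =
      (U.filter fun u => rk f u < j).card + (U.filter fun u => rk f u = j).card := by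
    rw [← Finset.card_union_of_disjoint, ← Finset.filter_or]
    · congr 1
      ext u
      simp only [Finset.mem_filter]
      refine and_congr_right fun _ => by omega
    · refine Finset.disjoint_filter.2 fun u _ h => by omega
  unfold cnt occ
  rw [h1]
  push_cast
  congr 1
  split_ifs with h
  · obtain ⟨u, hu, huj⟩ := h
    have : (U.filter fun u => rk f u = j) = {u} := by
      ext v
      rw [Finset.mem_filter, Finset.mem_singleton]
      exact ⟨fun hv => rk_inj.1 (hv.2.trans huj.symm), fun hv => hv ▸ ⟨hu, huj⟩⟩
    rw [this]
    simp
  · rw [Nat.cast_eq_zero, Finset.card_eq_zero, Finset.filter_eq_empty_iff]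
    exact fun u hu huj => h ⟨u, hu, huj⟩

lemma cnt_mono (U : Finset Q) {i j : ℕ} (h : i ≤ j) (f : LinExt Q) : cnt U i f ≤ cnt U j f := by
  unfold cnt
  exact_mod_cast Finset.card_le_card fun u hu => by
    rw [Finset.mem_filter] at hu ⊢
    exact ⟨hu.1, by omega⟩

lemma cnt_sub_eq_sum (U : Finset Q) {i j : ℕ} (h : i ≤ j) (f : LinExt Q) :
    cnt U j f - cnt U i f = ∑ a ∈ Finset.Ico i j, occ U a f := by
  induction j, h using Nat.le_induction with
  | base => simp
  | succ j hj ih => rw [Finset.sum_Ico_succ_top hj, ← ih, cnt_succ]; ring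

lemma cnt_swp {a j : ℕ} (h : j ≠ a + 1) (f : LinExt Q) : cnt U j (swp a f) = cnt U j f := by
  unfold cnt
  congr 2
  exact Finset.filter_congr fun u _ => rk_swp_lt_iff f u h

lemma occ_swp_left {a : ℕ} {f : LinExt Q} (h : Swappable a f) :
    occ U a (swp a f) = occ U (a + 1) f := by
  have : (∃ u ∈ U, rk (swp a f) u = a) ↔ ∃ u ∈ U, rk f u = a + 1 := by
    refine exists_congr fun u => and_congr_right fun _ => ?_
    rw [rk_swp h]
    split_ifs <;> omega
  simp only [occ, this]

lemma occ_swp_right {a : ℕ} {f : LinExt Q} (h : Swappable a f) :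
    occ U (a + 1) (swp a f) = occ U a f := by
  have : (∃ u ∈ U, rk (swp a f) u = a + 1) ↔ ∃ u ∈ U, rk f u = a := by
    refine exists_congr fun u => and_congr_right fun _ => ?_
    rw [rk_swp h]
    split_ifs <;> omega
  simp only [occ, this]

lemma swappable_of_occ (hU : ∀ u ∈ U, ∀ v, u < v → v ∈ U) {a : ℕ} (ha : a + 1 < Fintype.card Q)
    {f : LinExt Q} (h1 : occ U a f = 1) (h2 : occ U (a + 1) f = 0) : Swappable a f := by
  have h1' : ∃ u ∈ U, rk f u = a := by
    by_contra h
    rw [occ, if_neg h] at h1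
    norm_num at h1
  have h2' : ¬ ∃ u ∈ U, rk f u = a + 1 := by
    intro h
    rw [occ, if_pos h] at h2
    norm_num at h2
  obtain ⟨u, hu, hua⟩ := h1'
  obtain ⟨v, hv⟩ := exists_rk_eq f ha
  exact ⟨u, v, hua, hv, fun huv => h2' ⟨v, hU u hu v huv, hv⟩⟩

/-- The exchange inequality for adjacent positions and an upper set. -/
lemma ex_occ_sub_le (hU : ∀ u ∈ U, ∀ v, u < v → v ∈ U) {a : ℕ} (ha : a + 1 < Fintype.card Q)
    {φ g : LinExt Q → ℝ}
    (h1 : ∀ f, occ U a f = 0 → occ U (a + 1) f = 1 → Swappable a f → φ (swp a f) ≤ φ f + g f)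
    (h2 : ∀ f, occ U a f = 0 → occ U (a + 1) f = 1 → 0 ≤ φ f + g f) :
    ex (fun f => (occ U a f - occ U (a + 1) f) * φ f) ≤
      ex fun f => (1 - occ U a f) * occ U (a + 1) f * g f := by
  have e1 : ex (fun f => (occ U a f - occ U (a + 1) f) * φ f) =
      ex (fun f => occ U a (swp a f) * (1 - occ U (a + 1) (swp a f)) * φ (swp a f)) -
      ex (fun f => (1 - occ U a f) * occ U (a + 1) f * φ f) := by
    rw [ex_comp (swp_invol a) (fun f => occ U a f * (1 - occ U (a + 1) f) * φ f), ← ex_sub]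
    exact congrArg ex (funext fun f => by ring)
  rw [e1, ← ex_sub]
  refine ex_mono fun f => ?_
  by_cases hsw : Swappable a f
  · rw [occ_swp_left hsw, occ_swp_right hsw]
    rcases occ_eq U a f with h3 | h3 <;> rcases occ_eq U (a + 1) f with h4 | h4 <;>
      simp only [h3, h4] <;> norm_num
    linarith [h1 f h3 h4 hsw]
  · rw [swp_of_not hsw]
    rcases occ_eq U a f with h3 | h3 <;> rcases occ_eq U (a + 1) f with h4 | h4
    · simp [h3, h4]
    · have := h2 f h3 h4
      simp only [h3, h4]
      linarith
    · exact absurd (swappable_of_occ hU ha h3 h4) hsw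
    · simp [h3, h4]

lemma ex_occ_mul_mono (hU : ∀ u ∈ U, ∀ v, u < v → v ∈ U) {φ : LinExt Q → ℝ} (hφ : ∀ f, 0 ≤ φ f)
    {i j : ℕ} (hij : i ≤ j) (hj : j < Fintype.card Q)
    (hinv : ∀ a, i ≤ a → a < j → ∀ f, φ (swp a f) = φ f) :
    ex (fun f => occ U i f * φ f) ≤ ex fun f => occ U j f * φ f := by
  induction j, hij using Nat.le_induction with
  | base => exact le_rfl
  | succ j hij ih =>
    refine (ih (by omega) fun a h1 h2 => hinv a h1 (by omega)).trans ?_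
    have h3 := ex_occ_sub_le hU (a := j) hj (φ := φ) (g := fun _ => 0)
      (fun f _ _ _ => by rw [hinv j hij (by omega), add_zero]) fun f _ _ => by
        rw [add_zero]; exact hφ f
    simp only [mul_zero, ex_const, sub_mul] at h3
    rw [ex_sub] at h3
    linarith

lemma ex_occ_mono (hU : ∀ u ∈ U, ∀ v, u < v → v ∈ U) {i j : ℕ} (hij : i ≤ j)
    (hj : j < Fintype.card Q) : ex (occ U i) ≤ ex (occ U j) := by
  have := ex_occ_mul_mono hU (φ := fun _ => 1) (fun _ => zero_le_one) hij hj fun _ _ _ _ => rfl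
  simpa using this

/-- The second difference of the counting function of `U` at the middle of a window. -/
def bend (U : Finset Q) (L ℓ : ℕ) (f : LinExt Q) : ℝ :=
  2 * cnt U (L + ℓ) f - cnt U L f - cnt U (L + ℓ + ℓ) f

lemma bend_eq (U : Finset Q) (L ℓ : ℕ) (f : LinExt Q) : bend U L ℓ f =
    ∑ a ∈ Finset.Ico L (L + ℓ), occ U a f - ∑ a ∈ Finset.Ico (L + ℓ) (L + ℓ + ℓ), occ U a f := by
  rw [← cnt_sub_eq_sum U (by omega), ← cnt_sub_eq_sum U (by omega), bend]
  ring

lemma ex_bend_mul_le (hU : ∀ u ∈ U, ∀ v, u < v → v ∈ U) {L ℓ p : ℕ} (hp : L + ℓ = p + 1)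
    (hℓ : 1 ≤ ℓ) (hn : p + 1 + ℓ ≤ Fintype.card Q) {φ g : LinExt Q → ℝ} (hφ : ∀ f, 0 ≤ φ f)
    (hinv : ∀ a, L ≤ a → a + 1 < p + 1 + ℓ → a ≠ p → ∀ f, φ (swp a f) = φ f)
    (h1 : ∀ f, occ U p f = 0 → occ U (p + 1) f = 1 → Swappable p f → φ (swp p f) ≤ φ f + g f)
    (h2 : ∀ f, occ U p f = 0 → occ U (p + 1) f = 1 → 0 ≤ φ f + g f) :
    ex (fun f => bend U L ℓ f * φ f) ≤ ℓ * ex fun f => (1 - occ U p f) * occ U (p + 1) f * g f := by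
  have e : ex (fun f => bend U L ℓ f * φ f) =
      ∑ a ∈ Finset.Ico L (p + 1), ex (fun f => occ U a f * φ f) -
      ∑ a ∈ Finset.Ico (p + 1) (p + 1 + ℓ), ex (fun f => occ U a f * φ f) := by
    rw [← ex_sum, ← ex_sum, ← ex_sub]
    refine congrArg ex (funext fun f => ?_)
    rw [bend_eq, hp, sub_mul, Finset.sum_mul, Finset.sum_mul]
  have h3 : ∑ a ∈ Finset.Ico L (p + 1), ex (fun f => occ U a f * φ f) ≤
      ℓ * ex fun f => occ U p f * φ f := by
    have := Finset.sum_le_card_nsmul (Finset.Ico L (p + 1)) (fun a => ex fun f => occ U a f * φ f)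
      (ex fun f => occ U p f * φ f) fun a ha => by
        rw [Finset.mem_Ico] at ha
        exact ex_occ_mul_mono hU hφ (by omega) (by omega) fun b hb1 hb2 =>
          hinv b (by omega) (by omega) (by omega)
    rwa [Nat.card_Ico, nsmul_eq_mul, show p + 1 - L = ℓ by omega] at this
  have h4 : ℓ * ex (fun f => occ U (p + 1) f * φ f) ≤
      ∑ a ∈ Finset.Ico (p + 1) (p + 1 + ℓ), ex (fun f => occ U a f * φ f) := by
    have := Finset.card_nsmul_le_sum (Finset.Ico (p + 1) (p + 1 + ℓ))
      (fun a => ex fun f => occ U a f * φ f)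
      (ex fun f => occ U (p + 1) f * φ f) fun a ha => by
        rw [Finset.mem_Ico] at ha
        exact ex_occ_mul_mono hU hφ (by omega) (by omega) fun b hb1 hb2 =>
          hinv b (by omega) (by omega) (by omega)
    rwa [Nat.card_Ico, nsmul_eq_mul, show p + 1 + ℓ - (p + 1) = ℓ by omega] at this
  have h5 := ex_occ_sub_le hU (a := p) (by omega) h1 h2
  simp only [sub_mul (occ U p _)] at h5
  rw [ex_sub] at h5
  have h6 : (0 : ℝ) ≤ ℓ := by positivity
  have h7 := mul_le_mul_of_nonneg_left h5 h6
  rw [e]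
  linarith

lemma bend_swp_of_ne {L ℓ p a : ℕ} (hp : L + ℓ = p + 1) (h1 : L ≤ a) (h2 : a + 1 < p + 1 + ℓ)
    (h3 : a ≠ p) (f : LinExt Q) : bend U L ℓ (swp a f) = bend U L ℓ f := by
  unfold bend
  rw [cnt_swp (by omega), cnt_swp (by omega), cnt_swp (by omega)]

lemma cnt_succ_swp {p : ℕ} {f : LinExt Q} (h1 : occ U p f = 0) (h2 : occ U (p + 1) f = 1)
    (h : Swappable p f) : cnt U (p + 1) (swp p f) = cnt U (p + 1) f + 1 := by
  rw [cnt_succ, cnt_succ, cnt_swp (by omega), occ_swp_left h, h1, h2, add_zero]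

lemma ex_max_bend_le (hU : ∀ u ∈ U, ∀ v, u < v → v ∈ U) {L ℓ p m : ℕ} (hp : L + ℓ = p + 1)
    (hm : 1 ≤ m) (hℓ : ℓ = 2 * m ^ 2) (hn : p + 1 + ℓ ≤ Fintype.card Q) :
    ex (fun f => max 0 (bend U L ℓ f)) ≤ 2 * m := by
  have hℓ1 : 1 ≤ ℓ := by rw [hℓ]; nlinarith
  have hm' : (1 : ℝ) ≤ m := by exact_mod_cast hm
  have hℓ' : (ℓ : ℝ) = 2 * m ^ 2 := by rw [hℓ]; push_cast; ring
  have h1 := ex_bend_mul_le hU hp hℓ1 hn (φ := fun f => max 0 (bend U L ℓ f)) (g := fun _ => 2)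
    (fun f => le_max_left _ _) (fun a h1 h2 h3 f => by rw [bend_swp_of_ne hp h1 h2 h3])
    (fun f h2 h3 h4 => by
      have e : bend U L ℓ (swp p f) = bend U L ℓ f + 2 := by
        unfold bend
        rw [hp, cnt_succ_swp h2 h3 h4, cnt_swp (by omega), cnt_swp (by omega)]
        ring
      rw [e]
      have := le_max_left 0 (bend U L ℓ f)
      have := le_max_right 0 (bend U L ℓ f)
      exact max_le (by linarith) (by linarith))
    (fun f _ _ => by
      have := le_max_left 0 (bend U L ℓ f)
      linarith)
  have h2 : ex (fun f => (1 - occ U p f) * occ U (p + 1) f * 2) ≤ 2 := by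
    refine (ex_mono fun f => ?_).trans (le_of_eq (ex_const (2 : ℝ)))
    rcases occ_eq U p f with h3 | h3 <;> rcases occ_eq U (p + 1) f with h4 | h4 <;>
      rw [h3, h4] <;> norm_num
  have h3 : ex (fun f => 4 * m * max 0 (bend U L ℓ f)) ≤
      ex (fun f => bend U L ℓ f * max 0 (bend U L ℓ f) + 4 * m ^ 2) := by
    refine ex_mono fun f => ?_
    rcases max_cases 0 (bend U L ℓ f) with h | h
    · rw [h.1]; simp
    · rw [h.1]; nlinarith [sq_nonneg (bend U L ℓ f - 2 * m)]
  rw [ex_mul, ex_add, ex_const] at h3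
  have h4 : (ℓ : ℝ) * ex (fun f => (1 - occ U p f) * occ U (p + 1) f * 2) ≤ ℓ * 2 := by gcongr
  rw [hℓ'] at h1 h4
  have h5 : (m : ℝ) * ex (fun f => max 0 (bend U L ℓ f)) ≤ m * (2 * m) := by nlinarith
  exact le_of_mul_le_mul_left h5 (by linarith)

lemma pb_window_le (hU : ∀ u ∈ U, ∀ v, u < v → v ∈ U) {L ℓ p m : ℕ} (hp : L + ℓ = p + 1)
    (hm : 1 ≤ m) (hℓ : ℓ = 2 * m ^ 2) (hn : p + 1 + ℓ ≤ Fintype.card Q) (k T : ℕ) :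
    ℓ * pb (fun f => occ U p f = 0 ∧ occ U (p + 1) f = 1 ∧ |cnt U (p + 1) f - k| < T) ≤
      2 * T * (2 * m - ex (bend U L ℓ)) := by
  have hℓ1 : 1 ≤ ℓ := by rw [hℓ]; nlinarith
  set ψ : ℝ → ℝ := fun c => max 0 (min (2 * T) (k + T - c)) with hψ
  have hψ0 : ∀ c, 0 ≤ ψ c := fun c => le_max_left _ _
  have hψT : ∀ c, ψ c ≤ 2 * T := fun c => max_le (by positivity) (min_le_left _ _)
  have hψmono : ∀ c, ψ (c + 1) ≤ ψ c := fun c =>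
    max_le_max le_rfl (min_le_min le_rfl (by linarith))
  have hψeq : ∀ c : ℕ, |(c : ℝ) - k| < T → ψ c = k + T - c ∧ ψ (c + 1) = k + T - c - 1 ∧
      (1 : ℝ) ≤ k + T - c := by
    intro c hc
    rw [abs_lt] at hc
    have h1 : c < k + T := by
      have : (c : ℝ) < (k + T : ℕ) := by push_cast; linarith
      exact_mod_cast this
    have h2 : (c : ℝ) + 1 ≤ k + T := by exact_mod_cast h1
    refine ⟨?_, ?_, by linarith⟩
    · rw [hψ]
      simp only
      rw [min_eq_right (by linarith), max_eq_right (by linarith)]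
    · rw [hψ]
      simp only
      rw [min_eq_right (by linarith), max_eq_right (by linarith)]
      ring
  have h1 := ex_bend_mul_le hU hp hℓ1 hn (φ := fun f => ψ (cnt U (p + 1) f))
    (g := fun f => -(if |cnt U (p + 1) f - k| < T then 1 else 0)) (fun f => hψ0 _)
    (fun a h1 h2 h3 f => by rw [cnt_swp (by omega)])
    (fun f h2 h3 h4 => by
      rw [cnt_succ_swp h2 h3 h4]
      split_ifs with h
      · obtain ⟨h5, h6, -⟩ := hψeq _ h
        unfold cnt
        rw [h5, h6]
        linarith
      · have := hψmono (cnt U (p + 1) f)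
        linarith)
    (fun f _ _ => by
      split_ifs with h
      · obtain ⟨h5, -, h7⟩ := hψeq _ h
        unfold cnt
        rw [h5]
        linarith
      · have := hψ0 (cnt U (p + 1) f)
        linarith)
  have h2 : ex (fun f => (1 - occ U p f) * occ U (p + 1) f *
      -(if |cnt U (p + 1) f - k| < T then 1 else 0)) =
      -pb (fun f => occ U p f = 0 ∧ occ U (p + 1) f = 1 ∧ |cnt U (p + 1) f - k| < T) := by
    unfold pb
    rw [neg_eq_neg_one_mul, ← ex_mul]
    refine congrArg ex (funext fun f => ?_)
    rcases occ_eq U p f with h3 | h3 <;> rcases occ_eq U (p + 1) f with h4 | h4 <;>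
      by_cases h5 : |cnt U (p + 1) f - k| < T <;> simp [h3, h4, h5]
  have h3 : ex (fun f => 2 * (T : ℝ) * (bend U L ℓ f - max 0 (bend U L ℓ f))) ≤
      ex (fun f => bend U L ℓ f * ψ (cnt U (p + 1) f)) := by
    refine ex_mono fun f => ?_
    have h4 := hψ0 (cnt U (p + 1) f)
    have h5 := hψT (cnt U (p + 1) f)
    rcases max_cases 0 (bend U L ℓ f) with h | h
    · rw [h.1]; nlinarith
    · rw [h.1]; nlinarith
  rw [ex_mul, ex_sub] at h3
  have h4 := ex_max_bend_le hU hp hm hℓ hn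
  rw [h2] at h1
  have h5 : 2 * (T : ℝ) * ex (fun f => max 0 (bend U L ℓ f)) ≤ 2 * T * (2 * m) := by gcongr
  linarith

lemma neg_ex_bend_le (hU : ∀ u ∈ U, ∀ v, u < v → v ∈ U) {L ℓ : ℕ} (hℓ : 1 ≤ ℓ)
    (hn : L + ℓ + ℓ ≤ Fintype.card Q) :
    -ex (bend U L ℓ) ≤ ℓ * (ex (occ U (L + ℓ + ℓ - 1)) - ex (occ U L)) := by
  have e : ex (bend U L ℓ) = ∑ a ∈ Finset.Ico L (L + ℓ), ex (occ U a) -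
      ∑ a ∈ Finset.Ico (L + ℓ) (L + ℓ + ℓ), ex (occ U a) := by
    rw [← ex_sum, ← ex_sum, ← ex_sub]
    exact congrArg ex (funext fun f => bend_eq U L ℓ f)
  have h3 := Finset.card_nsmul_le_sum (Finset.Ico L (L + ℓ)) (fun a => ex (occ U a))
      (ex (occ U L)) fun a ha => by
        rw [Finset.mem_Ico] at ha
        exact ex_occ_mono hU ha.1 (by omega)
  have h4 := Finset.sum_le_card_nsmul (Finset.Ico (L + ℓ) (L + ℓ + ℓ)) (fun a => ex (occ U a))
      (ex (occ U (L + ℓ + ℓ - 1))) fun a ha => by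
        rw [Finset.mem_Ico] at ha
        exact ex_occ_mono hU (by omega) (by omega)
  rw [Nat.card_Ico, nsmul_eq_mul, show L + ℓ - L = ℓ by omega] at h3
  rw [Nat.card_Ico, nsmul_eq_mul, show L + ℓ + ℓ - (L + ℓ) = ℓ by omega] at h4
  rw [e]
  linarith

end

end Balance

namespace Balance

open scoped Classical

noncomputable section

variable {Q : Type*} [Fintype Q] [PartialOrder Q]

lemma mn_add_one_le_card (x : Q) : mn x + 1 ≤ Fintype.card Q := by
  rw [← ex_const (Q := Q) (Fintype.card Q : ℝ), ← ex_const (Q := Q) 1, mn, ← ex_add]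
  exact ex_mono fun f => by
    exact_mod_cast rk_lt_card f x

lemma mn_nonneg (x : Q) : 0 ≤ mn x := ex_nonneg fun _ => Nat.cast_nonneg _

lemma pb_ge_le {X : LinExt Q → ℝ} (hX : ∀ f, 0 ≤ X f) {a c : ℝ} (ha : 0 < a) (h : ex X ≤ c * a) :
    pb (fun f => a ≤ X f) ≤ c := by
  have := (markov hX a).trans h
  rw [mul_comm c] at this
  exact le_of_mul_le_mul_left this ha

lemma occ_of_mem {U : Finset Q} {u : Q} (hu : u ∈ U) (f : LinExt Q) : occ U (rk f u) f = 1 :=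
  if_pos ⟨u, hu, rfl⟩

lemma occ_of_notMem {U : Finset Q} {d : Q} (hd : d ∉ U) (f : LinExt Q) : occ U (rk f d) f = 0 :=
  if_neg fun ⟨_, hu, h⟩ => hd (rk_inj.1 h ▸ hu)

lemma exists_occ_jump {U : Finset Q} {f : LinExt Q} {a b : ℕ} (hab : a ≤ b) (ha : occ U a f = 0)
    (hb : occ U b f = 1) : ∃ p, a ≤ p ∧ p < b ∧ occ U p f = 0 ∧ occ U (p + 1) f = 1 := by
  induction b, hab using Nat.le_induction with
  | base => rw [ha] at hb; norm_num at hb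
  | succ b hab ih =>
    rcases occ_eq U b f with h | h
    · exact ⟨b, hab, by omega, h, hb⟩
    · obtain ⟨p, h1, h2, h3⟩ := ih h
      exact ⟨p, h1, by omega, h3⟩

lemma abs_cnt_sub_le (U : Finset Q) (i j : ℕ) (f : LinExt Q) :
    |cnt U i f - cnt U j f| ≤ |(i : ℝ) - j| := by
  have key : ∀ i j : ℕ, i ≤ j → |cnt U j f - cnt U i f| ≤ |(j : ℝ) - i| := by
    intro i j h
    rw [abs_of_nonneg (sub_nonneg.2 (cnt_mono U h f)), cnt_sub_eq_sum U h f]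
    refine (Finset.sum_le_card_nsmul _ _ 1 fun a _ => occ_le_one U a f).trans ?_
    rw [Nat.card_Ico, nsmul_eq_mul, mul_one, Nat.cast_sub h]
    exact le_abs_self _
  rcases le_total i j with h | h
  · rw [abs_sub_comm, abs_sub_comm (i : ℝ)]
    exact key i j h
  · exact key j i h

variable [BoundedOrder Q]

lemma exists_mn_near_below {D z : ℝ} (hD : Steps Q D) {y : Q} (h : z < mn y) (hz : mn (⊥ : Q) ≤ z) :
    ∃ d, d ≤ y ∧ z - D < mn d ∧ mn d ≤ z := by
  obtain ⟨s, hs⟩ := (Set.toFinite {s : Q | s ≤ y ∧ z < mn s}).exists_minimal ⟨y, le_rfl, h⟩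
  have hsb : s ≠ ⊥ := by
    rintro rfl
    linarith [hs.prop.2]
  obtain ⟨d, hds, hd⟩ := hD.2 s hsb
  have hsy := hs.prop.1
  refine ⟨d, hds.le.trans hsy, by linarith [hs.prop.2], ?_⟩
  by_contra! hc
  exact hs.not_prop_of_lt hds ⟨hds.le.trans hsy, hc⟩

lemma exists_mn_near_above {D z : ℝ} (hD : Steps Q D) {x : Q} (h : mn x < z) (hz : z ≤ mn (⊤ : Q)) :
    ∃ u, x ≤ u ∧ z ≤ mn u ∧ mn u < z + D := by
  obtain ⟨s, hs⟩ := (Set.toFinite {s : Q | x ≤ s ∧ mn s < z}).exists_maximal ⟨x, le_rfl, h⟩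
  have hst : s ≠ ⊤ := by
    rintro rfl
    linarith [hs.prop.2]
  obtain ⟨u, hsu, hu⟩ := hD.1 s hst
  have hxs := hs.prop.1
  refine ⟨u, hxs.trans hsu.le, ?_, by linarith [hs.prop.2]⟩
  by_contra! hc
  exact hs.not_prop_of_gt hsu ⟨hxs.trans hsu.le, hc⟩

lemma rk_bot (f : LinExt Q) : rk f ⊥ = 0 := by
  obtain ⟨x, hx⟩ := exists_rk_eq f (Fintype.card_pos (α := Q))
  have := rk_le (f := f) (bot_le (a := x))
  omega

lemma mn_bot : mn (⊥ : Q) = 0 := by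
  rw [← ex_const (Q := Q) 0]
  refine congrArg ex (funext fun f => ?_)
  rw [rk_bot, Nat.cast_zero]

/-- Near every mean level between those of two incomparable elements there is a fixed position at
which, with probability bounded below, the extension enters the upper set of `x`, while the number
of elements of that upper set seen so far is confined to a bounded window. -/
lemma exists_jump_position {ε : ℝ} (hε : 0 < ε) (hU : Unbalanced Q ε) {D Λ W T : ℕ}
    (hD : Steps Q D) (hΛ1 : 1 ≤ Λ) (hΛ : ∀ c : Q, ∑ e, min (pr e c) (pr c e) ≤ Λ)
    (hW : W = 2 * D + 32 * Λ) (hT : T = 4 * W * (3 * Λ + W)) {x y : Q} (hxy : ¬ x ≤ y) {A : ℕ}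
    (hx : mn x < A + D + 24 * Λ) (hy : A + D + 24 * Λ ≤ mn y) :
    ∃ p k : ℕ, A ≤ p ∧ p < A + W ∧
      1 ≤ 4 * W * pb (fun f => occ (Finset.univ.filter (x ≤ ·)) p f = 0 ∧
        occ (Finset.univ.filter (x ≤ ·)) (p + 1) f = 1 ∧
        |cnt (Finset.univ.filter (x ≤ ·)) (p + 1) f - k| < T) := by
  set U : Finset Q := Finset.univ.filter (x ≤ ·) with hUdef
  have hΛ1' : (1 : ℝ) ≤ Λ := by exact_mod_cast hΛ1
  have hD0 : (0 : ℝ) ≤ D := Nat.cast_nonneg _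
  have hA0 : (0 : ℝ) ≤ A := Nat.cast_nonneg _
  have hWr : (W : ℝ) = 2 * D + 32 * Λ := by rw [hW]; push_cast; ring
  have hTr : (T : ℝ) = 4 * W * (3 * Λ + W) := by rw [hT]; push_cast; ring
  obtain ⟨d, hdy, hd1, hd2⟩ := exists_mn_near_below (z := A + D + 8 * Λ) hD (y := y)
    (by linarith) (by rw [mn_bot]; positivity)
  obtain ⟨u, hxu, hu1, hu2⟩ := exists_mn_near_above (z := A + D + 24 * Λ) hD hx
    (hy.trans (mn_le le_top))
  have hdU : d ∉ U := fun h => hxy ((Finset.mem_filter.1 h).2.trans hdy)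
  have huU : u ∈ U := Finset.mem_filter.2 ⟨Finset.mem_univ _, hxu⟩
  have conc : ∀ c : Q, pb (fun f => 8 * (Λ : ℝ) ≤ |(rk f c : ℝ) - mn c|) ≤ 1 / 4 := fun c =>
    pb_ge_le (fun f => abs_nonneg _) (by linarith)
      ((ex_abs_rk_sub_mn_le hε hU (hΛ c)).trans (by linarith))
  set G : ℕ → LinExt Q → Prop := fun p f => occ U p f = 0 ∧ occ U (p + 1) f = 1 with hG
  have half : 1 / 2 ≤ pb (fun f => ∃ p ∈ Finset.Ico A (A + W), G p f) := by
    have h1 := pb_not fun f : LinExt Q => ∃ p ∈ Finset.Ico A (A + W), G p f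
    have h2 : pb (fun f : LinExt Q => ¬ ∃ p ∈ Finset.Ico A (A + W), G p f) ≤ _ :=
      pb_or_le (B := fun f => 8 * (Λ : ℝ) ≤ |(rk f d : ℝ) - mn d|)
        (C := fun f => 8 * (Λ : ℝ) ≤ |(rk f u : ℝ) - mn u|) fun f hf => by
          by_contra! hc
          obtain ⟨hc1, hc2⟩ := hc
          rw [abs_lt] at hc1 hc2
          have e1 : A < rk f d := by
            have : (A : ℝ) < rk f d := by linarith
            exact_mod_cast this
          have e2 : rk f d ≤ rk f u := by
            have : (rk f d : ℝ) ≤ rk f u := by linarith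
            exact_mod_cast this
          have e3 : rk f u < A + W := by
            have : (rk f u : ℝ) < A + W := by linarith
            exact_mod_cast this
          obtain ⟨p, q1, q2, q3⟩ := exists_occ_jump e2 (occ_of_notMem hdU f) (occ_of_mem huU f)
          exact hf ⟨p, Finset.mem_Ico.2 ⟨by omega, by omega⟩, q3⟩
    linarith [conc d, conc u]
  have hW0 : (0 : ℝ) < W := by linarith
  obtain ⟨p, hp, hpG⟩ : ∃ p ∈ Finset.Ico A (A + W), 1 / (2 * W) ≤ pb (G p) := by
    have h1 : ∑ p ∈ Finset.Ico A (A + W), (1 / (2 * W) : ℝ) ≤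
        ∑ p ∈ Finset.Ico A (A + W), pb (G p) := by
      refine le_trans (le_of_eq ?_) (half.trans (pb_exists_le _ G fun f hf => hf))
      rw [Finset.sum_const, Nat.card_Ico, nsmul_eq_mul, Nat.add_sub_cancel_left]
      field_simp
    refine Finset.exists_le_of_sum_le (Finset.nonempty_Ico.2 ?_) h1
    have : 0 < W := by exact_mod_cast hW0
    omega
  rw [Finset.mem_Ico] at hp
  have hp1 : (A : ℝ) ≤ p := by exact_mod_cast hp.1
  have hp2 : (p : ℝ) + 1 ≤ A + W := by exact_mod_cast hp.2
  refine ⟨p, (U.filter fun e => 1 / 2 + ε ≤ pr e d).card, hp.1, hp.2, ?_⟩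
  set k : ℝ := ((U.filter fun e => 1 / 2 + ε ≤ pr e d).card : ℝ) with hk
  have hcount : ex (fun f => |cnt U (p + 1) f - k|) ≤ 3 * Λ + W := by
    have h1 : ex (fun f => |cnt U (rk f d) f - k|) ≤ Λ := ex_abs_count_sub_le hε hU (hΛ d) U
    have h2 := ex_abs_rk_sub_mn_le hε hU (hΛ d)
    have h3 : |(p : ℝ) + 1 - mn d| ≤ W := by
      rw [abs_le]
      constructor <;> linarith
    have h4 : ex (fun f => |cnt U (p + 1) f - k|) ≤
        ex (fun f => (|cnt U (rk f d) f - k| + |(rk f d : ℝ) - mn d|) + W) := ex_mono fun f => by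
      have a1 := abs_cnt_sub_le U (p + 1) (rk f d) f
      have a2 := abs_sub_le (cnt U (p + 1) f) (cnt U (rk f d) f) k
      have a3 := abs_sub_le ((p : ℝ) + 1) (mn d) (rk f d)
      rw [abs_sub_comm (mn d)] at a3
      push_cast at a1
      linarith
    rw [ex_add, ex_add, ex_const] at h4
    linarith
  have hT0 : (0 : ℝ) < T := by rw [hTr]; positivity
  have hbad : pb (fun f => (T : ℝ) ≤ |cnt U (p + 1) f - k|) ≤ 1 / (4 * W) := by
    refine pb_ge_le (fun f => abs_nonneg _) hT0 (hcount.trans (le_of_eq ?_))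
    rw [hTr]
    field_simp
  have hsplit : pb (G p) ≤ _ :=
    pb_or_le (B := fun f => occ U p f = 0 ∧ occ U (p + 1) f = 1 ∧ |cnt U (p + 1) f - k| < T)
      (C := fun f => (T : ℝ) ≤ |cnt U (p + 1) f - k|) fun f hf => by
        rcases lt_or_ge (|cnt U (p + 1) f - k|) T with h | h
        · exact Or.inl ⟨hf.1, hf.2, h⟩
        · exact Or.inr h
  have hfin : 1 / (4 * (W : ℝ)) ≤
      pb (fun f => occ U p f = 0 ∧ occ U (p + 1) f = 1 ∧ |cnt U (p + 1) f - k| < T) := by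
    have : 1 / (2 * (W : ℝ)) = 1 / (4 * W) + 1 / (4 * W) := by field_simp; norm_num
    linarith
  rwa [div_le_iff₀ (by positivity), mul_comm] at hfin

lemma mn_sub_lt_of_not_le {ε : ℝ} (hε : 0 < ε) (hU : Unbalanced Q ε) {D Λ W T m ℓ : ℕ}
    (hD : Steps Q D) (hΛ1 : 1 ≤ Λ) (hΛ : ∀ c : Q, ∑ e, min (pr e c) (pr c e) ≤ Λ)
    (hW : W = 2 * D + 32 * Λ) (hT : T = 4 * W * (3 * Λ + W)) (hm : m = 16 * T * W + 1)
    (hℓ : ℓ = 2 * m ^ 2) {x y : Q} (hxy : ¬ x ≤ y) :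
    mn y < mn x + (1 + ℓ + m * (2 * ℓ + W) + D + 24 * Λ) := by
  by_contra! hc
  set U : Finset Q := Finset.univ.filter (x ≤ ·) with hUdef
  have hup : ∀ u ∈ U, ∀ v, u < v → v ∈ U := fun u hu v huv =>
    Finset.mem_filter.2 ⟨Finset.mem_univ _, (Finset.mem_filter.1 hu).2.trans huv.le⟩
  have hm1 : 1 ≤ m := by omega
  have hℓ1 : 1 ≤ ℓ := by rw [hℓ]; nlinarith
  obtain ⟨C, hCdef⟩ : ∃ C : ℕ, C = ⌈mn x⌉₊ := ⟨_, rfl⟩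
  have hC1 : mn x ≤ C := by rw [hCdef]; exact Nat.le_ceil _
  have hC2 : (C : ℝ) < mn x + 1 := by rw [hCdef]; exact Nat.ceil_lt_add_one (mn_nonneg x)
  obtain ⟨B, hB⟩ : ∃ B, B = 2 * ℓ + W := ⟨_, rfl⟩
  have hBr : (B : ℝ) = 2 * ℓ + W := by rw [hB]; push_cast; ring
  rw [← hBr] at hc
  have hΛ1' : (1 : ℝ) ≤ Λ := by exact_mod_cast hΛ1
  have hD0 : (0 : ℝ) ≤ D := Nat.cast_nonneg _
  have hℓ0 : (1 : ℝ) ≤ ℓ := by exact_mod_cast hℓ1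
  have hcard : C + m * B + ℓ < Fintype.card Q := by
    have := mn_add_one_le_card y
    have : (C : ℝ) + m * B + ℓ < Fintype.card Q := by linarith
    exact_mod_cast this
  have hjB : ∀ j, j < m → j * B + B ≤ m * B := fun j hj => by
    rw [← Nat.succ_mul]
    exact Nat.mul_le_mul_right _ hj
  have hpos : ∀ j : ℕ, ∃ p k : ℕ, j < m → C + ℓ + j * B ≤ p ∧ p < C + ℓ + j * B + W ∧
      1 ≤ 4 * W * pb (fun f => occ U p f = 0 ∧ occ U (p + 1) f = 1 ∧
        |cnt U (p + 1) f - k| < T) := by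
    intro j
    by_cases hj : j < m
    · have h1 : (j : ℝ) * B + B ≤ m * B := by exact_mod_cast hjB j hj
      have h2 : (0 : ℝ) ≤ j * B := by positivity
      have h3 : (0 : ℝ) ≤ B := by positivity
      obtain ⟨p, k, h⟩ := exists_jump_position hε hU hD hΛ1 hΛ hW hT hxy (A := C + ℓ + j * B)
        (by push_cast; linarith) (by push_cast; linarith)
      exact ⟨p, k, fun _ => h⟩
    · exact ⟨0, 0, fun h => absurd h hj⟩
  choose p k hp using hpos
  have hm0 : (0 : ℝ) < m := by exact_mod_cast hm1
  have htel : ∑ j ∈ Finset.range m, (ex (occ U (p j + ℓ)) - ex (occ U (p j + 1 - ℓ))) ≤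
      ∑ j ∈ Finset.range m, (1 / m : ℝ) := by
    have h1 : ∑ j ∈ Finset.range m, (ex (occ U (p j + ℓ)) - ex (occ U (p j + 1 - ℓ))) ≤
        ∑ j ∈ Finset.range m, (ex (occ U (C + (j + 1) * B)) - ex (occ U (C + j * B))) := by
      refine Finset.sum_le_sum fun j hj => ?_
      rw [Finset.mem_range] at hj
      obtain ⟨a1, a2, -⟩ := hp j hj
      have h3 := hjB j hj
      have h2 : (j + 1) * B = j * B + B := Nat.succ_mul _ _
      exact sub_le_sub (ex_occ_mono hup (by omega) (by omega))
        (ex_occ_mono hup (by omega) (by omega))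
    rw [Finset.sum_range_sub (fun j => ex (occ U (C + j * B)))] at h1
    refine h1.trans ?_
    rw [Finset.sum_const, Finset.card_range, nsmul_eq_mul, mul_one_div_cancel hm0.ne']
    have h2 : ex (occ U (C + m * B)) ≤ 1 := by
      rw [← ex_const (Q := Q) 1]
      exact ex_mono fun f => occ_le_one _ _ f
    have h3 : 0 ≤ ex (occ U (C + 0 * B)) := ex_nonneg fun f => occ_nonneg _ _ f
    linarith
  obtain ⟨j, hj, hjm⟩ := Finset.exists_le_of_sum_le ⟨0, Finset.mem_range.2 hm1⟩ htel
  rw [Finset.mem_range] at hj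
  obtain ⟨a1, a2, a3⟩ := hp j hj
  have h3 := hjB j hj
  have hwin := pb_window_le hup (L := p j + 1 - ℓ) (ℓ := ℓ) (p := p j) (by omega) hm1 hℓ
    (by omega) (k j) T
  have hbend := neg_ex_bend_le hup (L := p j + 1 - ℓ) hℓ1 (by omega)
  rw [show p j + 1 - ℓ + ℓ + ℓ - 1 = p j + ℓ by omega] at hbend
  set P := pb (fun f => occ U (p j) f = 0 ∧ occ U (p j + 1) f = 1 ∧
    |cnt U (p j + 1) f - k j| < T) with hP
  have hmr : (m : ℝ) = 16 * T * W + 1 := by rw [hm]; push_cast; ring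
  have hℓr : (ℓ : ℝ) = 2 * (m : ℝ) ^ 2 := by rw [hℓ]; push_cast; ring
  have hb2 : -ex (bend U (p j + 1 - ℓ) ℓ) ≤ 2 * m := by
    refine hbend.trans ((mul_le_mul_of_nonneg_left hjm (by linarith)).trans (le_of_eq ?_))
    rw [hℓr]
    field_simp
  have h4 : ℓ * P ≤ 2 * T * (4 * m) :=
    hwin.trans (mul_le_mul_of_nonneg_left (by linarith) (by positivity))
  have h5 : (m : ℝ) * P ≤ 4 * T := by
    rw [hℓr] at h4
    refine le_of_mul_le_mul_left (a := 2 * (m : ℝ)) ?_ (by positivity)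
    linarith
  have h6 : (m : ℝ) ≤ 4 * W * (4 * T) := by
    calc (m : ℝ) = m * 1 := by ring
      _ ≤ m * (4 * W * P) := by gcongr
      _ = 4 * W * (m * P) := by ring
      _ ≤ _ := by gcongr
  linarith

end

universe u

/-- In an unbalanced bounded poset of bounded width, incomparable elements have nearby mean
positions. -/
theorem exists_mn_dist_le (w : ℕ) (hw1 : 1 ≤ w) (ε : ℝ) (hε : 0 < ε) (hε2 : ε ≤ 1 / 2) :
    ∃ K : ℝ, 0 ≤ K ∧
      ∀ (Q : Type u) [Fintype Q] [PartialOrder Q] [BoundedOrder Q] [Nontrivial Q],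
      WidthLE Q w → Unbalanced Q ε → ∀ x y : Q, ¬ x ≤ y → mn y ≤ mn x + K := by
  obtain ⟨D, Λ, hD1, hΛ1, h⟩ := exists_concentration.{u} w hw1 ε hε hε2
  obtain ⟨D', hD'⟩ := exists_nat_ge D
  obtain ⟨Λ', hΛ'⟩ := exists_nat_ge Λ
  have hΛ1' : 1 ≤ Λ' := by exact_mod_cast hΛ1.trans hΛ'
  obtain ⟨W, hW⟩ : ∃ W, W = 2 * D' + 32 * Λ' := ⟨_, rfl⟩
  obtain ⟨T, hT⟩ : ∃ T, T = 4 * W * (3 * Λ' + W) := ⟨_, rfl⟩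
  obtain ⟨m, hm⟩ : ∃ m, m = 16 * T * W + 1 := ⟨_, rfl⟩
  obtain ⟨ℓ, hℓ⟩ : ∃ ℓ, ℓ = 2 * m ^ 2 := ⟨_, rfl⟩
  refine ⟨1 + ℓ + m * (2 * ℓ + W) + D' + 24 * Λ', by positivity, ?_⟩
  intro Q _ _ _ _ hw hU x y hxy
  obtain ⟨⟨s1, s2⟩, -, hsum⟩ := h Q hw hU
  have hS : Steps Q D' := by
    refine ⟨fun u hu => ?_, fun u hu => ?_⟩
    · obtain ⟨v, a, b⟩ := s1 u hu
      exact ⟨v, a, b.trans hD'⟩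
    · obtain ⟨v, a, b⟩ := s2 u hu
      exact ⟨v, a, b.trans hD'⟩
  exact (mn_sub_lt_of_not_le hε hU hS hΛ1' (fun c => (hsum c).trans hΛ') hW hT hm hℓ hxy).le

end Balance

namespace Balance

open scoped Classical

noncomputable section

variable {β : Type*}

lemma card_withBot_withTop [Fintype β] : Fintype.card (WithBot (WithTop β)) = Fintype.card β + 2 := by
  rw [show Fintype.card (WithBot (WithTop β)) = Fintype.card (WithTop β) + 1 from
    Fintype.card_option, show Fintype.card (WithTop β) = Fintype.card β + 1 from
    Fintype.card_option]

/-- The inclusion of a poset into the poset with a bottom and a top adjoined. -/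
def emb (x : β) : WithBot (WithTop β) := ((x : WithTop β) : WithBot (WithTop β))

lemma emb_inj {x y : β} : emb x = emb y ↔ x = y := by simp [emb]

lemma emb_cases (z : WithBot (WithTop β)) : z = ⊥ ∨ z = ⊤ ∨ ∃ x, z = emb x := by
  induction z using WithBot.recBotCoe with
  | bot => exact Or.inl rfl
  | coe z =>
    induction z using WithTop.recTopCoe with
    | top => exact Or.inr (Or.inl rfl)
    | coe x => exact Or.inr (Or.inr ⟨x, rfl⟩)

variable [PartialOrder β]

lemma emb_lt {x y : β} : emb x < emb y ↔ x < y := by simp [emb]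

lemma emb_le {x y : β} : emb x ≤ emb y ↔ x ≤ y := by simp [emb]

lemma bot_lt_emb (x : β) : ⊥ < emb x := WithBot.bot_lt_coe _

lemma emb_lt_top (x : β) : emb x < ⊤ := WithBot.coe_lt_coe.2 (WithTop.coe_lt_top x)

variable [Fintype β]

/-- The linear extension with prescribed positions. -/
def ofRk (r : β → ℕ) (hr : Function.Injective r) (hlt : ∀ x, r x < Fintype.card β)
    (hm : ∀ x y, x < y → r x < r y) : LinExt β :=
  ⟨Equiv.ofBijective (fun x => (⟨r x, hlt x⟩ : Fin (Fintype.card β)))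
    ((Fintype.bijective_iff_injective_and_card _).2
      ⟨fun _ _ h => hr (Fin.mk.inj h), (Fintype.card_fin _).symm⟩), fun x y h => hm x y h⟩

/-- The positions in the extension of `f` to the poset with a bottom and a top adjoined. -/
def liftRk (f : LinExt β) : WithBot (WithTop β) → ℕ :=
  WithBot.recBotCoe 0 (WithTop.recTopCoe (Fintype.card β + 1) fun x => rk f x + 1)

lemma liftRk_bot (f : LinExt β) : liftRk f ⊥ = 0 := rfl

lemma liftRk_top (f : LinExt β) : liftRk f ⊤ = Fintype.card β + 1 := rfl

lemma liftRk_emb (f : LinExt β) (x : β) : liftRk f (emb x) = rk f x + 1 := rfl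

/-- The extension of `f` to the poset with a bottom and a top adjoined. -/
def lift (f : LinExt β) : LinExt (WithBot (WithTop β)) := by
  refine ofRk (liftRk f) (fun y z h => ?_) (fun z => ?_) (fun y z h => ?_)
  · rcases emb_cases y with rfl | rfl | ⟨y, rfl⟩ <;> rcases emb_cases z with rfl | rfl | ⟨z, rfl⟩ <;>
      simp only [liftRk_bot, liftRk_top, liftRk_emb] at h
    · rfl
    · omega
    · omega
    · omega
    · rfl
    · have := rk_lt_card f z; omega
    · omega
    · have := rk_lt_card f y; omega
    · rw [rk_inj.1 (Nat.succ.inj h)]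
  · rw [card_withBot_withTop]
    rcases emb_cases z with rfl | rfl | ⟨z, rfl⟩
    · rw [liftRk_bot]; omega
    · rw [liftRk_top]; omega
    · rw [liftRk_emb]; have := rk_lt_card f z; omega
  · rcases emb_cases y with rfl | rfl | ⟨y, rfl⟩
    · rcases emb_cases z with rfl | rfl | ⟨z, rfl⟩
      · exact absurd h (lt_irrefl _)
      · rw [liftRk_bot, liftRk_top]; omega
      · rw [liftRk_bot, liftRk_emb]; omega
    · exact absurd h not_top_lt
    · rcases emb_cases z with rfl | rfl | ⟨z, rfl⟩
      · exact absurd h not_lt_bot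
      · rw [liftRk_emb, liftRk_top]; have := rk_lt_card f y; omega
      · rw [liftRk_emb, liftRk_emb]; have := rk_lt (f := f) (emb_lt.1 h); omega

lemma rk_lift (f : LinExt β) (x : β) : rk (lift f) (emb x) = rk f x + 1 := rfl

lemma lift_bijective : Function.Bijective (lift : LinExt β → _) := by
  refine ⟨fun f g h => ext_rk fun x => ?_, fun g => ?_⟩
  · have := rk_lift f x
    rw [h, rk_lift] at this
    omega
  · have h0 : rk g ⊥ = 0 := rk_bot g
    have hlow : ∀ x : β, 0 < rk g (emb x) := fun x => by
      have := rk_lt (f := g) (bot_lt_emb x)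
      omega
    have hhigh : ∀ x : β, rk g (emb x) < Fintype.card β + 1 := fun x => by
      have h1 := rk_lt (f := g) (emb_lt_top x)
      have h2 := rk_lt_card g ⊤
      rw [card_withBot_withTop] at h2
      omega
    refine ⟨ofRk (fun x => rk g (emb x) - 1) (fun x y h => ?_) (fun x => ?_) (fun x y h => ?_),
      ext_rk fun z => ?_⟩
    · have h1 := hlow x
      have h2 := hlow y
      have h3 : rk g (emb x) = rk g (emb y) := by dsimp only at h; omega
      exact emb_inj.1 (rk_inj.1 h3)
    · have h1 := hlow x
      have h2 := hhigh x
      omega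
    · have h1 := hlow x
      have h2 := rk_lt (f := g) (emb_lt.2 h)
      omega
    · rcases emb_cases z with rfl | rfl | ⟨z, rfl⟩
      · rw [rk_bot, rk_bot]
      · obtain ⟨y, hy⟩ := exists_rk_eq g (j := Fintype.card β + 1) (by
          rw [card_withBot_withTop]; omega)
        have h1 := rk_le (f := g) (le_top (a := y))
        have h2 := rk_lt_card g ⊤
        rw [card_withBot_withTop] at h2
        change Fintype.card β + 1 = _
        omega
      · rw [rk_lift]
        change rk g (emb z) - 1 + 1 = _
        have := hlow z
        omega

lemma pr_emb (x y : β) : pr (emb x) (emb y) = pr x y := by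
  let e := Equiv.ofBijective (lift : LinExt β → _) lift_bijective
  unfold pr pb ex
  rw [← Fintype.card_congr e, ← e.sum_comp]
  congr 1
  refine Finset.sum_congr rfl fun f _ => ?_
  have : (rk (e f) (emb x) < rk (e f) (emb y)) ↔ rk f x < rk f y := Nat.add_lt_add_iff_right
  simp only [this]
  congr

lemma unbalanced_withBot_withTop {ε : ℝ} (hε : ε ≤ 1 / 2)
    (h : ∀ x y : β, x ≠ y → min (pr x y) (pr y x) ≤ 1 / 2 - ε) :
    Unbalanced (WithBot (WithTop β)) ε := by
  intro x y hxy
  have key : x < y ∨ y < x → 1 / 2 + ε ≤ pr x y ∨ pr x y ≤ 1 / 2 - ε := by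
    rintro (h | h)
    · rw [pr_of_lt h]; exact Or.inl (by linarith)
    · rw [pr_of_gt h.le]; exact Or.inr (by linarith)
  rcases emb_cases x with rfl | rfl | ⟨x, rfl⟩
  · exact key (Or.inl (bot_lt_iff_ne_bot.2 hxy.symm))
  · exact key (Or.inr (lt_top_iff_ne_top.2 hxy.symm))
  · rcases emb_cases y with rfl | rfl | ⟨y, rfl⟩
    · exact key (Or.inr (bot_lt_emb x))
    · exact key (Or.inl (emb_lt_top x))
    · have hxy' : x ≠ y := fun h => hxy (congrArg emb h)
      rw [pr_emb]
      have h1 := pr_add hxy'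
      rcases min_le_iff.1 (h x y hxy') with h2 | h2
      · exact Or.inr h2
      · exact Or.inl (by linarith)

lemma widthLE_withBot_withTop {w : ℕ} (hw1 : 1 ≤ w) (hw : WidthLE β w) :
    WidthLE (WithBot (WithTop β)) w := by
  intro A hA
  by_cases hb : ⊥ ∈ A
  · have : A ⊆ {⊥} := fun z hz => Finset.mem_singleton.2 (by
      by_contra hne
      exact hA hb hz (Ne.symm hne) bot_le)
    exact (Finset.card_le_card this).trans (by rwa [Finset.card_singleton])
  by_cases ht : ⊤ ∈ A
  · have : A ⊆ {⊤} := fun z hz => Finset.mem_singleton.2 (by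
      by_contra hne
      exact hA hz ht hne le_top)
    exact (Finset.card_le_card this).trans (by rwa [Finset.card_singleton])
  have hsub : A ⊆ (Finset.univ.filter fun x : β => emb x ∈ A).image emb := fun z hz => by
    rcases emb_cases z with rfl | rfl | ⟨x, rfl⟩
    · exact absurd hz hb
    · exact absurd hz ht
    · exact Finset.mem_image_of_mem _ (Finset.mem_filter.2 ⟨Finset.mem_univ _, hz⟩)
  refine (Finset.card_le_card hsub).trans (Finset.card_image_le.trans (hw _ ?_))
  intro x hx y hy hxy hle
  exact hA (Finset.mem_filter.1 hx).2 (Finset.mem_filter.1 hy).2 (fun h => hxy (emb_inj.1 h))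
    (emb_le.2 hle)

lemma piVal_le {w : ℕ} (hw : WidthLE (WithBot (WithTop β)) w) {K : ℝ} (hK : 0 ≤ K)
    (h : ∀ x y : WithBot (WithTop β), ¬ x ≤ y → mn y ≤ mn x + K) (x : β) :
    (piVal x : ℝ) ≤ w * (2 * K + 1) := by
  have h1 := card_le_of_interval hw
    (S := (Finset.univ.filter fun y : β => ¬ x ≤ y ∧ ¬ y ≤ x).image emb) (L := 2 * K)
    (z := mn (emb x) - K) (by linarith) fun z hz => by
      obtain ⟨y, hy, rfl⟩ := Finset.mem_image.1 hz
      obtain ⟨a, b⟩ := (Finset.mem_filter.1 hy).2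
      have h1 := h _ _ (mt emb_le.1 a)
      have h2 := h _ _ (mt emb_le.1 b)
      constructor <;> linarith
  rw [Finset.card_image_of_injective _ fun _ _ h => emb_inj.1 h] at h1
  rwa [piVal, Nat.card_eq_fintype_card, Fintype.card_subtype]

end

end Balance

/-- for fixed width bound `w` and `ε > 0` there is `K` such that every finite
poset with `w(P) ≤ w` and `π(P) ≥ K` satisfies `δ(P) > 1/2 - ε`. -/
theorem stmt_2 (w : ℕ) (hw : 1 ≤ w) (ε : ℝ) (hε : 0 < ε) :
    ∃ K : ℝ,
      ∀ (β : Type) [Fintype β] [PartialOrder β],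
        (∀ A : Finset β, IsAntichain (· ≤ ·) (A : Set β) → A.card ≤ w) →
        (∃ x : β, K ≤ (piVal x : ℝ)) →
        ∃ x y : β, x ≠ y ∧ 1 / 2 - ε < min (prLT x y) (prLT y x) := by
  obtain ⟨K, hK, h⟩ := Balance.exists_mn_dist_le.{0} w hw (min ε (1 / 2)) (by positivity)
    (min_le_right _ _)
  refine ⟨w * (2 * K + 1) + 1, fun β _ _ hwidth ⟨x, hx⟩ => ?_⟩
  by_contra! hbal
  have hw' := Balance.widthLE_withBot_withTop hw hwidth
  have hU : Balance.Unbalanced (WithBot (WithTop β)) (min ε (1 / 2)) :=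
    Balance.unbalanced_withBot_withTop (min_le_right _ _) fun x y hxy => by
      rw [← Balance.prLT_eq, ← Balance.prLT_eq]
      exact (hbal x y hxy).trans (by linarith [min_le_left ε (1 / 2)])
  linarith [Balance.piVal_le hw' hK (h _ hw' hU) x]
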